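/- arXiv:2106.11703 — 2 statements merged into one kernel-verified Lean document; each statement's English description precedes it below -/
import Mathlib

section
/- If a topological space A is k-connected and a topological space B is l-connected, then the join A * B is (k+l+1)-connected. -/
/-- The relation defining the topological join: `(a,b,0) ~ (a,b',0)` and `(a,b,1) ~ (a',b,1)`. -/
inductive JoinRel (A B : Type*) : A × B × unitInterval → A × B × unitInterval → Prop
  | zero (a : A) (b b' : B) : JoinRel A B (a, b, 0) (a, b', 0)
  | one (a a' : A) (b : B) : JoinRel A B (a, b, 1) (a', b, 1)

/-- The topological join `A * B`, as a quotient of `A × B × [0,1]`. -/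
def TopJoin (A B : Type*) : Type _ := Quot (JoinRel A B)

instance (A B : Type*) [TopologicalSpace A] [TopologicalSpace B] :
    TopologicalSpace (TopJoin A B) :=
  inferInstanceAs (TopologicalSpace (Quot _))

/-- A space is `n`-connected (for `n : ℤ`) if it is nonempty and all homotopy
groups in dimensions `i ≤ n` (including `π₀`) are trivial;
`(-1)`-connected just means nonempty. -/
def NConnected (n : ℤ) (X : Type*) [TopologicalSpace X] : Prop :=
  Nonempty X ∧ ∀ (i : ℕ) (x : X), (i : ℤ) ≤ n → Subsingleton (HomotopyGroup (Fin i) X x)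

open Metric Set

lemma contOn_union_closed {X Y : Type*} [TopologicalSpace X] [TopologicalSpace Y] {s t : Set X}
    {f : X → Y} (hs : IsClosed s) (ht : IsClosed t) (h1 : ContinuousOn f s)
    (h2 : ContinuousOn f t) : ContinuousOn f (s ∪ t) := by
  have := (locallyFinite_of_finite (fun b : Bool => cond b s t)).continuousOn_iUnion (g := f)
    (by rintro (_|_) <;> assumption) (by rintro (_|_) <;> assumption)
  rwa [← Set.union_eq_iUnion] at this

/-- `g` (restricted to the sphere of radius `R`) extends to the ball. -/
def ExtB {X : Type*} [TopologicalSpace X] {m : ℕ} (R : ℝ) (g : (Fin m → ℝ) → X) : Prop :=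
  ∃ G : (Fin m → ℝ) → X, ContinuousOn G (closedBall 0 R) ∧ EqOn G g (sphere 0 R)

/-- Extension property in dimension `m`. -/
def EP (m : ℕ) (X : Type*) [TopologicalSpace X] : Prop :=
  ∀ g : (Fin m → ℝ) → X, ContinuousOn g (sphere 0 1) → ExtB 1 g

lemma ExtB.hep {X : Type*} [TopologicalSpace X] {m : ℕ} {R : ℝ} (hR : 0 < R)
    {F g : (Fin m → ℝ) → X} (hF : ExtB R F) (H : (Fin m → ℝ) → ℝ → X)
    (hH : ContinuousOn (fun z : (Fin m → ℝ) × ℝ => H z.1 z.2) (sphere 0 R ×ˢ Icc 0 1))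
    (h0 : ∀ x ∈ sphere (0 : Fin m → ℝ) R, H x 0 = g x)
    (h1 : ∀ x ∈ sphere (0 : Fin m → ℝ) R, H x 1 = F x) : ExtB R g := by
  obtain ⟨F', hF', hFF⟩ := hF
  refine ⟨fun x => if ‖x‖ ≤ R / 2 then F' ((2 : ℝ) • x) else H ((R / ‖x‖) • x) (2 - 2 * ‖x‖ / R),
    ?_, ?_⟩
  · have hsub : closedBall (0 : Fin m → ℝ) R ⊆
        {x | ‖x‖ ≤ R / 2} ∪ ({x | R / 2 ≤ ‖x‖} ∩ closedBall 0 R) := by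
      intro x hx
      rcases le_total ‖x‖ (R / 2) with h | h
      · exact Or.inl h
      · exact Or.inr ⟨h, hx⟩
    refine ContinuousOn.mono (contOn_union_closed (isClosed_le continuous_norm continuous_const)
      ((isClosed_le continuous_const continuous_norm).inter isClosed_closedBall) ?_ ?_) hsub
    · refine ContinuousOn.congr (f := fun x => F' ((2 : ℝ) • x)) ?_ ?_
      · refine hF'.comp (by fun_prop) ?_
        intro x hx
        simp only [mem_ofPred_eq] at hx
        simp only [mem_closedBall_zero_iff, norm_smul, Real.norm_ofNat]
        linarith
      · intro x hx
        exact if_pos hx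
    · refine ContinuousOn.congr (f := fun x => H ((R / ‖x‖) • x) (2 - 2 * ‖x‖ / R)) ?_ ?_
      · refine hH.comp (f := fun x => ((R / ‖x‖) • x, (2 - 2 * ‖x‖ / R))) ?_ ?_
        · refine ContinuousOn.prodMk (ContinuousOn.smul (continuousOn_const.div
            continuous_norm.continuousOn ?_) continuousOn_id) (by fun_prop)
          rintro x ⟨hx, -⟩ h
          simp only [mem_ofPred_eq] at hx
          linarith
        · rintro x ⟨hx, hx2⟩
          simp only [mem_ofPred_eq] at hx
          simp only [mem_closedBall_zero_iff] at hx2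
          have hpos : 0 < ‖x‖ := by linarith
          refine ⟨?_, ?_, ?_⟩
          · simp only [mem_sphere_zero_iff_norm, norm_smul, norm_div, Real.norm_eq_abs,
              abs_of_pos hR, abs_of_pos hpos]
            field_simp
          · have : 2 * ‖x‖ / R ≤ 2 := by rw [div_le_iff₀ hR]; linarith
            simp only; linarith
          · have : 1 ≤ 2 * ‖x‖ / R := by rw [le_div_iff₀ hR]; linarith
            simp only; linarith
      · rintro x ⟨hx, hx2⟩
        simp only [mem_ofPred_eq] at hx
        simp only
        split_ifs with h
        · have hx' : ‖x‖ = R / 2 := le_antisymm h hx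
          have e1 : R / ‖x‖ = 2 := by rw [hx']; field_simp
          have e2 : 2 - 2 * ‖x‖ / R = 1 := by rw [hx']; field_simp; norm_num
          rw [e1, e2]
          have hs : (2 : ℝ) • x ∈ sphere (0 : Fin m → ℝ) R := by
            simp [norm_smul, hx']; ring
          rw [h1 _ hs, hFF hs]
        · rfl
  · intro x hx
    have hx' : ‖x‖ = R := by simpa using hx
    have : ¬ (‖x‖ ≤ R / 2) := by rw [hx']; linarith
    simp only [if_neg this]
    rw [hx', div_self hR.ne', one_smul, mul_div_assoc, div_self hR.ne', mul_one, sub_self, h0 x hx]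

lemma ExtB.scale {X : Type*} [TopologicalSpace X] {m : ℕ} {R : ℝ} (hR : 0 < R)
    {g : (Fin m → ℝ) → X} (h : ExtB R (fun x => g (R⁻¹ • x))) : ExtB 1 g := by
  obtain ⟨G, hG, hGg⟩ := h
  refine ⟨fun x => G (R • x), hG.comp (by fun_prop) ?_, ?_⟩
  · intro x hx
    simp only [mem_closedBall_zero_iff, norm_smul, Real.norm_eq_abs, abs_of_pos hR] at hx ⊢
    nlinarith
  · intro x hx
    have : R • x ∈ sphere (0 : Fin m → ℝ) R := by
      simp only [mem_sphere_zero_iff_norm, norm_smul, Real.norm_eq_abs, abs_of_pos hR] at hx ⊢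
      rw [hx, mul_one]
    simp only [hGg this, smul_smul, inv_mul_cancel₀ hR.ne', one_smul]

lemma norm_fin_succ {n : ℕ} (x : Fin (n + 1) → ℝ) : ‖x‖ = max |x 0| ‖Fin.tail x‖ := by
  apply le_antisymm
  · rw [pi_norm_le_iff_of_nonneg (le_max_of_le_left (abs_nonneg _))]
    intro i
    refine Fin.cases ?_ (fun j => ?_) i
    · exact le_max_left _ _
    · exact le_max_of_le_right (norm_le_pi_norm (Fin.tail x) j)
  · refine max_le (norm_le_pi_norm x 0) ?_
    rw [pi_norm_le_iff_of_nonneg (norm_nonneg _)]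
    intro i
    exact norm_le_pi_norm x i.succ

/-- clamp to the unit cube -/
noncomputable def toCube {n : ℕ} (y : Fin n → ℝ) : Fin n → unitInterval :=
  fun i => Set.projIcc 0 1 zero_le_one ((y i + 1) / 2)

lemma continuous_toCube {n : ℕ} : Continuous (toCube (n := n)) := by
  unfold toCube
  refine continuous_pi fun i => continuous_projIcc.comp (by fun_prop)

/-- from the unit cube -/
def ofCube {n : ℕ} (u : Fin n → unitInterval) : Fin n → ℝ := fun i => 2 * (u i : ℝ) - 1

lemma continuous_ofCube {n : ℕ} : Continuous (ofCube (n := n)) := by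
  unfold ofCube
  fun_prop

lemma toCube_ofCube {n : ℕ} (u : Fin n → unitInterval) : toCube (ofCube u) = u := by
  funext i
  have : (2 * (u i : ℝ) - 1 + 1) / 2 = u i := by ring
  simp [toCube, ofCube]

lemma ofCube_toCube {n : ℕ} (y : Fin n → ℝ) (hy : ‖y‖ ≤ 1) : ofCube (toCube y) = y := by
  funext i
  have h := (norm_le_pi_norm y i).trans hy
  rw [Real.norm_eq_abs, abs_le] at h
  simp only [toCube, ofCube]
  rw [Set.projIcc_of_mem zero_le_one (x := (y i + 1) / 2) ⟨by linarith, by linarith⟩]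
  simp only; ring

lemma norm_ofCube_le {n : ℕ} (u : Fin n → unitInterval) : ‖ofCube u‖ ≤ 1 := by
  rw [pi_norm_le_iff_of_nonneg zero_le_one]
  intro i
  have := (u i).2.1
  have := (u i).2.2
  rw [Real.norm_eq_abs, abs_le]
  simp only [ofCube]
  constructor <;> linarith

lemma norm_ofCube_boundary {n : ℕ} (u : Fin n → unitInterval) (hu : u ∈ Cube.boundary (Fin n)) :
    ‖ofCube u‖ = 1 := by
  apply le_antisymm (norm_ofCube_le u)
  obtain ⟨i, hi⟩ := hu
  refine le_trans ?_ (norm_le_pi_norm (ofCube u) i)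
  rcases hi with hi | hi <;> simp [ofCube, hi]
  norm_num

lemma toCube_boundary {n : ℕ} (y : Fin n → ℝ) (hy : ‖y‖ = 1) :
    toCube y ∈ Cube.boundary (Fin n) := by
  have : ∃ i, ‖y i‖ = 1 := by
    by_contra! h
    have : ‖y‖ < 1 := by
      rw [pi_norm_lt_iff zero_lt_one]
      intro i
      exact lt_of_le_of_ne ((norm_le_pi_norm y i).trans hy.le) (h i)
    linarith
  obtain ⟨i, hi⟩ := this
  rw [Real.norm_eq_abs] at hi
  refine ⟨i, ?_⟩
  rcases eq_or_eq_neg_of_abs_eq hi with h | h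
  · right; simp [toCube, h]
  · left; simp [toCube, h]

lemma subsingleton_pi_of_EP {X : Type*} [TopologicalSpace X] {n : ℕ} (h : EP (n + 1) X) (x : X) :
    Subsingleton (HomotopyGroup (Fin n) X x) := by
  constructor
  intro p q
  induction p using Quotient.inductionOn with | _ f
  induction q using Quotient.inductionOn with | _ g
  apply Quotient.sound
  let s : (Fin (n + 1) → ℝ) → X := fun y =>
    if 1 ≤ y 0 then f (toCube (Fin.tail y)) else if y 0 ≤ -1 then g (toCube (Fin.tail y)) else x
  have htail : Continuous (fun y : Fin (n + 1) → ℝ => Fin.tail y) := by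
    unfold Fin.tail; fun_prop
  have hs : ContinuousOn s (sphere 0 1) := by
    have c1 : IsClosed {y : Fin (n + 1) → ℝ | 1 ≤ y 0} := isClosed_le (by fun_prop) (by fun_prop)
    have c2 : IsClosed {y : Fin (n + 1) → ℝ | y 0 ≤ -1} := isClosed_le (by fun_prop) (by fun_prop)
    have c3 : IsClosed {y : Fin (n + 1) → ℝ | ‖Fin.tail y‖ = 1} :=
      isClosed_eq (by fun_prop) (by fun_prop)
    refine ContinuousOn.mono (contOn_union_closed (c1.union c2) c3
      (contOn_union_closed c1 c2 ?_ ?_) ?_) ?_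
    · refine ContinuousOn.congr (f := fun y => f (toCube (Fin.tail y))) ?_ ?_
      · exact (f.1.continuous.comp (continuous_toCube.comp htail)).continuousOn
      · intro y hy
        exact if_pos hy
    · refine ContinuousOn.congr (f := fun y => g (toCube (Fin.tail y))) ?_ ?_
      · exact (g.1.continuous.comp (continuous_toCube.comp htail)).continuousOn
      · intro y hy
        simp only [mem_ofPred_eq] at hy
        have : ¬ (1 ≤ y 0) := by linarith
        simp only [s, if_neg this, if_pos hy]
    · refine ContinuousOn.congr (f := fun y => x) continuousOn_const ?_
      intro y hy
      have hb := toCube_boundary _ hy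
      simp only [s]
      rw [GenLoop.boundary f _ hb, GenLoop.boundary g _ hb]
      simp
    · intro y hy
      have hy1 : ‖y‖ = 1 := by simpa using hy
      rw [norm_fin_succ] at hy1
      rcases max_choice |y 0| ‖Fin.tail y‖ with h | h
      · rw [h] at hy1
        left
        rcases eq_or_eq_neg_of_abs_eq hy1 with h | h
        · left; exact h.ge
        · right; exact h.le
      · rw [h] at hy1
        right; exact hy1
  obtain ⟨G, hG, hGs⟩ := h s hs
  have hnorm : ∀ (a : unitInterval) (u : Fin n → unitInterval),
      ‖(Fin.cons (1 - 2 * (a : ℝ)) (ofCube u) : Fin (n + 1) → ℝ)‖ ≤ 1 := by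
    intro a u
    rw [norm_fin_succ]
    refine max_le ?_ (by simpa using norm_ofCube_le u)
    have := a.2.1
    have := a.2.2
    rw [abs_le, Fin.cons_zero]
    constructor <;> linarith
  have hsph : ∀ (a : unitInterval) (u : Fin n → unitInterval),
      (a = 0 ∨ a = 1 ∨ u ∈ Cube.boundary (Fin n)) →
      (Fin.cons (1 - 2 * (a : ℝ)) (ofCube u) : Fin (n + 1) → ℝ) ∈ sphere 0 1 := by
    intro a u hau
    rw [mem_sphere_zero_iff_norm]
    refine le_antisymm (hnorm a u) ?_
    rw [norm_fin_succ]
    rcases hau with h | h | h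
    · apply le_max_of_le_left; simp [h]
    · apply le_max_of_le_left; simp [h]; norm_num
    · apply le_max_of_le_right; simp [norm_ofCube_boundary u h]
  refine ⟨⟨⟨⟨fun z => G (Fin.cons (1 - 2 * (z.1 : ℝ)) (ofCube z.2)), ?_⟩, ?_, ?_⟩, ?_⟩⟩
  · rw [← continuousOn_univ]
    refine hG.comp (Continuous.continuousOn ?_) ?_
    · refine continuous_pi fun i => Fin.cases ?_ (fun j => ?_) i
      · simp only [Fin.cons_zero]; fun_prop
      · simp only [Fin.cons_succ, ofCube]; fun_prop
    · rintro z -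
      simpa using hnorm z.1 z.2
  · intro u
    simp only
    rw [hGs (hsph 0 u (by simp))]
    simp [s, toCube_ofCube]
  · intro u
    simp only
    rw [hGs (hsph 1 u (by simp))]
    have : ¬ ((1:ℝ) ≤ 1 - 2) := by norm_num
    have : ((1:ℝ) - 2 ≤ -1) := by norm_num
    simp [s, toCube_ofCube, this]
  · intro a u hu
    change G _ = f u
    simp only
    rw [hGs (hsph a u (by simp [hu]))]
    simp only [s, Fin.tail_cons, toCube_ofCube]
    rw [GenLoop.boundary f u hu, GenLoop.boundary g u hu]
    simp

lemma EP_zero {X : Type*} [TopologicalSpace X] (h : Nonempty X) : EP 0 X := by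
  intro g _
  refine ⟨fun _ => h.some, continuousOn_const, ?_⟩
  intro x hx
  have : x = 0 := Subsingleton.elim _ _
  rw [this, mem_sphere_zero_iff_norm, norm_zero] at hx
  exact absurd hx zero_ne_one

lemma EP_succ_of_pi {X : Type*} [TopologicalSpace X] {n : ℕ}
    (h : ∀ x, Subsingleton (HomotopyGroup (Fin n) X x)) : EP (n + 1) X := by
  intro g hg
  have htail : Continuous (fun y : Fin (n + 1) → ℝ => Fin.tail y) := by
    unfold Fin.tail; fun_prop
  let ρ : (Fin (n + 1) → ℝ) → ℝ := fun x => max ‖Fin.tail x‖ ((1 - x 0) / 2)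
  have hρ : Continuous ρ := by fun_prop
  let w : (Fin (n + 1) → ℝ) → (Fin (n + 1) → ℝ) := fun x =>
    Fin.cons (1 - 2 * ρ x) ((1 - ρ x) • Fin.tail x)
  have hw : Continuous w := by
    refine continuous_pi fun i => Fin.cases ?_ (fun j => ?_) i
    · simp only [w, Fin.cons_zero]; fun_prop
    · simp only [w, Fin.cons_succ, Pi.smul_apply, Fin.tail]; fun_prop
  let v : (Fin (n + 1) → ℝ) → ℝ → (Fin (n + 1) → ℝ) := fun x s => (1 - s) • x + s • w x
  have hv : Continuous (fun z : (Fin (n + 1) → ℝ) × ℝ => v z.1 z.2) := by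
    simp only [v]; fun_prop
  have hv0 : ∀ x ∈ sphere (0 : Fin (n + 1) → ℝ) 1, ∀ s ∈ Icc (0 : ℝ) 1, v x s ≠ 0 := by
    intro x hx s hs hvx
    have hx1 : ‖x‖ = 1 := by simpa using hx
    rw [norm_fin_succ] at hx1
    have ht : ‖Fin.tail x‖ ≤ 1 := hx1 ▸ le_max_right _ _
    have hz : |x 0| ≤ 1 := hx1 ▸ le_max_left _ _
    rw [abs_le] at hz
    have hρ1 : ρ x ≤ 1 := max_le ht (by linarith)
    have hρ0 : 0 ≤ ρ x := le_max_of_le_left (norm_nonneg _)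
    have e0 : (1 - s) * x 0 + s * (1 - 2 * ρ x) = 0 := by
      have := congrFun hvx 0
      simpa [v, w] using this
    have e1 : ∀ j : Fin n, (1 - s * ρ x) * Fin.tail x j = 0 := by
      intro j
      have := congrFun hvx j.succ
      simp [v, w] at this
      simp only [Fin.tail] at this ⊢
      linear_combination this
    by_cases htx : Fin.tail x = 0
    · rw [htx, norm_zero, max_eq_left (abs_nonneg _)] at hx1
      have hρx : ρ x = max 0 ((1 - x 0) / 2) := by simp only [ρ, htx, norm_zero]
      rcases eq_or_eq_neg_of_abs_eq hx1 with h | h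
      · rw [hρx, h] at e0; norm_num at e0
      · rw [hρx, h] at e0; norm_num at e0; linarith
    · have : ∃ j, Fin.tail x j ≠ 0 := by
        by_contra! hh
        exact htx (funext hh)
      obtain ⟨j, hj⟩ := this
      have e2 : 1 - s * ρ x = 0 := (mul_eq_zero.1 (e1 j)).resolve_right hj
      have hs1 : s = 1 := by nlinarith [hs.1, hs.2]
      subst hs1
      have : ρ x = 1 := by linarith
      rw [this] at e0
      norm_num at e0
  have hnormed : ∀ x ∈ sphere (0 : Fin (n + 1) → ℝ) 1, ∀ s ∈ Icc (0 : ℝ) 1,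
      (‖v x s‖⁻¹) • v x s ∈ sphere (0 : Fin (n + 1) → ℝ) 1 := by
    intro x hx s hs
    have := norm_ne_zero_iff.2 (hv0 x hx s hs)
    rw [mem_sphere_zero_iff_norm, norm_smul, norm_inv, norm_norm, inv_mul_cancel₀ this]
  have hvw : ∀ x, v x 1 = w x := by intro x; simp [v]
  let F : (Fin (n + 1) → ℝ) → X := fun x => g (‖w x‖⁻¹ • w x)
  have hwρ : ∀ x, ρ x = 1 → F x = g (Fin.cons (-1) 0) := by
    intro x hx
    have : w x = Fin.cons (-1) 0 := by
      simp only [w, hx]; norm_num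
    simp only [F]
    rw [this]
    congr 1
    rw [norm_fin_succ]
    simp
  have key : ExtB 1 F := by
    let a : X := g (Fin.cons (-1) 0)
    have hcons : Continuous (fun u : Fin n → unitInterval =>
        (Fin.cons 1 (ofCube u) : Fin (n + 1) → ℝ)) := by
      refine continuous_pi fun i => Fin.cases ?_ (fun j => ?_) i
      · simp only [Fin.cons_zero]; fun_prop
      · simp only [Fin.cons_succ, ofCube]; fun_prop
    have hcs : ∀ u : Fin n → unitInterval, (Fin.cons 1 (ofCube u) : Fin (n + 1) → ℝ) ∈
        sphere (0 : Fin (n + 1) → ℝ) 1 := by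
      intro u
      rw [mem_sphere_zero_iff_norm, norm_fin_succ]
      simp [norm_ofCube_le u]
    have hF : ContinuousOn F (sphere 0 1) := by
      refine hg.comp (ContinuousOn.smul (ContinuousOn.inv₀ hw.norm.continuousOn ?_) hw.continuousOn) ?_
      · intro x hx
        have := hv0 x hx 1 (by simp)
        rw [hvw] at this
        simpa using this
      · intro x hx
        have := hnormed x hx 1 (by simp)
        rwa [hvw] at this
    let γ : GenLoop (Fin n) X a := ⟨⟨fun u => F (Fin.cons 1 (ofCube u)), by
      rw [← continuousOn_univ]
      exact hF.comp hcons.continuousOn (fun u _ => hcs u)⟩, by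
      intro u hu
      apply hwρ
      simp [ρ, norm_ofCube_boundary u hu]⟩
    have hγ : GenLoop.Homotopic γ GenLoop.const :=
      Quotient.exact (@Subsingleton.elim _ (h a) (Quotient.mk _ γ) (Quotient.mk _ GenLoop.const))
    obtain ⟨K⟩ := hγ
    refine ⟨fun x => K (Set.projIcc 0 1 zero_le_one ((1 - x 0) / 2), toCube (Fin.tail x)), ?_, ?_⟩
    · refine Continuous.continuousOn (K.continuous.comp (Continuous.prodMk
        (continuous_projIcc.comp (by fun_prop)) (continuous_toCube.comp htail)))
    · intro x hx
      have hx1 : ‖x‖ = 1 := by simpa using hx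
      rw [norm_fin_succ] at hx1
      have ht : ‖Fin.tail x‖ ≤ 1 := hx1 ▸ le_max_right _ _
      have hz : |x 0| ≤ 1 := hx1 ▸ le_max_left _ _
      rw [abs_le] at hz
      rcases max_choice |x 0| ‖Fin.tail x‖ with h | h
      · rw [h] at hx1
        rcases eq_or_eq_neg_of_abs_eq hx1 with h | h
        · have e : x = Fin.cons 1 (ofCube (toCube (Fin.tail x))) := by
            rw [ofCube_toCube _ ht, ← h, Fin.cons_self_tail]
          simp only [h]
          norm_num
          conv_rhs => rw [e]
          rfl
        · simp only [h]
          norm_num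
          rw [hwρ x]
          simp only [ρ, h]
          norm_num
          exact ht
      · rw [h] at hx1
        have hb := toCube_boundary _ hx1
        simp only
        rw [K.eq_fst _ hb, hwρ x]
        · exact γ.2 _ hb
        · simp only [ρ, hx1]
          rw [max_eq_left]; linarith
  refine key.hep zero_lt_one (fun x s => g (‖v x s‖⁻¹ • v x s)) ?_ ?_ ?_
  · refine hg.comp (f := fun z : (Fin (n + 1) → ℝ) × ℝ => (‖v z.1 z.2‖⁻¹ • v z.1 z.2))
      (ContinuousOn.smul (ContinuousOn.inv₀ hv.norm.continuousOn ?_) hv.continuousOn) ?_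
    · rintro ⟨x, s⟩ ⟨hx, hs⟩
      simpa using hv0 x hx s hs
    · rintro ⟨x, s⟩ ⟨hx, hs⟩
      exact hnormed x hx s hs
  · intro x hx
    have : ‖x‖ = 1 := by simpa using hx
    simp [v, this]
  · intro x hx
    simp only [hvw, F]

/-- non-integral coordinates -/
noncomputable def nint {m : ℕ} (x : Fin m → ℝ) : Finset (Fin m) :=
  Finset.univ.filter fun i => Int.fract (x i) ≠ 0

lemma mem_nint {m : ℕ} {x : Fin m → ℝ} {i : Fin m} : i ∈ nint x ↔ Int.fract (x i) ≠ 0 := by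
  simp [nint]

/-- the smallest closed cell of the integer grid containing `x` -/
def gcell {m : ℕ} (x : Fin m → ℝ) : Set (Fin m → ℝ) :=
  Icc (fun i => (⌊x i⌋ : ℝ)) (fun i => (⌈x i⌉ : ℝ))

lemma mem_gcell_self {m : ℕ} (x : Fin m → ℝ) : x ∈ gcell x :=
  ⟨fun _ => Int.floor_le _, fun _ => Int.le_ceil _⟩

lemma gcell_sub {m : ℕ} {x y : Fin m → ℝ} (h : y ∈ gcell x) : gcell y ⊆ gcell x := by
  refine Icc_subset_Icc ?_ ?_
  · intro i
    exact Int.cast_le.2 (Int.le_floor.2 (h.1 i))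
  · intro i
    exact Int.cast_le.2 (Int.ceil_le.2 (h.2 i))

lemma ceil_of_fract_ne {r : ℝ} (h : Int.fract r ≠ 0) : ⌈r⌉ = ⌊r⌋ + 1 := by
  rw [Int.ceil_eq_iff]
  have h0 : 0 < Int.fract r := lt_of_le_of_ne (Int.fract_nonneg r) h.symm
  have h1 := Int.fract_lt_one r
  have h2 := Int.floor_add_fract r
  push_cast
  constructor <;> linarith

lemma eq_of_fract_zero {m : ℕ} {x y : Fin m → ℝ} (h : y ∈ gcell x) {i : Fin m}
    (hi : Int.fract (x i) = 0) : y i = x i := by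
  rw [Int.fract_eq_zero_iff] at hi
  obtain ⟨z, hz⟩ := hi
  have h1 := h.1 i
  have h2 := h.2 i
  simp only [← hz, Int.floor_intCast, Int.ceil_intCast] at h1 h2
  rw [← hz]
  exact le_antisymm h2 h1

lemma nint_sub {m : ℕ} {x y : Fin m → ℝ} (h : y ∈ gcell x) : nint y ⊆ nint x := by
  intro i
  rw [mem_nint, mem_nint]
  intro hy hx
  rw [eq_of_fract_zero h hx] at hy
  exact hy hx

lemma floor_eq_of_nint {m : ℕ} {x y : Fin m → ℝ} (h : y ∈ gcell x)
    (hd : (nint x).card ≤ (nint y).card) (i : Fin m) :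
    ⌊y i⌋ = ⌊x i⌋ ∧ ⌈y i⌉ = ⌈x i⌉ := by
  have he := Finset.eq_of_subset_of_card_le (nint_sub h) hd
  by_cases hi : i ∈ nint x
  · have hi' : i ∈ nint y := he ▸ hi
    rw [mem_nint] at hi hi'
    have : ⌊y i⌋ = ⌊x i⌋ := by
      have h1 := h.1 i
      have h2 := h.2 i
      simp only [ceil_of_fract_ne hi] at h1 h2
      push_cast at h2
      rw [Int.floor_eq_iff]
      refine ⟨h1, lt_of_le_of_ne h2 ?_⟩
      intro h3
      apply hi'
      rw [Int.fract_eq_zero_iff]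
      exact ⟨⌊x i⌋ + 1, by push_cast; exact h3.symm⟩
    rw [ceil_of_fract_ne hi, ceil_of_fract_ne hi', this]
    exact ⟨rfl, rfl⟩
  · rw [mem_nint, not_not] at hi
    rw [eq_of_fract_zero h hi]
    exact ⟨rfl, rfl⟩

/-- midpoint of the cell -/
noncomputable def gmid {m : ℕ} (x : Fin m → ℝ) : Fin m → ℝ := fun i => ((⌊x i⌋ : ℝ) + ⌈x i⌉) / 2

lemma gmid_congr {m : ℕ} {x y : Fin m → ℝ} (h : ∀ i, ⌊y i⌋ = ⌊x i⌋ ∧ ⌈y i⌉ = ⌈x i⌉) :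
    gmid y = gmid x := by
  funext i
  simp [gmid, (h i).1, (h i).2]

lemma gmid_spec {m : ℕ} (x : Fin m → ℝ) (i : Fin m) :
    ⌊gmid x i⌋ = ⌊x i⌋ ∧ ⌈gmid x i⌉ = ⌈x i⌉ := by
  by_cases hi : Int.fract (x i) = 0
  · rw [Int.fract_eq_zero_iff] at hi
    obtain ⟨z, hz⟩ := hi
    simp [gmid, ← hz]
  · have := ceil_of_fract_ne hi
    simp only [gmid, this]
    rw [Int.floor_eq_iff, Int.ceil_eq_iff]
    push_cast
    refine ⟨⟨?_, ?_⟩, ?_, ?_⟩ <;> linarith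

lemma gcell_congr {m : ℕ} {x y : Fin m → ℝ} (h : ∀ i, ⌊y i⌋ = ⌊x i⌋ ∧ ⌈y i⌉ = ⌈x i⌉) :
    gcell y = gcell x := by
  simp [gcell, fun i => (h i).1, fun i => (h i).2]

lemma gcell_gmid {m : ℕ} (x : Fin m → ℝ) : gcell (gmid x) = gcell x := gcell_congr (gmid_spec x)

lemma nint_gmid {m : ℕ} (x : Fin m → ℝ) : nint (gmid x) = nint x := by
  apply Finset.Subset.antisymm
  · exact nint_sub (gcell_gmid x ▸ mem_gcell_self _)
  · exact nint_sub (gcell_gmid x ▸ mem_gcell_self _)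

lemma gmid_gmid {m : ℕ} (x : Fin m → ℝ) : gmid (gmid x) = gmid x := gmid_congr (gmid_spec x)

lemma mem_ball_iff {m : ℕ} {x : Fin m → ℝ} {N : ℕ} :
    x ∈ closedBall (0 : Fin m → ℝ) N ↔ ∀ i, -(N : ℝ) ≤ x i ∧ x i ≤ N := by
  rw [mem_closedBall_zero_iff, pi_norm_le_iff_of_nonneg (Nat.cast_nonneg N)]
  simp [abs_le]

lemma floor_mem_of_ball {m : ℕ} {x : Fin m → ℝ} {N : ℕ} (hx : x ∈ closedBall (0 : Fin m → ℝ) N)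
    (i : Fin m) : -(N : ℤ) ≤ ⌊x i⌋ ∧ ⌈x i⌉ ≤ N := by
  rw [mem_ball_iff] at hx
  constructor
  · rw [Int.le_floor]; push_cast; exact (hx i).1
  · rw [Int.ceil_le]; exact_mod_cast (hx i).2

lemma gcell_sub_ball {m : ℕ} {x : Fin m → ℝ} {N : ℕ} (hx : x ∈ closedBall (0 : Fin m → ℝ) N) :
    gcell x ⊆ closedBall (0 : Fin m → ℝ) N := by
  intro y hy
  rw [mem_ball_iff]
  intro i
  have h := floor_mem_of_ball hx i
  have h1 := hy.1 i
  have h2 := hy.2 i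
  have h3 : (-(N : ℝ)) ≤ ⌊x i⌋ := by exact_mod_cast h.1
  have h4 : (⌈x i⌉ : ℝ) ≤ N := by exact_mod_cast h.2
  simp only at h1 h2
  constructor <;> linarith

lemma finite_gmid {m : ℕ} (N : ℕ) : (gmid '' closedBall (0 : Fin m → ℝ) N).Finite := by
  have hf : (Icc (fun _ : Fin m => -(N : ℤ)) (fun _ => (N : ℤ))).Finite := Set.finite_Icc _ _
  refine ((hf.prod hf).image
    (fun p : (Fin m → ℤ) × (Fin m → ℤ) => fun i => ((p.1 i : ℝ) + p.2 i) / 2)).subset ?_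
  rintro _ ⟨x, hx, rfl⟩
  refine ⟨(fun i => ⌊x i⌋, fun i => ⌈x i⌉), ⟨⟨?_, ?_⟩, ⟨?_, ?_⟩⟩, rfl⟩
  · exact fun i => (floor_mem_of_ball hx i).1
  · exact fun i => (Int.floor_le_ceil _).trans (floor_mem_of_ball hx i).2
  · exact fun i => (floor_mem_of_ball hx i).1.trans (Int.floor_le_ceil _)
  · exact fun i => (floor_mem_of_ball hx i).2

/-- closed unions of cells -/
def Cellular {m : ℕ} (S : Set (Fin m → ℝ)) : Prop := IsClosed S ∧ ∀ x ∈ S, gcell x ⊆ S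

lemma Cellular.union {m : ℕ} {S T : Set (Fin m → ℝ)} (hS : Cellular S) (hT : Cellular T) :
    Cellular (S ∪ T) := by
  refine ⟨hS.1.union hT.1, ?_⟩
  rintro x (h | h)
  · exact (hS.2 x h).trans subset_union_left
  · exact (hT.2 x h).trans subset_union_right

/-- points of the ball in cells of dimension `< d` -/
def Skel {m : ℕ} (N d : ℕ) : Set (Fin m → ℝ) := {x | x ∈ closedBall 0 (N : ℝ) ∧ (nint x).card < d}

lemma isClosed_fract_zero : IsClosed {r : ℝ | Int.fract r = 0} := by
  have : {r : ℝ | Int.fract r = 0} = range ((↑) : ℤ → ℝ) := by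
    ext r
    exact Int.fract_eq_zero_iff
  rw [this]
  exact Int.isClosedEmbedding_coe_real.isClosed_range

lemma isClosed_card {m : ℕ} (s : Set ℝ) (hs : IsClosed s) (d : ℕ) [DecidablePred (· ∈ s)] :
    IsClosed {x : Fin m → ℝ | d ≤ (Finset.univ.filter fun i => x i ∈ s).card} := by
  have : {x : Fin m → ℝ | d ≤ (Finset.univ.filter fun i => x i ∈ s).card} =
      ⋃ T ∈ {T : Finset (Fin m) | d ≤ T.card}, {x | ∀ i ∈ T, x i ∈ s} := by
    ext x
    simp only [mem_ofPred_eq, mem_iUnion, exists_prop]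
    constructor
    · intro h
      exact ⟨_, h, fun i hi => (Finset.mem_filter.1 hi).2⟩
    · rintro ⟨T, hT, h⟩
      exact hT.trans (Finset.card_le_card fun i hi => Finset.mem_filter.2 ⟨Finset.mem_univ _, h i hi⟩)
  rw [this]
  refine Set.Finite.isClosed_biUnion (Set.toFinite _) ?_
  intro T _
  have : {x : Fin m → ℝ | ∀ i ∈ T, x i ∈ s} = ⋂ i ∈ T, (fun x : Fin m → ℝ => x i) ⁻¹' s := by
    ext x; simp
  rw [this]
  exact isClosed_biInter fun i _ => hs.preimage (continuous_apply i)

lemma cellular_skel {m : ℕ} (N d : ℕ) : Cellular (Skel (m := m) N d) := by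
  classical
  constructor
  · have : Skel (m := m) N d = closedBall 0 (N : ℝ) ∩ {x : Fin m → ℝ |
        m + 1 ≤ (Finset.univ.filter fun i => x i ∈ {r : ℝ | Int.fract r = 0}).card + d} := by
      ext x
      simp only [Skel, mem_ofPred_eq, mem_inter_iff, nint]
      have := Finset.card_filter_add_card_filter_not (s := (Finset.univ : Finset (Fin m)))
        (fun i => Int.fract (x i) = 0)
      rw [Finset.card_univ, Fintype.card_fin] at this
      simp only [ne_eq]
      refine and_congr_right fun _ => ?_
      omega
    rw [this]
    refine isClosed_closedBall.inter ?_
    have := isClosed_card (m := m) _ isClosed_fract_zero (m + 1 - d)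
    simpa only [Nat.sub_le_iff_le_add] using this
  · rintro x ⟨hx, hd⟩ y hy
    exact ⟨gcell_sub_ball hx hy, (Finset.card_le_card (nint_sub hy)).trans_lt hd⟩

lemma extend_cell {A : Type*} [TopologicalSpace A] {m N d : ℕ} (hA : EP d A)
    {α : (Fin m → ℝ) → A} (hα : ContinuousOn α (Skel N d)) (c : Fin m → ℝ)
    (hc : c ∈ closedBall (0 : Fin m → ℝ) N) (hd : (nint c).card = d) :
    ∃ e : (Fin m → ℝ) → A, ContinuousOn e (gcell c) ∧
      ∀ y ∈ gcell c, (nint y).card < d → e y = α y := by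
  classical
  let σ := (nint c).equivFinOfCardEq hd
  let up : (Fin d → ℝ) → (Fin m → ℝ) := fun y i =>
    if h : i ∈ nint c then ⌊c i⌋ + (y (σ ⟨i, h⟩) + 1) / 2 else c i
  let down : (Fin m → ℝ) → (Fin d → ℝ) := fun x k => 2 * (x (σ.symm k) - ⌊c (σ.symm k)⌋) - 1
  have hup : Continuous up := by
    refine continuous_pi fun i => ?_
    simp only [up]
    split_ifs with h
    · fun_prop
    · fun_prop
  have hdown : Continuous down := by
    simp only [down]; fun_prop
  have hupcell : ∀ y ∈ closedBall (0 : Fin d → ℝ) 1, up y ∈ gcell c := by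
    intro y hy
    have hy' : ∀ k, |y k| ≤ 1 := by
      rw [mem_closedBall_zero_iff, pi_norm_le_iff_of_nonneg zero_le_one] at hy
      exact hy
    constructor
    · intro i
      simp only [up]
      split_ifs with h
      · have := abs_le.1 (hy' (σ ⟨i, h⟩))
        linarith
      · exact Int.floor_le _
    · intro i
      simp only [up]
      split_ifs with h
      · have := abs_le.1 (hy' (σ ⟨i, h⟩))
        rw [ceil_of_fract_ne (mem_nint.1 h)]
        push_cast
        linarith
      · exact Int.le_ceil _
  have hupskel : ∀ y ∈ sphere (0 : Fin d → ℝ) 1, up y ∈ Skel N d := by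
    intro y hy
    have hcell := hupcell y (sphere_subset_closedBall hy)
    refine ⟨gcell_sub_ball hc hcell, ?_⟩
    rw [← hd]
    apply Finset.card_lt_card
    refine ⟨nint_sub hcell, ?_⟩
    intro hsub
    obtain ⟨i, hi⟩ := toCube_boundary y (by simpa using hy)
    have hmem := (σ.symm i).2
    have h1 := mem_nint.1 (hsub hmem)
    apply h1
    simp only [up, dif_pos hmem, Subtype.coe_eta, Equiv.apply_symm_apply]
    have hy' : |y i| ≤ 1 := by
      rw [mem_sphere_zero_iff_norm] at hy
      exact hy ▸ norm_le_pi_norm y i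
    have := abs_le.1 hy'
    rw [toCube, projIcc_of_mem zero_le_one (x := (y i + 1) / 2) ⟨by linarith, by linarith⟩] at hi
    rw [Subtype.ext_iff, Subtype.ext_iff] at hi
    rcases hi with hi | hi
    · simp only [Icc.coe_zero] at hi
      rw [hi]; simp
    · simp only [Icc.coe_one] at hi
      rw [hi]; simp
  have hud : ∀ x ∈ gcell c, up (down x) = x := by
    intro x hx
    funext i
    simp only [up]
    split_ifs with h
    · simp only [down, Equiv.symm_apply_apply]; ring
    · rw [mem_nint, not_not] at h
      exact (eq_of_fract_zero hx h).symm
  have hdown_ball : ∀ x ∈ gcell c, down x ∈ closedBall (0 : Fin d → ℝ) 1 := by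
    intro x hx
    rw [mem_closedBall_zero_iff, pi_norm_le_iff_of_nonneg zero_le_one]
    intro k
    have h1 := hx.1 (σ.symm k)
    have h2 := hx.2 (σ.symm k)
    simp only [ceil_of_fract_ne (mem_nint.1 (σ.symm k).2)] at h1 h2
    push_cast at h2
    rw [Real.norm_eq_abs, abs_le]
    simp only [down]
    constructor <;> linarith
  have hdown_sphere : ∀ x ∈ gcell c, (nint x).card < d → down x ∈ sphere (0 : Fin d → ℝ) 1 := by
    intro x hx hxd
    rw [mem_sphere_zero_iff_norm]
    apply le_antisymm (by simpa using hdown_ball x hx)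
    have : ¬ (nint c ⊆ nint x) := fun h => by
      have := Finset.card_le_card h
      omega
    rw [Finset.not_subset] at this
    obtain ⟨i, hi, hix⟩ := this
    rw [mem_nint, not_not, Int.fract_eq_zero_iff] at hix
    obtain ⟨z, hz⟩ := hix
    have h1 := hx.1 i
    have h2 := hx.2 i
    simp only [ceil_of_fract_ne (mem_nint.1 hi), ← hz] at h1 h2
    have h1' : ⌊c i⌋ ≤ z := by exact_mod_cast h1
    have h2' : z ≤ ⌊c i⌋ + 1 := by exact_mod_cast h2
    refine le_trans ?_ (norm_le_pi_norm (down x) (σ ⟨i, hi⟩))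
    simp only [down, Equiv.symm_apply_apply, Real.norm_eq_abs, ← hz]
    have : z = ⌊c i⌋ ∨ z = ⌊c i⌋ + 1 := by omega
    rcases this with h | h
    · rw [h]; simp
    · rw [h]; push_cast; norm_num
  obtain ⟨G, hG, hGe⟩ := hA (fun y => α (up y)) (hα.comp hup.continuousOn hupskel)
  refine ⟨fun x => G (down x), hG.comp hdown.continuousOn hdown_ball, ?_⟩
  intro y hy hyd
  simp only
  rw [hGe (hdown_sphere y hy hyd)]
  simp only [hud y hy]

lemma extend_step {A : Type*} [TopologicalSpace A] {m N d : ℕ} (hA : EP d A)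
    {α : (Fin m → ℝ) → A} {C : Set (Fin m → ℝ)} (hC : Cellular C)
    (hα : ContinuousOn α (C ∪ Skel N d)) :
    ∃ α' : (Fin m → ℝ) → A, ContinuousOn α' (C ∪ Skel N (d + 1)) ∧ EqOn α' α (C ∪ Skel N d) := by
  classical
  have hS := hC.union (cellular_skel (m := m) N d)
  set S := C ∪ Skel (m := m) N d with hSdef
  have hex : ∀ c : Fin m → ℝ, ∃ e : (Fin m → ℝ) → A,
      (c ∈ closedBall (0 : Fin m → ℝ) N → (nint c).card = d → ContinuousOn e (gcell c) ∧
      ∀ y ∈ gcell c, (nint y).card < d → e y = α y) := by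
    intro c
    by_cases h : c ∈ closedBall (0 : Fin m → ℝ) N ∧ (nint c).card = d
    · obtain ⟨e, he⟩ := extend_cell hA (hα.mono subset_union_right) c h.1 h.2
      exact ⟨e, fun _ _ => he⟩
    · exact ⟨α, fun h1 h2 => absurd ⟨h1, h2⟩ h⟩
  choose e he using hex
  let ι := {c : Fin m → ℝ // c ∈ gmid '' closedBall (0 : Fin m → ℝ) N ∧
    (nint c).card = d ∧ ¬ (gcell c ⊆ S)}
  have : Finite ι := (Set.Finite.subset (finite_gmid N) (fun c hc => hc.1) :
    {c : Fin m → ℝ | c ∈ gmid '' closedBall (0 : Fin m → ℝ) N ∧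
    (nint c).card = d ∧ ¬ (gcell c ⊆ S)}.Finite)
  let α' : (Fin m → ℝ) → A := fun x => if x ∈ S then α x else e (gmid x) x
  have hEq : EqOn α' α S := fun x hx => if_pos hx
  refine ⟨α', ?_, hEq⟩
  have hsub : C ∪ Skel (m := m) N (d + 1) ⊆ S ∪ ⋃ c : ι, gcell c.1 := by
    intro x hx
    by_cases hxS : x ∈ S
    · exact Or.inl hxS
    · right
      rcases hx with hx | hx
      · exact absurd (Or.inl hx) hxS
      · have hd : (nint x).card = d := by
          have h1 := hx.2
          by_contra h2
          exact hxS (Or.inr ⟨hx.1, by omega⟩)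
        refine mem_iUnion.2 ⟨⟨gmid x, ⟨x, hx.1, rfl⟩, by rw [nint_gmid, hd], ?_⟩, ?_⟩
        · intro h
          rw [gcell_gmid] at h
          exact hxS (h (mem_gcell_self x))
        · rw [gcell_gmid]
          exact mem_gcell_self x
  refine ContinuousOn.mono (contOn_union_closed hS.1 (isClosed_iUnion_of_finite
    fun c => isClosed_Icc) (hα.congr hEq) ?_) hsub
  refine (locallyFinite_of_finite _).continuousOn_iUnion (fun c => isClosed_Icc) ?_
  rintro ⟨c, ⟨x, hx, rfl⟩, hd, hcS⟩
  rw [nint_gmid] at hd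
  have hmb : gmid x ∈ closedBall (0 : Fin m → ℝ) N :=
    gcell_sub_ball hx (gcell_gmid x ▸ mem_gcell_self _)
  obtain ⟨hec, hee⟩ := he (gmid x) hmb (by rw [nint_gmid, hd])
  refine hec.congr ?_
  intro y hy
  have hyb := gcell_sub_ball hmb hy
  rcases lt_or_ge (nint y).card d with h | h
  · have hyS : y ∈ S := Or.inr ⟨hyb, h⟩
    rw [hEq hyS, hee y hy h]
  · have hspec := floor_eq_of_nint hy (by rw [nint_gmid, hd]; exact h)
    have hyS : y ∉ S := by
      intro hyS
      apply hcS
      rw [← gcell_congr hspec]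
      exact hS.2 y hyS
    simp only [α', if_neg hyS]
    rw [gmid_congr hspec, gmid_gmid]

lemma extend_skel {A : Type*} [TopologicalSpace A] {m N : ℕ}
    {α : (Fin m → ℝ) → A} {C : Set (Fin m → ℝ)} (hC : Cellular C)
    (hα : ContinuousOn α C) (d : ℕ) (hA : ∀ i < d, EP i A) :
    ∃ α' : (Fin m → ℝ) → A, ContinuousOn α' (C ∪ Skel N d) ∧ EqOn α' α C := by
  induction d with
  | zero =>
    refine ⟨α, ?_, fun _ _ => rfl⟩
    have : Skel (m := m) N 0 = ∅ := by
      ext x; simp [Skel]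
    rw [this, union_empty]
    exact hα
  | succ d ih =>
    obtain ⟨α₁, h1, h2⟩ := ih fun i hi => hA i (by omega)
    obtain ⟨α₂, h3, h4⟩ := extend_step (hA d (by omega)) hC h1
    exact ⟨α₂, h3, fun x hx => (h4 (Or.inl hx)).trans (h2 hx)⟩

namespace TopJoinAux

variable {A B : Type*} [TopologicalSpace A] [TopologicalSpace B]

/-- points of the join, with a real (clamped) parameter -/
noncomputable def J (a : A) (b : B) (r : ℝ) : TopJoin A B :=
  Quot.mk _ (a, b, Set.projIcc 0 1 zero_le_one r)

lemma J_zero {a : A} {b b' : B} {r r' : ℝ} (h : r ≤ 0) (h' : r' ≤ 0) : J a b r = J a b' r' := by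
  unfold J
  rw [projIcc_of_le_left _ h, projIcc_of_le_left _ h']
  exact Quot.sound (JoinRel.zero a b b')

lemma J_one {a a' : A} {b : B} {r r' : ℝ} (h : 1 ≤ r) (h' : 1 ≤ r') : J a b r = J a' b r' := by
  unfold J
  rw [projIcc_of_right_le _ h, projIcc_of_right_le _ h']
  exact Quot.sound (JoinRel.one a a' b)

lemma J_congr {a a' : A} {b b' : B} {r : ℝ} (ha : r < 1 → a = a') (hb : 0 < r → b = b') :
    J a b r = J a' b' r := by
  rcases lt_or_ge r 1 with h1 | h1
  · rcases lt_or_ge 0 r with h0 | h0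
    · rw [ha h1, hb h0]
    · rw [ha h1, J_zero h0 h0]
  · rw [hb (by linarith), J_one h1 h1]

lemma continuous_J : Continuous (fun z : A × B × ℝ => J z.1 z.2.1 z.2.2) := by
  unfold J
  refine continuous_quot_mk.comp (continuous_fst.prodMk ((continuous_fst.comp continuous_snd).prodMk
    (continuous_projIcc.comp (continuous_snd.comp continuous_snd))))

lemma continuousOn_J {Y : Type*} [TopologicalSpace Y] {S C E : Set Y} (a₀ : A) (b₀ : B)
    (hS : IsClosed S) (hC : IsClosed C) (hE : IsClosed E) {α : Y → A} {β : Y → B} {τ : Y → ℝ}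
    (hα : ContinuousOn α C) (hβ : ContinuousOn β E) (hτ : ContinuousOn τ S)
    (h1 : ∀ y ∈ S, τ y < 1 → y ∈ C) (h0 : ∀ y ∈ S, 0 < τ y → y ∈ E) :
    ContinuousOn (fun y => J (α y) (β y) (τ y)) S := by
  have c0 : IsClosed (S ∩ τ ⁻¹' Iic 0) := hτ.preimage_isClosed_of_isClosed hS isClosed_Iic
  have c1 : IsClosed (S ∩ τ ⁻¹' Ici 1) := hτ.preimage_isClosed_of_isClosed hS isClosed_Ici
  have c2 : IsClosed (S ∩ (C ∩ E)) := hS.inter (hC.inter hE)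
  refine ContinuousOn.mono (contOn_union_closed (c0.union c1) c2
    (contOn_union_closed c0 c1 ?_ ?_) ?_) ?_
  · refine ContinuousOn.congr (f := fun y => J (α y) b₀ 0) ?_ ?_
    · refine continuous_J.comp_continuousOn (f := fun y => (α y, b₀, (0 : ℝ)))
        (ContinuousOn.prodMk (hα.mono ?_) continuousOn_const)
      rintro y ⟨hy, hy0⟩
      exact h1 y hy (lt_of_le_of_lt hy0 zero_lt_one)
    · rintro y ⟨hy, hy0⟩
      exact J_zero hy0 le_rfl
  · refine ContinuousOn.congr (f := fun y => J a₀ (β y) 1) ?_ ?_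
    · refine continuous_J.comp_continuousOn (f := fun y => (a₀, β y, (1 : ℝ)))
        (continuousOn_const.prodMk (ContinuousOn.prodMk (hβ.mono ?_) continuousOn_const))
      rintro y ⟨hy, hy0⟩
      exact h0 y hy (lt_of_lt_of_le zero_lt_one hy0)
    · rintro y ⟨hy, hy0⟩
      exact J_one hy0 le_rfl
  · exact continuous_J.comp_continuousOn (f := fun y => (α y, β y, τ y))
      ((hα.mono fun y hy => hy.2.1).prodMk ((hβ.mono fun y hy => hy.2.2).prodMk
        (hτ.mono fun y hy => hy.1)))
  · intro y hy
    rcases lt_or_ge (τ y) 1 with h | h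
    · rcases lt_or_ge 0 (τ y) with h' | h'
      · exact Or.inr ⟨hy, h1 y hy h, h0 y hy h'⟩
      · exact Or.inl (Or.inl ⟨hy, h'⟩)
    · exact Or.inl (Or.inr ⟨hy, h⟩)

/-- the join parameter -/
def tX : TopJoin A B → ℝ := Quot.lift (fun p => (p.2.2 : ℝ)) (by
  rintro _ _ (⟨a, b, b'⟩ | ⟨a, a', b⟩) <;> rfl)

open Classical in
/-- the `A`-coordinate -/
noncomputable def αX (a₀ : A) : TopJoin A B → A :=
  Quot.lift (fun p => if (p.2.2 : ℝ) < 1 then p.1 else a₀) (by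
    rintro _ _ (⟨a, b, b'⟩ | ⟨a, a', b⟩)
    · rfl
    · simp)

open Classical in
/-- the `B`-coordinate -/
noncomputable def βX (b₀ : B) : TopJoin A B → B :=
  Quot.lift (fun p => if 0 < (p.2.2 : ℝ) then p.2.1 else b₀) (by
    rintro _ _ (⟨a, b, b'⟩ | ⟨a, a', b⟩)
    · simp
    · rfl)

lemma continuous_tX : Continuous (tX : TopJoin A B → ℝ) :=
  continuous_quot_lift _ (by fun_prop)

lemma continuousOn_αX (a₀ : A) : ContinuousOn (αX a₀ : TopJoin A B → A) {x | tX x < 1} := by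
  have ho : IsOpen {x : TopJoin A B | tX x < 1} := isOpen_lt continuous_tX continuous_const
  rw [continuousOn_open_iff ho]
  intro O hO
  have hq : Topology.IsQuotientMap (Quot.mk (JoinRel A B)) := isQuotientMap_quot_mk
  refine hq.isOpen_preimage.1 ?_
  have : Quot.mk (JoinRel A B) ⁻¹' ({x : TopJoin A B | tX x < 1} ∩ αX a₀ ⁻¹' O) =
      {p : A × B × unitInterval | (p.2.2 : ℝ) < 1} ∩ Prod.fst ⁻¹' O := by
    ext p
    change ((p.2.2 : ℝ) < 1 ∧ (if (p.2.2 : ℝ) < 1 then p.1 else a₀) ∈ O) ↔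
      ((p.2.2 : ℝ) < 1 ∧ p.1 ∈ O)
    refine and_congr_right fun h => ?_
    rw [if_pos h]
  refine this.symm ▸ ?_
  exact (isOpen_lt (by fun_prop) (by fun_prop)).inter (hO.preimage continuous_fst)

lemma continuousOn_βX (b₀ : B) : ContinuousOn (βX b₀ : TopJoin A B → B) {x | 0 < tX x} := by
  have ho : IsOpen {x : TopJoin A B | 0 < tX x} := isOpen_lt continuous_const continuous_tX
  rw [continuousOn_open_iff ho]
  intro O hO
  have hq : Topology.IsQuotientMap (Quot.mk (JoinRel A B)) := isQuotientMap_quot_mk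
  refine hq.isOpen_preimage.1 ?_
  have : Quot.mk (JoinRel A B) ⁻¹' ({x : TopJoin A B | 0 < tX x} ∩ βX b₀ ⁻¹' O) =
      {p : A × B × unitInterval | 0 < (p.2.2 : ℝ)} ∩ (fun p => p.2.1) ⁻¹' O := by
    ext p
    change (0 < (p.2.2 : ℝ) ∧ (if 0 < (p.2.2 : ℝ) then p.2.1 else b₀) ∈ O) ↔
      (0 < (p.2.2 : ℝ) ∧ p.2.1 ∈ O)
    refine and_congr_right fun h => ?_
    rw [if_pos h]
  refine this.symm ▸ ?_
  exact (isOpen_lt (by fun_prop) (by fun_prop)).inter (hO.preimage (by fun_prop))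

lemma exists_stretch (a₀ : A) (b₀ : B) : ∃ L : TopJoin A B → ℝ → TopJoin A B,
    Continuous (fun z : TopJoin A B × ℝ => L z.1 z.2) ∧ (∀ x, L x 0 = x) ∧
    ∀ x, L x 1 = J (αX a₀ x) (βX b₀ x) (3 * tX x - 1) := by
  let f : A × B × unitInterval → C(unitInterval, TopJoin A B) := fun p =>
    ⟨fun s => J p.1 p.2.1 ((p.2.2 : ℝ) + s * (2 * p.2.2 - 1)), by
      exact continuous_J.comp (f := fun s : unitInterval =>
        (p.1, p.2.1, (p.2.2 : ℝ) + s * (2 * p.2.2 - 1))) (by fun_prop)⟩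
  have hf : Continuous f := by
    refine ContinuousMap.continuous_of_continuous_uncurry _ ?_
    exact continuous_J.comp (f := fun z : (A × B × unitInterval) × unitInterval =>
        (z.1.1, z.1.2.1, (z.1.2.2 : ℝ) + z.2 * (2 * z.1.2.2 - 1))) (by fun_prop)
  have hcompat : ∀ p q, JoinRel A B p q → f p = f q := by
    rintro _ _ (⟨a, b, b'⟩ | ⟨a, a', b⟩)
    · ext s
      have := s.2.1
      refine J_zero ?_ ?_ <;> simpa using this
    · ext s
      have := s.2.1
      refine J_one ?_ ?_ <;> norm_num <;> exact this
  let L' : TopJoin A B → C(unitInterval, TopJoin A B) := Quot.lift f hcompat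
  have hL' : Continuous L' := continuous_quot_lift _ hf
  refine ⟨fun x s => L' x (Set.projIcc 0 1 zero_le_one s), ?_, ?_, ?_⟩
  · exact (hL'.comp continuous_fst).eval (continuous_projIcc.comp continuous_snd)
  · intro x
    obtain ⟨⟨a, b, t⟩, rfl⟩ := Quot.exists_rep x
    change J a b ((t : ℝ) + (Set.projIcc (0:ℝ) 1 zero_le_one 0 : unitInterval) * (2 * t - 1)) = _
    simp [J]
    rfl
  · intro x
    obtain ⟨⟨a, b, t⟩, rfl⟩ := Quot.exists_rep x
    change J a b ((t : ℝ) + (Set.projIcc (0:ℝ) 1 zero_le_one 1 : unitInterval) * (2 * t - 1)) =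
      J (if (t : ℝ) < 1 then a else a₀) (if 0 < (t : ℝ) then b else b₀) (3 * (t : ℝ) - 1)
    have e : (t : ℝ) + (Set.projIcc (0:ℝ) 1 zero_le_one 1 : unitInterval) * (2 * t - 1) =
      3 * (t : ℝ) - 1 := by simp; ring
    rw [e]
    apply J_congr
    · intro h
      rw [if_pos (by linarith)]
    · intro h
      rw [if_pos (by linarith)]

end TopJoinAux

/-- collapse map of the line -/
noncomputable def col (a u : ℝ) : ℝ := u + (max 0 (min 1 (5 * Int.fract u - a)) - Int.fract u)

lemma continuous_col {a : ℝ} (h1 : 1 ≤ a) (h3 : a ≤ 3) : Continuous (col a) := by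
  unfold col
  refine continuous_id.add ?_
  refine ContinuousOn.comp_fract'' (f := fun v : ℝ => max 0 (min 1 (5 * v - a)) - v)
    (by fun_prop) ?_
  have e0 : max 0 (min 1 (5 * 0 - a)) = 0 :=
    max_eq_left ((min_le_right _ _).trans (by linarith))
  have e1 : max 0 (min 1 (5 * 1 - a)) = 1 := by
    rw [min_eq_left (by linarith)]; simp
  rw [e0, e1]; norm_num

lemma col_mem {a : ℝ} (h1 : 1 ≤ a) (u : ℝ) :
    (⌊u⌋ : ℝ) ≤ col a u ∧ col a u ≤ ⌈u⌉ := by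
  have hu := Int.floor_add_fract u
  by_cases h : Int.fract u = 0
  · have e : col a u = u := by
      have e0 : max 0 (min 1 (5 * 0 - a)) = 0 :=
        max_eq_left ((min_le_right _ _).trans (by linarith))
      rw [col, h, e0]; simp
    rw [e]
    exact ⟨Int.floor_le u, Int.le_ceil u⟩
  · rw [ceil_of_fract_ne h]
    push_cast
    have k0 : 0 ≤ max 0 (min 1 (5 * Int.fract u - a)) := le_max_left _ _
    have k1 : max 0 (min 1 (5 * Int.fract u - a)) ≤ 1 := max_le zero_le_one (min_le_left _ _)
    simp only [col]
    constructor <;> linarith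

/-- the zone not collapsed by `col a` -/
def Zone (a : ℝ) : Set ℝ := {u | a / 5 ≤ Int.fract u ∧ Int.fract u ≤ (a + 1) / 5}

lemma zone_of_col {a u : ℝ} (h : Int.fract (col a u) ≠ 0) : u ∈ Zone a := by
  by_contra hz
  apply h
  have hu := Int.floor_add_fract u
  have : Int.fract u < a / 5 ∨ (a + 1) / 5 < Int.fract u := by
    by_contra! hh
    exact hz ⟨hh.1, hh.2⟩
  rw [Int.fract_eq_zero_iff]
  rcases this with h | h
  · refine ⟨⌊u⌋, ?_⟩
    have e0 : max 0 (min 1 (5 * Int.fract u - a)) = 0 :=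
      max_eq_left ((min_le_right _ _).trans (by linarith))
    rw [col, e0]; linarith
  · refine ⟨⌊u⌋ + 1, ?_⟩
    have e1 : max 0 (min 1 (5 * Int.fract u - a)) = 1 := by
      rw [min_eq_left (by linarith)]; simp
    rw [col, e1]; push_cast; linarith

lemma isClosed_zone {a : ℝ} (h1 : 1 ≤ a) (h3 : a ≤ 3) : IsClosed (Zone a) := by
  have hc : Continuous ((fun v : ℝ => min |v - (2 * a + 1) / 10| (1 / 5)) ∘ Int.fract) := by
    refine ContinuousOn.comp_fract'' (by fun_prop) ?_
    have e0 : (1 : ℝ) / 5 ≤ |0 - (2 * a + 1) / 10| := by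
      rw [le_abs]; right; linarith
    have e1 : (1 : ℝ) / 5 ≤ |1 - (2 * a + 1) / 10| := by
      rw [le_abs]; left; linarith
    rw [min_eq_right e0, min_eq_right e1]
  have : Zone a = ((fun v : ℝ => min |v - (2 * a + 1) / 10| (1 / 5)) ∘ Int.fract) ⁻¹' Iic (1 / 10) := by
    ext u
    simp only [Zone, mem_ofPred_eq, mem_preimage, Function.comp, mem_Iic, min_le_iff, abs_le]
    constructor
    · rintro ⟨h, h'⟩
      left; constructor <;> linarith
    · rintro (⟨h, h'⟩ | h)
      · constructor <;> linarith
      · norm_num at h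
  rw [this]
  exact isClosed_Iic.preimage hc

/-- coordinatewise straight-line homotopy from the identity to the collapse -/
noncomputable def colh {m : ℕ} (a s : ℝ) (x : Fin m → ℝ) : Fin m → ℝ :=
  fun i => (1 - s) * x i + s * col a (x i)

lemma continuous_colh {m : ℕ} {a : ℝ} (h1 : 1 ≤ a) (h3 : a ≤ 3) :
    Continuous (fun z : (Fin m → ℝ) × ℝ => colh a z.2 z.1) := by
  have := continuous_col h1 h3
  unfold colh
  fun_prop

lemma colh_mem {m : ℕ} {a s : ℝ} (h1 : 1 ≤ a) (hs : s ∈ Icc (0 : ℝ) 1) (x : Fin m → ℝ) :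
    colh a s x ∈ gcell x := by
  have hs0 := hs.1
  have hs1 := hs.2
  constructor
  · intro i
    have := (col_mem h1 (x i)).1
    have := Int.floor_le (x i)
    simp only [colh]; nlinarith
  · intro i
    have := (col_mem h1 (x i)).2
    have := Int.le_ceil (x i)
    simp only [colh]; nlinarith

open Classical in
lemma colh_skel {m N d : ℕ} {a : ℝ} (h1 : 1 ≤ a) {x : Fin m → ℝ}
    (hx : x ∈ closedBall (0 : Fin m → ℝ) N)
    (h : ¬ (d ≤ (Finset.univ.filter fun i => x i ∈ Zone a).card)) : colh a 1 x ∈ Skel N d := by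
  refine ⟨gcell_sub_ball hx (colh_mem h1 (by simp) x), ?_⟩
  refine lt_of_le_of_lt (Finset.card_le_card ?_) (not_le.1 h)
  intro i hi
  rw [mem_nint] at hi
  simp only [Finset.mem_filter, Finset.mem_univ, true_and]
  apply zone_of_col
  simpa [colh] using hi

lemma cellular_sphere {m N : ℕ} : Cellular (sphere (0 : Fin m → ℝ) N) := by
  refine ⟨isClosed_sphere, ?_⟩
  intro x hx y hy
  have hyb : ‖y‖ ≤ N := by simpa using gcell_sub_ball (sphere_subset_closedBall hx) hy
  rw [mem_sphere_zero_iff_norm] at hx ⊢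
  refine le_antisymm hyb ?_
  by_contra! hlt
  have hN : (0 : ℝ) < N := lt_of_le_of_lt (norm_nonneg y) hlt
  have : ‖x‖ < N := by
    rw [pi_norm_lt_iff hN]
    intro i
    refine lt_of_le_of_ne (hx ▸ norm_le_pi_norm x i) ?_
    intro hi
    have hfr : Int.fract (x i) = 0 := by
      rw [Int.fract_eq_zero_iff]
      rcases eq_or_eq_neg_of_abs_eq hi with h | h
      · exact ⟨N, by rw [h]; simp⟩
      · exact ⟨-N, by rw [h]; simp⟩
    have := norm_le_pi_norm y i
    rw [eq_of_fract_zero hy hfr, hi] at this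
    linarith
  linarith

lemma cellular_cells {m N : ℕ} (P : (Fin m → ℝ) → Prop) :
    Cellular (⋃ c ∈ {c | c ∈ gmid '' closedBall (0 : Fin m → ℝ) N ∧ P c}, gcell c) := by
  constructor
  · exact Set.Finite.isClosed_biUnion ((finite_gmid N).subset fun c hc => hc.1)
      fun c _ => isClosed_Icc
  · intro x hx
    obtain ⟨c, hc, hxc⟩ := mem_iUnion₂.1 hx
    exact (gcell_sub hxc).trans (subset_biUnion_of_mem (u := gcell) hc)

lemma norm_sub_le_of_gcell {m : ℕ} {x y : Fin m → ℝ} (h : y ∈ gcell x) : ‖x - y‖ ≤ 1 := by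
  rw [pi_norm_le_iff_of_nonneg zero_le_one]
  intro i
  have h1 := h.1 i
  have h2 := h.2 i
  have h3 := Int.floor_le (x i)
  have h4 := Int.le_ceil (x i)
  have h5 : (⌈x i⌉ : ℝ) ≤ ⌊x i⌋ + 1 := by exact_mod_cast Int.ceil_le_floor_add_one (x i)
  simp only at h1 h2
  rw [Real.norm_eq_abs, abs_le, Pi.sub_apply]
  constructor <;> linarith

open TopJoinAux in
theorem EP_join {A B : Type*} [TopologicalSpace A] [TopologicalSpace B] (a₀ : A) (b₀ : B)
    {p q m : ℕ} (hA : ∀ i ≤ p, EP i A) (hB : ∀ i ≤ q, EP i B) (hm : m ≤ p + q + 1) :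
    EP m (TopJoin A B) := by
  classical
  intro g₀ hg₀
  have hu := (isCompact_sphere (0 : Fin m → ℝ) 1).uniformContinuousOn_of_continuous
    (continuous_tX.comp_continuousOn hg₀)
  rw [Metric.uniformContinuousOn_iff] at hu
  obtain ⟨δ, hδ, hu⟩ := hu (1 / 3) (by norm_num)
  obtain ⟨n, hn⟩ := exists_nat_one_div_lt hδ
  set N : ℕ := n + 1 with hNdef
  have hN : (0 : ℝ) < N := by positivity
  apply ExtB.scale hN
  set g : (Fin m → ℝ) → TopJoin A B := fun x => g₀ ((N : ℝ)⁻¹ • x) with hgdef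
  have hscale : ∀ x ∈ sphere (0 : Fin m → ℝ) N, (N : ℝ)⁻¹ • x ∈ sphere (0 : Fin m → ℝ) 1 := by
    intro x hx
    rw [mem_sphere_zero_iff_norm] at hx ⊢
    rw [norm_smul, hx, norm_inv, Real.norm_eq_abs, abs_of_pos hN, inv_mul_cancel₀ hN.ne']
  have hg : ContinuousOn g (sphere 0 N) := hg₀.comp (by fun_prop) hscale
  set t : (Fin m → ℝ) → ℝ := fun x => tX (g x) with htdef
  have ht : ContinuousOn t (sphere 0 N) := continuous_tX.comp_continuousOn hg
  have hosc : ∀ x ∈ sphere (0 : Fin m → ℝ) N, ∀ y ∈ gcell x, |t x - t y| < 1 / 3 := by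
    intro x hx y hy
    have hy' := cellular_sphere.2 x hx hy
    have := hu _ (hscale x hx) _ (hscale y hy') ?_
    · rw [Real.dist_eq] at this
      exact this
    · rw [dist_eq_norm, ← smul_sub, norm_smul, norm_inv, Real.norm_eq_abs, abs_of_pos hN]
      refine lt_of_le_of_lt ?_ hn
      have := norm_sub_le_of_gcell hy
      rw [one_div, hNdef]
      push_cast
      refine mul_le_of_le_one_right (by positivity) this
  -- the two cellular pieces
  let C : Set (Fin m → ℝ) := ⋃ c ∈ {c | c ∈ gmid '' closedBall (0 : Fin m → ℝ) N ∧
    (gcell c ⊆ sphere 0 N ∧ ∀ z ∈ gcell c, t z < 1)}, gcell c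
  let E : Set (Fin m → ℝ) := ⋃ c ∈ {c | c ∈ gmid '' closedBall (0 : Fin m → ℝ) N ∧
    (gcell c ⊆ sphere 0 N ∧ ∀ z ∈ gcell c, 0 < t z)}, gcell c
  have hC : Cellular C := cellular_cells _
  have hE : Cellular E := cellular_cells _
  have hCs : ∀ x ∈ C, x ∈ sphere (0 : Fin m → ℝ) N ∧ t x < 1 := by
    intro x hx
    obtain ⟨c, hc, hxc⟩ := mem_iUnion₂.1 hx
    exact ⟨hc.2.1 hxc, hc.2.2 x hxc⟩
  have hEs : ∀ x ∈ E, x ∈ sphere (0 : Fin m → ℝ) N ∧ 0 < t x := by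
    intro x hx
    obtain ⟨c, hc, hxc⟩ := mem_iUnion₂.1 hx
    exact ⟨hc.2.1 hxc, hc.2.2 x hxc⟩
  have hC1 : ∀ x ∈ sphere (0 : Fin m → ℝ) N, 3 * t x - 1 < 1 → x ∈ C := by
    intro x hx h
    refine mem_iUnion₂.2 ⟨gmid x, ⟨⟨x, sphere_subset_closedBall hx, rfl⟩, ?_⟩, ?_⟩ <;>
      rw [gcell_gmid]
    · refine ⟨cellular_sphere.2 x hx, fun z hz => ?_⟩
      have := abs_lt.1 (hosc x hx z hz)
      linarith
    · exact mem_gcell_self x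
  have hE0 : ∀ x ∈ sphere (0 : Fin m → ℝ) N, 0 < 3 * t x - 1 → x ∈ E := by
    intro x hx h
    refine mem_iUnion₂.2 ⟨gmid x, ⟨⟨x, sphere_subset_closedBall hx, rfl⟩, ?_⟩, ?_⟩ <;>
      rw [gcell_gmid]
    · refine ⟨cellular_sphere.2 x hx, fun z hz => ?_⟩
      have := abs_lt.1 (hosc x hx z hz)
      linarith
    · exact mem_gcell_self x
  have hα₀ : ContinuousOn (fun x => αX a₀ (g x)) C :=
    (continuousOn_αX a₀).comp (hg.mono fun x hx => (hCs x hx).1) fun x hx => (hCs x hx).2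
  have hβ₀ : ContinuousOn (fun x => βX b₀ (g x)) E :=
    (continuousOn_βX b₀).comp (hg.mono fun x hx => (hEs x hx).1) fun x hx => (hEs x hx).2
  obtain ⟨α, hα, hαe⟩ := extend_skel (N := N) hC hα₀ (p + 1) (fun i hi => hA i (by omega))
  obtain ⟨β, hβ, hβe⟩ := extend_skel (N := N) hE hβ₀ (q + 1) (fun i hi => hB i (by omega))
  have cc3 : Continuous (colh (m := m) 3 1) :=
    (continuous_colh (by norm_num) (by norm_num)).comp (Continuous.prodMk continuous_id
      continuous_const)
  have cc1 : Continuous (colh (m := m) 1 1) :=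
    (continuous_colh (by norm_num) (by norm_num)).comp (Continuous.prodMk continuous_id
      continuous_const)
  let C2 : Set (Fin m → ℝ) := colh 3 1 ⁻¹' (C ∪ Skel N (p + 1))
  let E2 : Set (Fin m → ℝ) := colh 1 1 ⁻¹' (E ∪ Skel N (q + 1))
  have hC2 : IsClosed C2 := (hC.union (cellular_skel N (p + 1))).1.preimage cc3
  have hE2 : IsClosed E2 := (hE.union (cellular_skel N (q + 1))).1.preimage cc1
  have hα2 : ContinuousOn (fun x => α (colh 3 1 x)) C2 :=
    hα.comp cc3.continuousOn fun x hx => hx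
  have hβ2 : ContinuousOn (fun x => β (colh 1 1 x)) E2 :=
    hβ.comp cc1.continuousOn fun x hx => hx
  have hCC2 : C ⊆ C2 := fun x hx => Or.inl (hC.2 x hx (colh_mem (by norm_num) (by simp) x))
  have hEE2 : E ⊆ E2 := fun x hx => Or.inl (hE.2 x hx (colh_mem (by norm_num) (by simp) x))
  -- Urysohn function
  obtain ⟨τ, hτ0, hτ1, -⟩ := exists_continuous_zero_one_of_isClosed
    (isClosed_card (m := m) (Zone 1) (isClosed_zone (by norm_num) (by norm_num)) (q + 1))
    (isClosed_card (m := m) (Zone 3) (isClosed_zone (by norm_num) (by norm_num)) (p + 1))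
    (by
      rw [Set.disjoint_left]
      intro x h1 h3
      simp only [mem_ofPred_eq] at h1 h3
      have hd : Disjoint (Finset.univ.filter fun i => x i ∈ Zone 1)
          (Finset.univ.filter fun i => x i ∈ Zone 3) := by
        rw [Finset.disjoint_filter]
        rintro i - ⟨_, h⟩ ⟨h', _⟩
        norm_num at h h'
        linarith
      have := Finset.card_union_of_disjoint hd
      have h2 := Finset.card_le_univ ((Finset.univ.filter fun i => x i ∈ Zone 1) ∪
          (Finset.univ.filter fun i => x i ∈ Zone 3))
      rw [Fintype.card_fin] at h2
      omega)
  have hτC : ∀ x ∈ closedBall (0 : Fin m → ℝ) N, τ x < 1 → x ∈ C2 := by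
    intro x hx h
    refine Or.inr (colh_skel (by norm_num) hx ?_)
    intro hcard
    have := hτ1 hcard
    simp only [Pi.one_apply] at this
    linarith
  have hτE : ∀ x ∈ closedBall (0 : Fin m → ℝ) N, 0 < τ x → x ∈ E2 := by
    intro x hx h
    refine Or.inr (colh_skel (by norm_num) hx ?_)
    intro hcard
    have := hτ0 hcard
    simp only [Pi.zero_apply] at this
    linarith
  have hsb : ∀ x ∈ sphere (0 : Fin m → ℝ) N, x ∈ closedBall (0 : Fin m → ℝ) N :=
    fun x hx => sphere_subset_closedBall hx
  have k0 : ExtB (N : ℝ) (fun x => J (α (colh 3 1 x)) (β (colh 1 1 x)) (τ x)) :=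
    ⟨_, continuousOn_J a₀ b₀ isClosed_closedBall hC2 hE2 hα2 hβ2 τ.continuous.continuousOn
      hτC hτE, fun _ _ => rfl⟩
  have hSI : IsClosed (sphere (0 : Fin m → ℝ) N ×ˢ Icc (0 : ℝ) 1) :=
    isClosed_sphere.prod isClosed_Icc
  have hfst : MapsTo Prod.fst (sphere (0 : Fin m → ℝ) N ×ˢ Icc (0 : ℝ) 1) (sphere 0 N) :=
    fun z hz => hz.1
  have htf : ContinuousOn (fun z : (Fin m → ℝ) × ℝ => t z.1)
      (sphere (0 : Fin m → ℝ) N ×ˢ Icc (0 : ℝ) 1) := ht.comp continuousOn_fst hfst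
  have k1 : ExtB (N : ℝ) (fun x => J (α (colh 3 1 x)) (β (colh 1 1 x)) (3 * t x - 1)) := by
    refine k0.hep hN (fun x s => J (α (colh 3 1 x)) (β (colh 1 1 x))
      ((1 - s) * (3 * t x - 1) + s * τ x)) ?_ ?_ ?_
    · refine continuousOn_J (C := Prod.fst ⁻¹' C2) (E := Prod.fst ⁻¹' E2) a₀ b₀ hSI
        (hC2.preimage continuous_fst) (hE2.preimage continuous_fst)
        (hα2.comp continuousOn_fst fun z hz => hz) (hβ2.comp continuousOn_fst fun z hz => hz)
        ?_ ?_ ?_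
      · have := τ.continuous
        fun_prop
      · rintro ⟨x, s⟩ ⟨hx, hs0, hs1⟩ h
        simp only at h hx hs0 hs1
        rcases lt_or_ge (3 * t x - 1) 1 with h1 | h1
        · exact hCC2 (hC1 x hx h1)
        · refine hτC x (hsb x hx) ?_
          by_contra! h2
          nlinarith
      · rintro ⟨x, s⟩ ⟨hx, hs0, hs1⟩ h
        simp only at h hx hs0 hs1
        rcases lt_or_ge 0 (3 * t x - 1) with h1 | h1
        · exact hEE2 (hE0 x hx h1)
        · refine hτE x (hsb x hx) ?_
          by_contra! h2
          nlinarith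
    · intro x _; simp
    · intro x _; simp
  have k2 : ExtB (N : ℝ) (fun x => J (α x) (β x) (3 * t x - 1)) := by
    refine k1.hep hN (fun x s => J (α (colh 3 s x)) (β (colh 1 s x)) (3 * t x - 1)) ?_ ?_ ?_
    · refine continuousOn_J (C := C ×ˢ Icc (0 : ℝ) 1) (E := E ×ˢ Icc (0 : ℝ) 1) a₀ b₀ hSI
        (hC.1.prod isClosed_Icc) (hE.1.prod isClosed_Icc)
        ((hα.mono subset_union_left).comp
          (continuous_colh (by norm_num) (by norm_num)).continuousOn ?_)
        ((hβ.mono subset_union_left).comp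
          (continuous_colh (by norm_num) (by norm_num)).continuousOn ?_) ?_ ?_ ?_
      · rintro ⟨x, s⟩ ⟨hx, hs⟩
        exact hC.2 x hx (colh_mem (by norm_num) hs x)
      · rintro ⟨x, s⟩ ⟨hx, hs⟩
        exact hE.2 x hx (colh_mem (by norm_num) hs x)
      · fun_prop
      · rintro ⟨x, s⟩ ⟨hx, hs⟩ h
        exact ⟨hC1 x hx h, hs⟩
      · rintro ⟨x, s⟩ ⟨hx, hs⟩ h
        exact ⟨hE0 x hx h, hs⟩
    · intro x _
      have e : ∀ a : ℝ, colh a 0 x = x := fun a => by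
        funext i
        simp [colh]
      rw [e, e]
    · intro x _; rfl
  obtain ⟨L, hL, hL0, hL1⟩ := exists_stretch a₀ b₀
  refine k2.hep hN (fun x s => L (g x) s) ?_ ?_ ?_
  · exact hL.comp_continuousOn (f := fun z : (Fin m → ℝ) × ℝ => (g z.1, z.2))
      ((hg.comp continuousOn_fst hfst).prodMk continuousOn_snd)
  · intro x _; exact hL0 _
  · intro x hx
    simp only [hL1]
    refine J_congr (fun h => ?_) (fun h => ?_)
    · exact (hαe (hC1 x hx h)).symm
    · exact (hβe (hE0 x hx h)).symm

lemma EP_of_NConnected {X : Type*} [TopologicalSpace X] {k : ℤ} (h : NConnected k X) (i : ℕ)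
    (hi : i ≤ (k + 1).toNat) : EP i X := by
  rcases i with _ | i
  · exact EP_zero h.1
  · exact EP_succ_of_pi fun x => h.2 i x (by omega)

/-- If `A` is `k`-connected and `B` is `l`-connected, then the join `A * B`
is `(k + l + 1)`-connected. -/
theorem join_connectivity {A B : Type*} [TopologicalSpace A] [TopologicalSpace B]
    (k l : ℤ) (hA : NConnected k A) (hB : NConnected l B) :
    NConnected (k + l + 1) (TopJoin A B) := by
  obtain ⟨a₀⟩ := hA.1
  obtain ⟨b₀⟩ := hB.1
  refine ⟨⟨TopJoinAux.J a₀ b₀ 0⟩, fun i x hi => subsingleton_pi_of_EP ?_ x⟩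
  exact EP_join a₀ b₀ (EP_of_NConnected hA) (EP_of_NConnected hB) (by omega)
end

section
/- Let d_1, ..., d_l ≥ 1 and s_1, ..., s_l ≥ 0 be integers with s_i < d_i for all i (so the i-th factor is the (s_i - 1)-skeleton of Δ^{d_i - 1}, a proper skeleton). Then the join of the skeleta Δ^{d_1-1}_{(s_1-1)} * ... * Δ^{d_l-1}_{(s_l-1)} (empty factors, where s_i = 0, are omitted from the join) is homotopy equivalent to a wedge of spheres of dimension (Σ_i s_i) - 1, and hence is ((Σ_i s_i) - 2)-connected but not ((Σ_i s_i) - 1)-connected, provided Σ_i s_i ≥ 1. -/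
/-- An abstract simplicial complex on a vertex set `V`. -/
structure SComplex (V : Type*) where
  faces : Set (Finset V)
  nonempty_of_mem : ∀ σ ∈ faces, σ.Nonempty
  down_closed : ∀ σ ∈ faces, ∀ τ, τ ⊆ σ → τ.Nonempty → τ ∈ faces

/-- The geometric realization of an abstract simplicial complex. -/
def SComplex.Realization {V : Type*} [Fintype V] (K : SComplex V) : Type _ :=
  {f : V → ℝ // (∀ v, 0 ≤ f v) ∧ (∑ v, f v = 1) ∧ ∃ σ ∈ K.faces, ∀ v, f v ≠ 0 → v ∈ σ}

instance {V : Type*} [Fintype V] (K : SComplex V) : TopologicalSpace K.Realization := by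
  unfold SComplex.Realization; infer_instance

/-- The join of the `(s i - 1)`-skeleta of the simplices `Δ^{d i - 1}` (empty factors,
where `s i = 0`, are omitted): a face is a nonempty subset of the disjoint union of the
vertex sets whose restriction to the `i`-th vertex set has cardinality at most `s i`. -/
def joinSkeleta (l : ℕ) (d s : Fin l → ℕ) : SComplex (Σ i : Fin l, Fin (d i)) where
  faces := {σ | σ.Nonempty ∧ ∀ i, (σ.filter (fun p => p.1 = i)).card ≤ s i}
  nonempty_of_mem := fun _ h => h.1
  down_closed := fun _ h _ hsub hne =>
    ⟨hne, fun i => le_trans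
      (Finset.card_le_card (Finset.filter_subset_filter _ hsub)) (h.2 i)⟩

/-- The wedge of copies of a pointed space `(X, x0)` indexed by `N`. -/
def Wedge (N : Type*) (X : Type*) (x0 : X) : Type _ :=
  Quot (fun p q : N × X => p.2 = x0 ∧ q.2 = x0)

instance (N X : Type*) [TopologicalSpace X] (x0 : X) :
    TopologicalSpace (Wedge N X x0) :=
  letI : TopologicalSpace N := ⊥
  inferInstanceAs (TopologicalSpace (Quot _))


section
open Set Metric MeasureTheory Topology


theorem jsk_det_interp {m : ℕ} (E : Type*) [NormedAddCommGroup E] [InnerProductSpace ℝ E]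
    [FiniteDimensional ℝ E] (hm : Module.finrank ℝ E = m) (τ : ℝ) (hτ : 0 < τ) :
    ∃ (v : ℕ → ℝ) (w : ℕ → ℝ), (∀ k ∈ Finset.range (m+1), 0 ≤ v k ∧ v k ≤ τ) ∧
      (∑ k ∈ Finset.range (m+1), w k = 1) ∧
      ∀ A : E →L[ℝ] E, (1 + A).det = ∑ k ∈ Finset.range (m+1), w k * (1 + v k • A).det := by
  classical
  let v : ℕ → ℝ := fun k => τ * ((k:ℝ) / (m+1))
  have hinj : Set.InjOn v (Finset.range (m+1)) := by
    intro a _ b _ hab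
    have h1 : (0:ℝ) < m + 1 := by positivity
    simp only [v] at hab
    field_simp at hab
    exact_mod_cast hab
  have key : ∀ p : Polynomial ℝ, p.degree < ((Finset.range (m+1)).card : WithBot ℕ) →
      p.eval 1 = ∑ k ∈ Finset.range (m+1),
        (Lagrange.basis (Finset.range (m+1)) v k).eval 1 * p.eval (v k) := by
    intro p hp
    conv_lhs => rw [Lagrange.eq_interpolate hinj hp]
    rw [Lagrange.interpolate_apply, Polynomial.eval_finsetSum]
    refine Finset.sum_congr rfl fun k _ => ?_
    simp [mul_comm]
  refine ⟨v, fun k => (Lagrange.basis (Finset.range (m+1)) v k).eval 1, ?_, ?_, ?_⟩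
  · intro k hk
    have hk' : (k:ℝ) ≤ m + 1 := by
      have := Finset.mem_range.1 hk
      exact_mod_cast this.le
    refine ⟨by positivity, ?_⟩
    simp only [v]
    have : (k:ℝ)/(m+1) ≤ 1 := by rw [div_le_one (by positivity)]; exact hk'
    nlinarith
  · have := key 1 (by rw [Polynomial.degree_one]; simp; exact_mod_cast Nat.succ_pos m)
    simpa using this.symm
  · intro A
    let b := Module.finBasisOfFinrankEq ℝ E hm
    let M := LinearMap.toMatrix b b A.toLinearMap
    have hdet : ∀ t : ℝ, (1 + t • A).det =
        (Matrix.det ((Polynomial.X : Polynomial ℝ) • M.map Polynomial.C +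
          (1 : Matrix (Fin m) (Fin m) ℝ).map Polynomial.C)).eval t := by
      intro t
      have h1 : (1 + t • A).det = LinearMap.det ((1 + t • A : E →L[ℝ] E) : E →ₗ[ℝ] E) := rfl
      rw [h1, ← LinearMap.det_toMatrix b]
      rw [← Polynomial.coe_evalRingHom, RingHom.map_det]
      congr 1
      ext i j
      simp [M, LinearMap.toMatrix_apply, Matrix.one_apply, Finsupp.single_apply, eq_comm, add_comm]
      split_ifs <;> simp_all [mul_comm]
    have h2 := key (Matrix.det ((Polynomial.X : Polynomial ℝ) • M.map Polynomial.C +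
          (1 : Matrix (Fin m) (Fin m) ℝ).map Polynomial.C)) (by
        refine lt_of_le_of_lt Polynomial.degree_le_natDegree ?_
        have := Polynomial.natDegree_det_X_add_C_le M 1
        simp only [Fintype.card_fin] at this
        simp only [Finset.card_range]
        exact_mod_cast Nat.lt_succ_of_le this)
    rw [← hdet] at h2
    simp only [one_smul] at h2
    rw [h2]
    refine Finset.sum_congr rfl fun k _ => by rw [hdet]

theorem jsk_no_C1_retraction (E : Type*) [NormedAddCommGroup E] [InnerProductSpace ℝ E]
    [FiniteDimensional ℝ E] (G : E → E) (hG : ContDiff ℝ 1 G)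
    (hn : ∀ x, ‖G x‖ = 2) (hid : ∀ x, ‖x‖ = 2 → G x = x) : False := by
  let _ : MeasurableSpace E := borel E
  have : BorelSpace E := ⟨rfl⟩
  set h : E → E := fun x => G x - x with hh
  have hhc : ContDiff ℝ 1 h := hG.sub contDiff_id
  have hdc : Continuous (fderiv ℝ h) := hhc.continuous_fderiv one_ne_zero
  obtain ⟨C, hC⟩ : ∃ C, ∀ x ∈ closedBall (0:E) 2, ‖fderiv ℝ h x‖ ≤ C :=
    (isCompact_closedBall (0:E) 2).exists_bound_of_continuousOn hdc.continuousOn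
  have hC0 : 0 ≤ C := le_trans (norm_nonneg _) (hC 0 (by simp))
  have hlip : ∀ x ∈ closedBall (0:E) 2, ∀ y ∈ closedBall (0:E) 2, ‖h y - h x‖ ≤ C * ‖y - x‖ := by
    intro x hx y hy
    exact (convex_closedBall (0:E) 2).norm_image_sub_le_of_norm_fderiv_le
      (fun z _ => (hhc.differentiable one_ne_zero) z) hC hx hy
  obtain ⟨δ, hδ, hδdet⟩ : ∃ δ > 0, ∀ A : E →L[ℝ] E, ‖A‖ < δ → 0 < (1 + A).det := by
    have hc : ContinuousAt (fun A : E →L[ℝ] E => (1 + A).det) 0 :=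
      (ContinuousLinearMap.continuous_det.comp (continuous_const.add continuous_id)).continuousAt
    have h0 : (0:ℝ) < (1 + (0 : E →L[ℝ] E)).det := by
      rw [add_zero]
      have : (1 : E →L[ℝ] E).det = 1 := by
        simp [ContinuousLinearMap.det]
      rw [this]; exact one_pos
    have := hc.eventually (lt_mem_nhds h0)
    obtain ⟨δ, hδ, hb⟩ := Metric.eventually_nhds_iff.1 this
    exact ⟨δ, hδ, fun A hA => hb (by simpa [dist_eq_norm] using hA)⟩
  obtain ⟨τ, hτ, hτ1, hτδ, hτC⟩ : ∃ τ > 0, τ < (1:ℝ) ∧ τ * C < δ ∧ τ * C < 1 := by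
    have hp : 0 < C + 1 := by linarith
    refine ⟨min (1/2) (min (δ / (2 * (C+1))) (1/(2*(C+1)))), by positivity,
      lt_of_le_of_lt (min_le_left _ _) (by norm_num), ?_, ?_⟩
    · calc _ ≤ δ / (2 * (C+1)) * C := by
            gcongr; exact (min_le_right _ _).trans (min_le_left _ _)
        _ < δ := by
          rw [div_mul_eq_mul_div, div_lt_iff₀ (by positivity)]; nlinarith
    · calc _ ≤ 1 / (2 * (C+1)) * C := by
            gcongr; exact (min_le_right _ _).trans (min_le_right _ _)
        _ < 1 := by
          rw [div_mul_eq_mul_div, div_lt_iff₀ (by positivity)]; nlinarith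
  -- the key volume identity for small t
  have hvol : ∀ t, 0 ≤ t → t ≤ τ →
      ∫ x in ball (0:E) 2, (1 + t • fderiv ℝ h x).det = (volume (ball (0:E) 2)).toReal := by
    intro t ht0 htτ
    have htC : t * C < 1 := lt_of_le_of_lt (by gcongr) hτC
    have hpos : ∀ x ∈ ball (0:E) 2, 0 < (1 + t • fderiv ℝ h x).det := by
      intro x hx
      apply hδdet
      rw [norm_smul, Real.norm_of_nonneg ht0]
      refine lt_of_le_of_lt ?_ hτδ
      gcongr
      exact hC x (ball_subset_closedBall hx)
    let Φ : E → E := fun x => x + t • h x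
    have hΦc : Continuous Φ := continuous_id.add (hhc.continuous.const_smul t)
    have hΦd : ∀ x, HasStrictFDerivAt Φ (1 + t • fderiv ℝ h x) x := by
      intro x
      exact (hasStrictFDerivAt_id x).add
        (((hhc.contDiffAt).hasStrictFDerivAt one_ne_zero).const_smul t)
    have hinj : InjOn Φ (closedBall (0:E) 2) := by
      intro x hx y hy hxy
      by_contra hne
      have h1 : y - x = t • (h x - h y) := by
        simp only [Φ] at hxy
        rw [smul_sub, sub_eq_sub_iff_add_eq_add, ← hxy, add_comm]
      have h2 : ‖y - x‖ ≤ t * (C * ‖y - x‖) := by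
        calc ‖y - x‖ = ‖t • (h x - h y)‖ := by rw [← h1]
          _ = t * ‖h x - h y‖ := by rw [norm_smul, Real.norm_of_nonneg ht0]
          _ ≤ t * (C * ‖x - y‖) := by gcongr; exact hlip y hy x hx
          _ = _ := by rw [norm_sub_rev]
      have h3 : 0 < ‖y - x‖ := norm_pos_iff.2 (sub_ne_zero.2 (Ne.symm hne))
      nlinarith
    have hmaps : ∀ x ∈ ball (0:E) 2, Φ x ∈ ball (0:E) 2 := by
      intro x hx
      rw [mem_ball_zero_iff] at hx ⊢
      have : Φ x = (1 - t) • x + t • G x := by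
        simp only [Φ, hh, smul_sub, sub_smul, one_smul]; abel
      rw [this]
      calc _ ≤ ‖(1 - t) • x‖ + ‖t • G x‖ := norm_add_le _ _
        _ = (1-t) * ‖x‖ + t * 2 := by
          rw [norm_smul, norm_smul, hn, Real.norm_of_nonneg ht0, Real.norm_of_nonneg (by linarith)]
        _ < 2 := by nlinarith
    have himg : Φ '' ball (0:E) 2 = ball (0:E) 2 := by
      have hopen : IsOpen (Φ '' ball (0:E) 2) := by
        rw [isOpen_iff_mem_nhds]
        rintro _ ⟨x, hx, rfl⟩
        have hsurj : (1 + t • fderiv ℝ h x).range = ⊤ := by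
          rw [LinearMap.range_eq_top]
          exact (LinearMap.equivOfDetNeZero ((1 + t • fderiv ℝ h x : E →L[ℝ] E) : E →ₗ[ℝ] E)
            (hpos x hx).ne').surjective
        rw [← (hΦd x).map_nhds_eq_of_surj hsurj]
        exact Filter.image_mem_map (isOpen_ball.mem_nhds hx)
      have hclosed : Φ '' closedBall (0:E) 2 ∩ ball (0:E) 2 = Φ '' ball (0:E) 2 := by
        apply Subset.antisymm
        · rintro _ ⟨⟨x, hx, rfl⟩, hy⟩
          refine ⟨x, ?_, rfl⟩
          rw [mem_closedBall_zero_iff] at hx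
          rw [mem_ball_zero_iff]
          refine lt_of_le_of_ne hx fun heq => ?_
          have : Φ x = x := by simp [Φ, hh, hid x heq]
          rw [this, mem_ball_zero_iff] at hy
          exact hy.ne heq
        · rintro _ ⟨x, hx, rfl⟩
          exact ⟨⟨x, ball_subset_closedBall hx, rfl⟩, hmaps x hx⟩
      refine Subset.antisymm (by rintro _ ⟨x, hx, rfl⟩; exact hmaps x hx) ?_
      have hK : IsClosed (Φ '' closedBall (0:E) 2) :=
        ((isCompact_closedBall (0:E) 2).image hΦc).isClosed
      have hpre : IsPreconnected (ball (0:E) 2) := (convex_ball (0:E) 2).isPreconnected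
      refine hpre.subset_of_closure_inter_subset hopen ?_ ?_
      · exact ⟨Φ 0, hmaps 0 (by simp), ⟨0, by simp, rfl⟩⟩
      · rintro y ⟨hy1, hy2⟩
        rw [← hclosed]
        refine ⟨?_, hy2⟩
        exact (closure_minimal (image_mono ball_subset_closedBall) hK) hy1
    have := integral_image_eq_integral_abs_det_fderiv_smul (volume : Measure E) measurableSet_ball
      (fun x _ => ((hΦd x).hasFDerivAt).hasFDerivWithinAt) (hinj.mono ball_subset_closedBall)
      (fun _ => (1:ℝ))
    rw [himg] at this
    simp only [smul_eq_mul, mul_one, integral_const] at this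
    rw [setIntegral_congr_fun measurableSet_ball
      (fun x hx => (abs_of_pos (hpos x hx)).symm), ← this]
    simp [Measure.real]
  obtain ⟨v, w, hv, hw, hinterp⟩ := jsk_det_interp E rfl τ hτ
  have hz : ∀ x, (1 + fderiv ℝ h x).det = 0 := by
    intro x
    have h1 : (1 + fderiv ℝ h x : E →L[ℝ] E) = fderiv ℝ G x := by
      have : fderiv ℝ h x = fderiv ℝ G x - ContinuousLinearMap.id ℝ E := by
        exact (((hG.differentiable one_ne_zero x).hasFDerivAt).sub (hasFDerivAt_id x)).fderiv
      rw [this]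
      ext; simp
    rw [h1]
    by_contra hdet
    have hsur : Function.Surjective (fderiv ℝ G x) :=
      (LinearMap.equivOfDetNeZero ((fderiv ℝ G x : E →L[ℝ] E) : E →ₗ[ℝ] E) hdet).surjective
    obtain ⟨u, hu⟩ := hsur (G x)
    have hd := (hG.differentiable one_ne_zero x).hasFDerivAt
    have hd2 := hd.norm_sq
    have hconst : (fun x => ‖G x‖ ^ 2) = fun _ => (4:ℝ) := by
      funext y; rw [hn]; norm_num
    rw [hconst] at hd2
    have := hd2.unique (hasFDerivAt_const (4:ℝ) x)
    have h3 := congrArg (fun L => L u) this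
    simp [hu, hn] at h3
  have hI : ∀ k ∈ Finset.range (Module.finrank ℝ E + 1),
      IntegrableOn (fun x => w k * (1 + v k • fderiv ℝ h x).det) (ball (0:E) 2) volume := by
    intro k _
    have hc : Continuous (fun x => w k * (1 + v k • fderiv ℝ h x).det) :=
      continuous_const.mul (ContinuousLinearMap.continuous_det.comp
        (continuous_const.add (hdc.const_smul (v k))))
    exact (hc.continuousOn.integrableOn_compact (isCompact_closedBall (0:E) 2)).mono_set
      ball_subset_closedBall
  have h1 : ∫ x in ball (0:E) 2, (1 + fderiv ℝ h x).det = (volume (ball (0:E) 2)).toReal := by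
    rw [integral_congr_ae (Filter.Eventually.of_forall fun x => hinterp (fderiv ℝ h x))]
    rw [integral_finsetSum _ hI]
    have : ∀ k ∈ Finset.range (Module.finrank ℝ E + 1),
        ∫ x in ball (0:E) 2, w k * (1 + v k • fderiv ℝ h x).det
          = w k * (volume (ball (0:E) 2)).toReal := by
      intro k hk
      rw [integral_const_mul, hvol _ (hv k hk).1 (hv k hk).2]
    rw [Finset.sum_congr rfl this, ← Finset.sum_mul, hw, one_mul]
  simp_rw [hz] at h1
  simp only [integral_zero] at h1
  have hpos : 0 < (volume (ball (0:E) 2)).toReal :=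
    ENNReal.toReal_pos (measure_ball_pos _ _ (by norm_num)).ne' measure_ball_lt_top.ne
  linarith


theorem jsk_no_retraction (E : Type*) [NormedAddCommGroup E] [InnerProductSpace ℝ E]
    [FiniteDimensional ℝ E] (r : E → E) (hr : Continuous r) (hn : ∀ x, ‖r x‖ = 1)
    (hid : ∀ x, 1 ≤ ‖x‖ → r x = ‖x‖⁻¹ • x) : False := by
  have hU : {x : E | 1 < ‖x‖} ∈ 𝓝ˢ {x : E | 2 ≤ ‖x‖} := by
    refine (isOpen_lt continuous_const continuous_norm).mem_nhdsSet.2 fun x hx => ?_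
    simp only [mem_ofPred_eq] at hx ⊢
    linarith
  obtain ⟨g, hg, hgr, heq, -⟩ := hr.exists_contDiff_approx_and_eqOn 1 (ε := fun _ => 1/2)
    continuous_const (fun _ => by norm_num) (S := {x : E | 2 ≤ ‖x‖})
    (isClosed_le continuous_const continuous_norm) hU (by
      have : ContDiffOn ℝ 1 (fun x : E => ‖x‖⁻¹ • x) {x : E | 1 < ‖x‖} := by
        intro x hx
        have hx0 : x ≠ 0 := by
          rintro rfl
          simp at hx
          linarith
        exact (((contDiffAt_norm ℝ hx0).inv (norm_ne_zero_iff.2 hx0)).smul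
          contDiffAt_id).contDiffWithinAt
      exact this.congr fun x hx => hid x (le_of_lt hx))
  have hg0 : ∀ x, g x ≠ 0 := by
    intro x h0
    have := hgr x
    rw [h0, dist_zero_left, hn] at this
    norm_num at this
  refine jsk_no_C1_retraction E (fun x => (2 * ‖g x‖⁻¹) • g x) ?_ ?_ ?_
  · exact (contDiff_const.mul ((hg.norm ℝ hg0).inv fun x => norm_ne_zero_iff.2 (hg0 x))).smul hg
  · intro x
    rw [norm_smul, norm_mul, norm_inv, norm_norm]
    have := norm_ne_zero_iff.2 (hg0 x)
    field_simp
    simp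
  · intro x hx
    have h1 : g x = r x := heq (by simp [hx])
    rw [h1, hn, hid x (by rw [hx]; norm_num), hx, smul_smul]
    norm_num

theorem jsk_sphere_not_null (E : Type*) [NormedAddCommGroup E] [InnerProductSpace ℝ E]
    [FiniteDimensional ℝ E] :
    ¬ (ContinuousMap.id (sphere (0:E) 1)).Nullhomotopic := by
  rintro ⟨p, ⟨F⟩⟩
  classical
  let u : E → sphere (0:E) 1 := fun x =>
    if h : x = 0 then p else ⟨‖x‖⁻¹ • x, by
      rw [mem_sphere_zero_iff_norm, norm_smul, norm_inv, norm_norm]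
      exact inv_mul_cancel₀ (norm_ne_zero_iff.2 h)⟩
  have hu : ∀ x, x ≠ 0 → (u x : E) = ‖x‖⁻¹ • x := by
    intro x hx
    simp [u, hx]
  have huc : ∀ x, x ≠ 0 → ContinuousAt u x := by
    intro x hx
    rw [Topology.IsInducing.subtypeVal.continuousAt_iff]
    have h1 : ContinuousAt (fun x : E => ‖x‖⁻¹ • x) x :=
      (continuousAt_id.norm.inv₀ (norm_ne_zero_iff.2 hx)).smul continuousAt_id
    refine h1.congr ?_
    filter_upwards [isOpen_ne.mem_nhds hx] with y hy
    exact (hu y hy).symm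
  let τ : E → unitInterval := fun x => Set.projIcc 0 1 zero_le_one (2 - 2 * ‖x‖)
  have hτ : Continuous τ :=
    continuous_projIcc.comp (continuous_const.sub (continuous_const.mul continuous_norm))
  refine jsk_no_retraction E (fun x => (F (τ x, u x) : E)) ?_ ?_ ?_
  · rw [continuous_iff_continuousAt]
    intro x
    by_cases hx : x = 0
    · have : (fun x => (F (τ x, u x) : E)) =ᶠ[𝓝 x] fun _ => (p : E) := by
        have : ∀ᶠ y in 𝓝 x, ‖y‖ < 1/2 :=
          continuous_norm.continuousAt.eventually_lt continuousAt_const (by simp [hx])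
        filter_upwards [this] with y hy
        have : τ y = 1 := Set.projIcc_of_right_le _ (by linarith)
        rw [this]
        simp
      exact continuousAt_const.congr this.symm
    · have h2 : ContinuousAt (fun x => (τ x, u x)) x := hτ.continuousAt.prodMk (huc x hx)
      exact (continuous_subtype_val.comp F.continuous).continuousAt.comp h2
  · intro x
    exact mem_sphere_zero_iff_norm.1 (F (τ x, u x)).2
  · intro x hx
    have : τ x = 0 := Set.projIcc_of_le_left _ (by linarith)
    have hx0 : x ≠ 0 := by rintro rfl; simp at hx; linarith
    simp only [this]
    simp [hu x hx0]

theorem jsk_nullhomotopic_of_homeo {X Y : Type*} [TopologicalSpace X] [TopologicalSpace Y]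
    (e : X ≃ₜ Y) (h : (ContinuousMap.id X).Nullhomotopic) : (ContinuousMap.id Y).Nullhomotopic := by
  have h1 := (h.comp_left (e.symm : C(Y, X))).comp_right (e : C(X, Y))
  convert h1 using 1
  ext x
  simp

theorem jsk_onePoint_not_null (n : ℕ) :
    ¬ (ContinuousMap.id (OnePoint (EuclideanSpace ℝ (Fin n)))).Nullhomotopic := by
  intro h
  have e : OnePoint (EuclideanSpace ℝ (Fin n)) ≃ₜ sphere (0 : EuclideanSpace ℝ (Fin (n+1))) 1 :=
    onePointEquivSphereOfFinrankEq (by simp)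
  exact jsk_sphere_not_null _ (jsk_nullhomotopic_of_homeo e h)

section


open Classical in
/-- collapse of the complement of an open embedding -/
noncomputable def jskCollapse {X Y : Type*} (e : Y → X) (x : X) : OnePoint Y :=
  if h : ∃ y, e y = x then ((h.choose : Y) : OnePoint Y) else OnePoint.infty

theorem jskCollapse_apply {X Y : Type*} {e : Y → X} (he : Function.Injective e) (y : Y) :
    jskCollapse e (e y) = (y : OnePoint Y) := by
  have h : ∃ y', e y' = e y := ⟨y, rfl⟩
  rw [jskCollapse, dif_pos h]
  rw [he h.choose_spec]

theorem jskCollapse_infty {X Y : Type*} {e : Y → X} {x : X} (hx : x ∉ range e) :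
    jskCollapse e x = OnePoint.infty := by
  rw [jskCollapse, dif_neg]
  exact hx

theorem jskCollapse_continuous {X Y : Type*} [TopologicalSpace X] [TopologicalSpace Y] [T2Space X]
    {e : Y → X} (he : IsOpenEmbedding e) : Continuous (jskCollapse e) := by
  rw [continuous_def]
  intro s hs
  by_cases h : OnePoint.infty ∈ s
  · rw [OnePoint.isOpen_iff_of_mem h] at hs
    have h1 : IsClosed (e '' ((OnePoint.some : Y → OnePoint Y) ⁻¹' s)ᶜ) :=
      (hs.2.image he.continuous).isClosed
    rw [← isClosed_compl_iff]
    convert h1 using 1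
    ext x
    by_cases hx : x ∈ range e
    · obtain ⟨y, rfl⟩ := hx
      simp [jskCollapse_apply he.injective, he.injective.eq_iff]
    · simp only [mem_compl_iff, mem_preimage, jskCollapse_infty hx, h, not_true_eq_false, false_iff]
      rintro ⟨y, -, rfl⟩
      exact hx ⟨y, rfl⟩
  · rw [OnePoint.isOpen_iff_of_notMem h] at hs
    convert he.isOpenMap _ hs using 1
    ext x
    by_cases hx : x ∈ range e
    · obtain ⟨y, rfl⟩ := hx
      simp [jskCollapse_apply he.injective, he.injective.eq_iff]
    · simp only [mem_preimage, jskCollapse_infty hx, h, false_iff]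
      rintro ⟨y, -, rfl⟩
      exact hx ⟨y, rfl⟩

theorem jsk_homotopyEquiv {X Y : Type*} [TopologicalSpace X] [TopologicalSpace Y] [T2Space X]
    [CompactSpace X] [T2Space Y] [LocallyCompactSpace Y] {e : Y → X} (he : IsOpenEmbedding e)
    (p : X) (hp : p ∉ range e)
    (H : unitInterval × X → X) (hH : Continuous H) (H0 : ∀ x, H (0, x) = x)
    (HA : ∀ t x, x ∉ range e → H (t, x) ∉ range e) (H1 : ∀ x, x ∉ range e → H (1, x) = p) :
    Nonempty (ContinuousMap.HomotopyEquiv X (OnePoint Y)) := by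
  let q : X → OnePoint Y := jskCollapse e
  have hq : Continuous q := jskCollapse_continuous he
  have hqs : Function.Surjective q := by
    intro z
    induction z using OnePoint.rec with
    | infty => exact ⟨p, jskCollapse_infty hp⟩
    | coe y => exact ⟨e y, jskCollapse_apply he.injective y⟩
  have hqq : IsQuotientMap q := hq.isClosedMap.isQuotientMap hq hqs
  let g : OnePoint Y → X := fun z => z.elim p (fun y => H (1, e y))
  have hgq : ∀ x, g (q x) = H (1, x) := by
    intro x
    by_cases hx : x ∈ range e
    · obtain ⟨y, rfl⟩ := hx
      simp only [q, g, jskCollapse_apply he.injective]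
      rfl
    · simp only [q, g, jskCollapse_infty hx, H1 x hx]
      rfl
  have hg : Continuous g := by
    rw [hqq.continuous_iff]
    have : g ∘ q = fun x => H (1, x) := funext hgq
    rw [this]
    exact hH.comp (by fun_prop)
  let K : unitInterval × OnePoint Y → OnePoint Y := fun z =>
    z.2.elim OnePoint.infty (fun y => q (H (z.1, e y)))
  have hKq : ∀ t x, K (t, q x) = q (H (t, x)) := by
    intro t x
    by_cases hx : x ∈ range e
    · obtain ⟨y, rfl⟩ := hx
      simp only [q, K, jskCollapse_apply he.injective]
      rfl
    · simp only [q, K, jskCollapse_infty hx, jskCollapse_infty (HA t x hx)]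
      rfl
  have hK : Continuous K := by
    have hQ : Continuous (Prod.map id q : unitInterval × X → unitInterval × OnePoint Y) :=
      continuous_id.prodMap hq
    have hQQ : IsQuotientMap (Prod.map id q : unitInterval × X → unitInterval × OnePoint Y) :=
      hQ.isClosedMap.isQuotientMap hQ (Function.surjective_id.prodMap hqs)
    rw [hQQ.continuous_iff]
    have : K ∘ Prod.map id q = fun z => q (H z) := by
      funext ⟨t, x⟩
      exact hKq t x
    rw [this]
    exact hq.comp hH
  refine ⟨⟨⟨q, hq⟩, ⟨g, hg⟩, ?_, ?_⟩⟩
  · refine ContinuousMap.Homotopic.symm ⟨⟨⟨H, hH⟩, ?_, ?_⟩⟩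
    · intro x
      exact H0 x
    · intro x
      exact (hgq x).symm
  · refine ContinuousMap.Homotopic.symm ⟨⟨⟨K, hK⟩, ?_, ?_⟩⟩
    · intro z
      obtain ⟨x, rfl⟩ := hqs z
      simp [hKq, H0]
    · intro z
      obtain ⟨x, rfl⟩ := hqs z
      simp [hKq, hgq]

open scoped unitInterval

/-- shrinking clamp on the interval -/
noncomputable def jskClamp (t s : I) : I :=
  Set.projIcc (0:ℝ) 1 zero_le_one ((1 + (t:ℝ)) * s - t / 2)

noncomputable def jskBump (s : I) : I :=
  Set.projIcc (0:ℝ) 1 zero_le_one (4 * s) * Set.projIcc (0:ℝ) 1 zero_le_one (4 * (1 - s))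

theorem jskClamp_zero (s : I) : jskClamp 0 s = s := by
  simp [jskClamp]

theorem jskClamp_bdry (t s : I) (h : s = 0 ∨ s = 1) : jskClamp t s = 0 ∨ jskClamp t s = 1 := by
  rcases h with rfl | rfl
  · left
    exact Set.projIcc_of_le_left _ (by simp; linarith [t.2.1])
  · right
    exact Set.projIcc_of_right_le _ (by simp; linarith [t.2.1])

theorem jskBump_bdry (s : I) (h : s = 0 ∨ s = 1) : jskBump s = 0 := by
  rcases h with rfl | rfl
  · have : Set.projIcc (0:ℝ) 1 zero_le_one (4 * ((0:I):ℝ)) = 0 :=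
      Set.projIcc_of_le_left _ (by simp)
    rw [jskBump, this, zero_mul]
  · have : Set.projIcc (0:ℝ) 1 zero_le_one (4 * (1 - ((1:I):ℝ))) = 0 :=
      Set.projIcc_of_le_left _ (by simp)
    rw [jskBump, this, mul_zero]

theorem jskBump_one (s : I) (h : ¬ (jskClamp 1 s = 0 ∨ jskClamp 1 s = 1)) : jskBump s = 1 := by
  push Not at h
  have h1 : (1/4 : ℝ) ≤ s := by
    by_contra hc
    push Not at hc
    exact h.1 (Set.projIcc_of_le_left _ (by simp; linarith))
  have h2 : (s:ℝ) ≤ 3/4 := by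
    by_contra hc
    push Not at hc
    exact h.2 (Set.projIcc_of_right_le _ (by simp; linarith))
  have h3 : Set.projIcc (0:ℝ) 1 zero_le_one (4 * (s:ℝ)) = 1 :=
    Set.projIcc_of_right_le _ (by linarith)
  have h4 : Set.projIcc (0:ℝ) 1 zero_le_one (4 * (1 - (s:ℝ))) = 1 :=
    Set.projIcc_of_right_le _ (by linarith)
  rw [jskBump, h3, h4, mul_one]

theorem jsk_null_rel {i : ℕ} {X : Type*} [TopologicalSpace X] {x c : X}
    (f : GenLoop (Fin i) X x) (p : Path x c) (F : I × (Fin i → I) → X) (hF : Continuous F)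
    (F0 : ∀ y, F (0, y) = f y) (F1 : ∀ y, F (1, y) = c)
    (Fb : ∀ t, ∀ y ∈ Cube.boundary (Fin i), F (t, y) = p t) :
    GenLoop.Homotopic f GenLoop.const := by
  let ρ : I → (Fin i → I) → (Fin i → I) := fun t y k => jskClamp t (y k)
  have hρ : Continuous (fun z : I × (Fin i → I) => ρ z.1 z.2) := by
    refine continuous_pi fun k => ?_
    exact continuous_projIcc.comp (by fun_prop)
  have hρb : ∀ t, ∀ y ∈ Cube.boundary (Fin i), ρ t y ∈ Cube.boundary (Fin i) := by
    rintro t y ⟨k, hk⟩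
    exact ⟨k, jskClamp_bdry t _ hk⟩
  let β : (Fin i → I) → I := fun y => ∏ k, jskBump (y k)
  have hβ : Continuous β := by
    refine continuous_finsetProd _ fun k _ => ?_
    exact (continuous_projIcc.comp (by fun_prop)).mul (continuous_projIcc.comp (by fun_prop))
  have hβb : ∀ y ∈ Cube.boundary (Fin i), β y = 0 := by
    rintro y ⟨k, hk⟩
    exact Finset.prod_eq_zero (Finset.mem_univ k) (jskBump_bdry _ hk)
  have hβ1 : ∀ y, ρ 1 y ∉ Cube.boundary (Fin i) → β y = 1 := by
    intro y hy
    refine Finset.prod_eq_one fun k _ => jskBump_one _ fun hk => hy ⟨k, hk⟩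
  have hfb : ∀ y ∈ Cube.boundary (Fin i), f y = x := f.2
  have hfc : Continuous f := f.1.continuous
  let f1 : C(Fin i → I, X) := ⟨fun y => f (ρ 1 y), hfc.comp (hρ.comp (continuous_const.prodMk continuous_id))⟩
  let f2 : C(Fin i → I, X) := ⟨fun y => p (β y), p.continuous.comp hβ⟩
  have s1 : ContinuousMap.HomotopicRel f.1 f1 (Cube.boundary (Fin i)) := by
    refine ⟨⟨⟨⟨fun z => f (ρ z.1 z.2), hfc.comp hρ⟩, ?_, ?_⟩, ?_⟩⟩
    · intro y
      have : ρ 0 y = y := funext fun k => jskClamp_zero _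
      simp only [this]
      rfl
    · intro y
      rfl
    · intro t y hy
      change f (ρ t y) = f y
      rw [hfb _ (hρb t y hy), hfb y hy]
  have s2 : ContinuousMap.HomotopicRel f1 f2 (Cube.boundary (Fin i)) := by
    refine ⟨⟨⟨⟨fun z => F (z.1 * β z.2, ρ 1 z.2), hF.comp ?_⟩, ?_, ?_⟩, ?_⟩⟩
    · exact (continuous_fst.mul (hβ.comp continuous_snd)).prodMk
        (hρ.comp (continuous_const.prodMk continuous_snd))
    · intro y
      change F (0 * β y, ρ 1 y) = f (ρ 1 y)
      rw [zero_mul, F0]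
    · intro y
      change F (1 * β y, ρ 1 y) = p (β y)
      rw [one_mul]
      by_cases hy : ρ 1 y ∈ Cube.boundary (Fin i)
      · exact Fb _ _ hy
      · rw [hβ1 y hy, F1, p.target]
    · intro t y hy
      change F (t * β y, ρ 1 y) = f (ρ 1 y)
      rw [hβb y hy, mul_zero, F0]
  have s3 : ContinuousMap.HomotopicRel f2 (GenLoop.const : GenLoop (Fin i) X x).1
      (Cube.boundary (Fin i)) := by
    refine ⟨⟨⟨⟨fun z => p (unitInterval.symm z.1 * β z.2), p.continuous.comp ?_⟩, ?_, ?_⟩, ?_⟩⟩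
    · exact (unitInterval.continuous_symm.comp continuous_fst).mul (hβ.comp continuous_snd)
    · intro y
      change p (unitInterval.symm 0 * β y) = p (β y)
      simp
    · intro y
      change p (unitInterval.symm 1 * β y) = x
      simp
    · intro t y hy
      change p (unitInterval.symm t * β y) = p (β y)
      rw [hβb y hy, mul_zero]
  exact (s1.trans s2).trans s3


section jskW
variable {J E : Type*} [TopologicalSpace J] [DiscreteTopology J] [Finite J]
  [NormedAddCommGroup E] [InnerProductSpace ℝ E] [FiniteDimensional ℝ E]

theorem jsk_tendsto_infty {Z : Type*} {f : Z → OnePoint (J × E)} {l : Filter Z} :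
    Filter.Tendsto f l (𝓝 OnePoint.infty) ↔
      ∀ R : ℝ, ∀ᶠ z in l, ∀ j y, f z = ((j, y) : J × E) → R < ‖y‖ := by
  constructor
  · intro h R
    have hK : IsCompact (Set.univ ×ˢ closedBall (0:E) R : Set (J × E)) :=
      isCompact_univ.prod (isCompact_closedBall _ _)
    have : (((↑) : J × E → OnePoint (J × E)) '' (Set.univ ×ˢ closedBall (0:E) R))ᶜ
        ∈ 𝓝 (OnePoint.infty : OnePoint (J × E)) := by
      refine IsOpen.mem_nhds ?_ ?_
      · exact OnePoint.isOpen_compl_image_coe.2 ⟨hK.isClosed, hK⟩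
      · simp
    filter_upwards [h this] with z hz j y hzy
    by_contra hc
    push Not at hc
    exact hz ⟨(j, y), by simpa using hc, hzy.symm⟩
  · intro h
    rw [OnePoint.hasBasis_nhds_infty.tendsto_right_iff]
    rintro s ⟨-, hs⟩
    have hb : Bornology.IsBounded (Prod.snd '' s) := (hs.image continuous_snd).isBounded
    obtain ⟨R, hR⟩ := hb.exists_norm_le
    filter_upwards [h R] with z hz
    rcases hfz : f z with _ | ⟨j, y⟩
    · right; rfl
    · left
      refine ⟨(j, y), fun hm => ?_, rfl⟩
      have := hz j y hfz
      have h2 := hR y ⟨(j, y), hm, rfl⟩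
      linarith

/-- perturbation map -/
noncomputable def jskPerturb (a : E) (z : OnePoint (J × E) × E) : OnePoint (J × E) :=
  z.1.elim OnePoint.infty
    (fun w => ((w.1, w.2 + (max 0 (min 1 (2 - ‖w.2 - a‖))) • z.2) : J × E))

theorem jskPerturb_continuous (a : E) :
    Continuous (jskPerturb a : OnePoint (J × E) × E → OnePoint (J × E)) := by
  rw [continuous_iff_continuousAt]
  rintro ⟨z, p⟩
  induction z using OnePoint.rec with
  | infty =>
    have hid : Filter.Tendsto (fun z : OnePoint (J × E) × E => z.1)
      (𝓝 (OnePoint.infty, p)) (𝓝 OnePoint.infty) := continuous_fst.continuousAt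
    have h1 := jsk_tendsto_infty.1 hid (‖a‖ + 2)
    have : (fun z : OnePoint (J × E) × E => z.1) =ᶠ[𝓝 (OnePoint.infty, p)] jskPerturb a := by
      filter_upwards [h1] with z hz
      obtain ⟨z, p'⟩ := z
      induction z using OnePoint.rec with
      | infty => rfl
      | coe w =>
        have h2 := hz w.1 w.2 rfl
        have h3 : 2 ≤ ‖w.2 - a‖ := by
          have := norm_sub_norm_le w.2 a
          linarith
        have h4 : max 0 (min 1 (2 - ‖w.2 - a‖)) = 0 :=
          max_eq_left ((min_le_right _ _).trans (by linarith))
        simp [jskPerturb, h4]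
    exact (continuous_fst.continuousAt).congr this
  | coe w =>
    have he : IsOpenEmbedding (Prod.map ((↑) : J × E → OnePoint (J × E)) (id : E → E)) :=
      OnePoint.isOpenEmbedding_coe.prodMap IsOpenEmbedding.id
    have := he.continuousAt_iff (g := jskPerturb a) (x := (w, p))
    refine this.1 (Continuous.continuousAt ?_)
    change Continuous (fun q : (J × E) × E =>
      (((q.1.1, q.1.2 + (max 0 (min 1 (2 - ‖q.1.2 - a‖))) • q.2) : J × E) : OnePoint (J × E)))
    exact OnePoint.continuous_coe.comp (by fun_prop)

/-- coordinates near `a` -/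
noncomputable def jskCoord (a : E) (z : OnePoint (J × E)) : E :=
  z.elim 0 (fun w => (max 0 (min 1 (3 - ‖w.2 - a‖))) • (w.2 - a))

theorem jskCoord_continuous (a : E) :
    Continuous (jskCoord a : OnePoint (J × E) → E) := by
  rw [continuous_iff_continuousAt]
  intro z
  induction z using OnePoint.rec with
  | infty =>
    have h1 := jsk_tendsto_infty.1 (Filter.tendsto_id (α := OnePoint (J × E))
      (x := 𝓝 OnePoint.infty)) (‖a‖ + 3)
    have : (fun _ : OnePoint (J × E) => (0:E)) =ᶠ[𝓝 (OnePoint.infty)] jskCoord a := by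
      filter_upwards [h1] with z hz
      induction z using OnePoint.rec with
      | infty => rfl
      | coe w =>
        have h2 := hz w.1 w.2 rfl
        have h3 : 3 ≤ ‖w.2 - a‖ := by
          have := norm_sub_norm_le w.2 a
          linarith
        have h4 : max 0 (min 1 (3 - ‖w.2 - a‖)) = 0 :=
          max_eq_left ((min_le_right _ _).trans (by linarith))
        simp [jskCoord, h4]
    exact continuousAt_const.congr this
  | coe w =>
    refine (OnePoint.isOpenEmbedding_coe.continuousAt_iff (g := jskCoord a) (x := w)).1
      (Continuous.continuousAt ?_)
    change Continuous (fun q : J × E => (max 0 (min 1 (3 - ‖q.2 - a‖))) • (q.2 - a))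
    fun_prop

open Classical in
/-- radial expansion from `c` -/
noncomputable def jskExpand (c : E) (z : unitInterval × OnePoint (J × E)) : OnePoint (J × E) :=
  z.2.elim OnePoint.infty
    (fun w => if z.1 = 1 then OnePoint.infty else
      ((w.1, c + (1 - (z.1:ℝ))⁻¹ • (w.2 - c)) : J × E))

theorem jskExpand_continuousAt (c : E) (t : unitInterval) (z : OnePoint (J × E))
    (hz : ∀ j : J, z ≠ ((j, c) : J × E)) : ContinuousAt (jskExpand c) (t, z) := by
  induction z using OnePoint.rec with
  | infty =>
    refine jsk_tendsto_infty.2 fun R => ?_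
    have hid : Filter.Tendsto (fun z : unitInterval × OnePoint (J × E) => z.2)
      (𝓝 (t, OnePoint.infty)) (𝓝 OnePoint.infty) := continuous_snd.continuousAt
    filter_upwards [jsk_tendsto_infty.1 hid (|R| + 2 * ‖c‖)] with q hq
    intro j y hy
    obtain ⟨t', z⟩ := q
    induction z using OnePoint.rec with
    | infty => exact absurd hy.symm (OnePoint.coe_ne_infty _)
    | coe w =>
      have h2 : |R| + 2 * ‖c‖ < ‖w.2‖ := hq w.1 w.2 rfl
      by_cases ht : t' = 1
      · simp [jskExpand, ht] at hy
      · have ht1 : (t':ℝ) < 1 := lt_of_le_of_ne t'.2.2 (fun h => ht (Subtype.ext h))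
        have hy' : y = c + (1 - (t':ℝ))⁻¹ • (w.2 - c) := by
          simp only [jskExpand, ht, OnePoint.elim_some, if_false] at hy
          have := OnePoint.coe_injective hy
          exact (congrArg Prod.snd this).symm
        have h1 : 1 ≤ (1 - (t':ℝ))⁻¹ := (one_le_inv₀ (by linarith)).2 (by linarith [t'.2.1])
        have h3 := norm_sub_norm_le w.2 c
        have h4 : ‖w.2 - c‖ ≤ ‖(1 - (t':ℝ))⁻¹ • (w.2 - c)‖ := by
          rw [norm_smul, Real.norm_of_nonneg (by linarith)]
          nlinarith [norm_nonneg (w.2 - c)]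
        have h5 : ‖(1 - (t':ℝ))⁻¹ • (w.2 - c)‖ ≤ ‖y‖ + ‖c‖ := by
          have : (1 - (t':ℝ))⁻¹ • (w.2 - c) = y - c := by rw [hy']; abel
          rw [this]; exact norm_sub_le _ _
        linarith [le_abs_self R]
  | coe w =>
    have he : IsOpenEmbedding (Prod.map (id : unitInterval → unitInterval)
        ((↑) : J × E → OnePoint (J × E))) :=
      IsOpenEmbedding.id.prodMap OnePoint.isOpenEmbedding_coe
    refine (he.continuousAt_iff (g := jskExpand c) (x := (t, w))).1 ?_
    by_cases ht : t = 1
    · have hne : w.2 ≠ c := by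
        rintro rfl
        exact hz w.1 rfl
      have hval : (jskExpand c ∘ Prod.map id ((↑) : J × E → OnePoint (J × E))) (t, w)
          = OnePoint.infty := by
        simp [jskExpand, ht]
      rw [ContinuousAt, hval]
      refine jsk_tendsto_infty.2 fun R => ?_
      set ε := ‖w.2 - c‖ / 2 with hε
      have hεp : 0 < ε := half_pos (norm_pos_iff.2 (sub_ne_zero.2 hne))
      have e1 : ∀ᶠ q : unitInterval × (J × E) in 𝓝 (t, w), ε < ‖q.2.2 - c‖ := by
        refine (ContinuousAt.eventually_lt continuousAt_const ?_ ?_)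
        · fun_prop
        · simp only [hε]; linarith
      have e2 : ∀ᶠ q : unitInterval × (J × E) in 𝓝 (t, w),
          (1 - (q.1:ℝ)) * (|R| + ‖c‖) < ε := by
        refine (ContinuousAt.eventually_lt ?_ continuousAt_const ?_)
        · fun_prop
        · simp [ht, hεp]
      filter_upwards [e1, e2] with q h1 h2
      obtain ⟨t', w'⟩ := q
      intro j y hy
      by_cases ht' : t' = 1
      · simp [jskExpand, ht'] at hy
      · have ht1 : (t':ℝ) < 1 := lt_of_le_of_ne t'.2.2 (fun h => ht' (Subtype.ext h))
        have hy' : y = c + (1 - (t':ℝ))⁻¹ • (w'.2 - c) := by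
          simp only [jskExpand, ht', OnePoint.elim_some, if_false, Function.comp, Prod.map, id] at hy
          have := OnePoint.coe_injective hy
          exact (congrArg Prod.snd this).symm
        have h5 : ‖(1 - (t':ℝ))⁻¹ • (w'.2 - c)‖ ≤ ‖y‖ + ‖c‖ := by
          have : (1 - (t':ℝ))⁻¹ • (w'.2 - c) = y - c := by rw [hy']; abel
          rw [this]; exact norm_sub_le _ _
        rw [norm_smul, norm_inv, Real.norm_of_nonneg (by linarith), inv_mul_le_iff₀ (by linarith)]
          at h5
        simp only at h1 h2
        have h6 : (1 - (t':ℝ)) * (|R| + ‖c‖) < (1 - (t':ℝ)) * (‖y‖ + ‖c‖) := by linarith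
        have h7 := lt_of_mul_lt_mul_left h6 (by linarith)
        linarith [le_abs_self R]
    · have ht1 : (t:ℝ) < 1 := lt_of_le_of_ne t.2.2 (fun h => ht (Subtype.ext h))
      have hc : ContinuousAt (fun q : unitInterval × (J × E) =>
          (((q.2.1, c + (1 - (q.1:ℝ))⁻¹ • (q.2.2 - c)) : J × E) : OnePoint (J × E))) (t, w) := by
        refine OnePoint.continuous_coe.continuousAt.comp ?_
        have : ContinuousAt (fun q : unitInterval × (J × E) => (1 - (q.1:ℝ))⁻¹) (t, w) :=
          ContinuousAt.inv₀ (by fun_prop) (by simp only; linarith)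
        refine ContinuousAt.prodMk (by fun_prop) ?_
        exact continuousAt_const.add (this.smul (by fun_prop))
      refine hc.congr ?_
      have : ∀ᶠ q : unitInterval × (J × E) in 𝓝 (t, w), q.1 ≠ 1 :=
        (continuous_fst.continuousAt).eventually_ne ht
      filter_upwards [this] with q hq
      simp [jskExpand, hq]

end jskW


/-- homotopies that are constant on `B` at each time -/
def JskBHom {Y X : Type*} [TopologicalSpace Y] [TopologicalSpace X] (B : Set Y)
    (f g : Y → X) : Prop :=
  ∃ F : I × Y → X, Continuous F ∧ (∀ y, F (0, y) = f y) ∧ (∀ y, F (1, y) = g y) ∧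
    ∀ t, ∀ y ∈ B, ∀ y' ∈ B, F (t, y) = F (t, y')

theorem JskBHom.trans {Y X : Type*} [TopologicalSpace Y] [TopologicalSpace X] {B : Set Y}
    {f g h : Y → X} (h1 : JskBHom B f g) (h2 : JskBHom B g h) : JskBHom B f h := by
  obtain ⟨F, Fc, F0, F1, Fb⟩ := h1
  obtain ⟨G, Gc, G0, G1, Gb⟩ := h2
  have fc : Continuous f := by
    have : f = fun y => F (0, y) := by ext y; rw [F0]
    rw [this]; fun_prop
  have gc : Continuous g := by
    have : g = fun y => F (1, y) := by ext y; rw [F1]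
    rw [this]; fun_prop
  have hc : Continuous h := by
    have : h = fun y => G (1, y) := by ext y; rw [G1]
    rw [this]; fun_prop
  let F' : ContinuousMap.Homotopy ⟨f, fc⟩ ⟨g, gc⟩ := ⟨⟨F, Fc⟩, F0, F1⟩
  let G' : ContinuousMap.Homotopy ⟨g, gc⟩ ⟨h, hc⟩ := ⟨⟨G, Gc⟩, G0, G1⟩
  refine ⟨F'.trans G', (F'.trans G').continuous, fun y => (F'.trans G').apply_zero y,
    fun y => (F'.trans G').apply_one y, ?_⟩
  intro t y hy y' hy'
  simp only [ContinuousMap.Homotopy.trans_apply]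
  split_ifs with h
  · exact Fb _ _ hy _ hy'
  · exact Gb _ _ hy _ hy'

theorem JskBHom.postcomp {Y X Z : Type*} [TopologicalSpace Y] [TopologicalSpace X]
    [TopologicalSpace Z] {B : Set Y}
    {f g : Y → X} (h1 : JskBHom B f g) {k : X → Z} (hk : Continuous k) :
    JskBHom B (k ∘ f) (k ∘ g) := by
  obtain ⟨F, Fc, F0, F1, Fb⟩ := h1
  refine ⟨k ∘ F, hk.comp Fc, fun y => by simp [F0], fun y => by simp [F1], ?_⟩
  intro t y hy y' hy'
  simp [Fb t y hy y' hy']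

section jskW2
variable {J E : Type*} [TopologicalSpace J] [DiscreteTopology J] [Finite J]
  [NormedAddCommGroup E] [InnerProductSpace ℝ E] [FiniteDimensional ℝ E]

theorem jsk_exists_far {i : ℕ} (hi : i < Module.finrank ℝ E) (w : OnePoint (J × E)) :
    ∃ a : E, ∀ p : E, jskPerturb a (w, p) = w := by
  induction w using OnePoint.rec with
  | infty => exact ⟨0, fun p => rfl⟩
  | coe w =>
    have : Nontrivial E := Module.nontrivial_of_finrank_pos (R := ℝ) (by omega)
    obtain ⟨b, hb⟩ := exists_norm_eq E (c := 2) (by norm_num)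
    refine ⟨w.2 - b, fun p => ?_⟩
    have h4 : max 0 (min 1 (2 - ‖w.2 - (w.2 - b)‖)) = 0 :=
      max_eq_left ((min_le_right _ _).trans (by simp [hb]))
    simp only [jskPerturb, OnePoint.elim_some, h4, zero_smul, add_zero]

theorem jskExpand_zero (c : E) (z : OnePoint (J × E)) : jskExpand c (0, z) = z := by
  induction z using OnePoint.rec with
  | infty => rfl
  | coe w => simp [jskExpand]

theorem jskExpand_one (c : E) (z : OnePoint (J × E)) : jskExpand c (1, z) = OnePoint.infty := by
  induction z using OnePoint.rec with
  | infty => rfl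
  | coe w => simp [jskExpand]

theorem jsk_cube_null {i : ℕ} (hi : i < Module.finrank ℝ E)
    (φ : (Fin i → I) → OnePoint (J × E)) (hφ : Continuous φ) (B : Set (Fin i → I))
    (w : OnePoint (J × E)) (hw : ∀ y ∈ B, φ y = w) :
    JskBHom B φ (fun _ => OnePoint.infty) := by
  obtain ⟨a, ha⟩ := jsk_exists_far (J := J) hi w
  let pr : (Fin i → ℝ) → (Fin i → I) := fun x k => Set.projIcc (0:ℝ) 1 zero_le_one (x k)
  have hpr : Continuous pr := continuous_pi fun k => continuous_projIcc.comp (by fun_prop)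
  have hcoord : Continuous (fun y : Fin i → I => (fun k => ((y k : I) : ℝ))) := by fun_prop
  have hprc : ∀ y : Fin i → I, pr (fun k => (y k : ℝ)) = y := by
    intro y; ext k; simp [pr]
  obtain ⟨P, hP, hPd, -⟩ := ((jskCoord_continuous a).comp (hφ.comp hpr)).exists_contDiff_approx 1
    (ε := fun _ => 1/2) continuous_const (fun _ => by norm_num)
  have hd : Dense (range P)ᶜ := ContDiff.dense_compl_range_of_finrank_lt_finrank (by exact_mod_cast hP)
    (by simpa using hi)
  obtain ⟨c', hc', hc'P⟩ := hd.exists_mem_open (isOpen_ball (x := (0:E)) (ε := 1/2))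
    ⟨0, by simp⟩
  simp only [mem_ball_zero_iff] at hc'P
  let q : (Fin i → I) → E := fun y => P (fun k => (y k : ℝ)) - jskCoord a (φ y)
  have hq : Continuous q := (hP.continuous.comp hcoord).sub ((jskCoord_continuous a).comp hφ)
  have hqn : ∀ y, ‖q y‖ < 1/2 := by
    intro y
    have := hPd (fun k => (y k : ℝ))
    simp only [Function.comp, hprc] at this
    rwa [dist_eq_norm] at this
  let φ₁ : (Fin i → I) → OnePoint (J × E) := fun y => jskPerturb a (φ y, q y)
  have hφ₁ : Continuous φ₁ := (jskPerturb_continuous a).comp (hφ.prodMk hq)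
  have hp0 : ∀ z : OnePoint (J × E), jskPerturb a (z, 0) = z := by
    intro z
    induction z using OnePoint.rec with
    | infty => rfl
    | coe w => simp [jskPerturb]
  have s1 : JskBHom B φ φ₁ := by
    refine ⟨fun z => jskPerturb a (φ z.2, (z.1:ℝ) • q z.2), ?_, ?_, ?_, ?_⟩
    · exact (jskPerturb_continuous a).comp (by fun_prop)
    · intro y; simp [hp0]
    · intro y; simp [φ₁]
    · intro t y hy y' hy'
      simp [hw y hy, hw y' hy', ha]
  have hmiss : ∀ y (j : J), φ₁ y ≠ ((j, a + c') : J × E) := by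
    intro y j h
    simp only [φ₁] at h
    have hqy := hqn y
    have hqe : q y = P (fun k => (y k : ℝ)) - jskCoord a (φ y) := rfl
    generalize φ y = z at h hqe
    induction z using OnePoint.rec with
    | infty => exact OnePoint.coe_ne_infty _ h.symm
    | coe v =>
      have h2 : v.2 + (max 0 (min 1 (2 - ‖v.2 - a‖))) • q y = a + c' := by
        have := OnePoint.coe_injective h
        exact congrArg Prod.snd this
      by_cases hv : ‖v.2 - a‖ ≤ 1
      · have e1 : max 0 (min 1 (2 - ‖v.2 - a‖)) = 1 := by
          rw [min_eq_left (by linarith), max_eq_right (by norm_num)]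
        have e2 : max 0 (min 1 (3 - ‖v.2 - a‖)) = 1 := by
          rw [min_eq_left (by linarith), max_eq_right (by norm_num)]
        rw [e1, hqe] at h2
        simp only [jskCoord, OnePoint.elim_some, e2, one_smul] at h2
        apply hc'
        refine ⟨fun k => (y k : ℝ), ?_⟩
        · have : P (fun k => (y k : ℝ)) = c' := by
            have h3 : v.2 + (P (fun k => (y k : ℝ)) - (v.2 - a)) = a + P (fun k => (y k : ℝ)) := by
              abel
            rw [h3] at h2
            exact add_left_cancel h2
          exact this
      · push Not at hv
        have e1 : ‖(max 0 (min 1 (2 - ‖v.2 - a‖))) • q y‖ ≤ ‖q y‖ := by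
          rw [norm_smul, Real.norm_of_nonneg (le_max_left _ _)]
          have : max 0 (min 1 (2 - ‖v.2 - a‖)) ≤ 1 := max_le (by norm_num) (min_le_left _ _)
          nlinarith [norm_nonneg (q y)]
        have e3 : v.2 - a = c' - (max 0 (min 1 (2 - ‖v.2 - a‖))) • q y := by
          rw [sub_eq_sub_iff_add_eq_add, h2, add_comm]
        have e4 := norm_sub_le c' ((max 0 (min 1 (2 - ‖v.2 - a‖))) • q y)
        rw [← e3] at e4
        linarith
  refine s1.trans ?_
  refine ⟨fun z => jskExpand (a + c') (z.1, φ₁ z.2), ?_, ?_, ?_, ?_⟩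
  · rw [continuous_iff_continuousAt]
    rintro ⟨t, y⟩
    refine ContinuousAt.comp (f := fun z : I × (Fin i → I) => (z.1, φ₁ z.2)) (x := (t, y))
      (jskExpand_continuousAt (a + c') t (φ₁ y) (hmiss y)) ?_
    exact Continuous.continuousAt (by fun_prop)
  · intro y; exact jskExpand_zero _ _
  · intro y; exact jskExpand_one _ _
  · intro t y hy y' hy'
    simp [φ₁, hw y hy, hw y' hy', ha]

theorem jsk_homotopyGroup_subsingleton {X : Type*} [TopologicalSpace X]
    (e : ContinuousMap.HomotopyEquiv X (OnePoint (J × E))) {i : ℕ}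
    (hi : i < Module.finrank ℝ E) (x : X) : Subsingleton (HomotopyGroup (Fin i) X x) := by
  set c : X := e.invFun OnePoint.infty with hc
  have key : ∀ f : GenLoop (Fin i) X x, JskBHom (Cube.boundary (Fin i)) (f : (Fin i → I) → X)
      (fun _ => c) := by
    intro f
    have h1 := jsk_cube_null (J := J) hi (fun y => e.toFun (f y))
      (e.toFun.continuous.comp f.1.continuous) (Cube.boundary (Fin i)) (e.toFun x)
      (fun y hy => congrArg e.toFun (f.2 y hy))
    have h2 := h1.postcomp e.invFun.continuous
    obtain ⟨K⟩ := e.left_inv.symm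
    refine JskBHom.trans ?_ h2
    refine ⟨fun z => K (z.1, f z.2), ?_, ?_, ?_, ?_⟩
    · exact K.continuous.comp (continuous_fst.prodMk (f.1.continuous.comp continuous_snd))
    · intro y; simp
    · intro y; simp
    · intro t y hy y' hy'
      have e1 : f y = x := f.2 y hy
      have e2 : f y' = x := f.2 y' hy'
      simp only [e1, e2]
  have null : ∀ f : GenLoop (Fin i) X x, GenLoop.Homotopic f GenLoop.const := by
    intro f
    by_cases hB : (Cube.boundary (Fin i)).Nonempty
    · obtain ⟨y0, hy0⟩ := hB
      obtain ⟨F, Fc, F0, F1, Fb⟩ := key f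
      let p : Path x c := ⟨⟨fun t => F (t, y0), by fun_prop⟩, by
        simp only []
        rw [F0]; exact f.2 y0 hy0, F1 y0⟩
      exact jsk_null_rel f p F Fc F0 F1 (fun t y hy => Fb t y hy y0 hy0)
    · obtain ⟨G, Gc, G0, G1, -⟩ := key GenLoop.const
      obtain ⟨F, Fc, F0, F1, Fb⟩ := key f
      let p : Path x c := ⟨⟨fun t => G (t, fun _ => 0), by fun_prop⟩, G0 _, G1 _⟩
      exact jsk_null_rel f p F Fc F0 F1 (fun t y hy => absurd ⟨y, hy⟩ hB)
  constructor
  intro a b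
  induction a using Quotient.inductionOn with | _ f =>
  induction b using Quotient.inductionOn with | _ g =>
  exact Quotient.sound ((null f).trans (null g).symm)

end jskW2


/-- the open embedding of Euclidean space as the interior of the cube -/
noncomputable def jskCube (n : ℕ) (y : EuclideanSpace ℝ (Fin n)) : Fin n → I :=
  fun k => unitInterval.sigmoid (y k)

theorem jsk_sigmoid_isOpenEmbedding : IsOpenEmbedding unitInterval.sigmoid := by
  have h : IsEmbedding unitInterval.sigmoid := by
    refine unitInterval.sigmoid_strictMono.isEmbedding_of_ordConnected ?_
    rw [unitInterval.range_sigmoid]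
    exact ordConnected_Ioo
  exact ⟨h, by rw [unitInterval.range_sigmoid]; exact isOpen_Ioo⟩

theorem jskCube_isOpenEmbedding (n : ℕ) : IsOpenEmbedding (jskCube n) := by
  have h1 : IsOpenEmbedding (Pi.map (fun _ : Fin n => unitInterval.sigmoid)) := by
    refine ⟨IsEmbedding.piMap fun _ => jsk_sigmoid_isOpenEmbedding.isEmbedding, ?_⟩
    rw [Set.range_piMap]
    exact isOpen_set_pi Set.finite_univ fun _ _ => jsk_sigmoid_isOpenEmbedding.isOpen_range
  exact h1.comp (EuclideanSpace.equiv (Fin n) ℝ).toHomeomorph.isOpenEmbedding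

theorem jskCube_range (n : ℕ) (c : Fin n → I) (hc : c ∉ range (jskCube n)) :
    c ∈ Cube.boundary (Fin n) := by
  by_contra h
  apply hc
  have : ∀ k, c k ∈ range unitInterval.sigmoid := by
    intro k
    rw [unitInterval.range_sigmoid]
    simp only [Cube.boundary, mem_ofPred_eq, not_exists, not_or] at h
    exact ⟨lt_of_le_of_ne (c k).2.1 (fun h' => (h k).1 h'.symm),
      lt_of_le_of_ne (c k).2.2 (fun h' => (h k).2 h')⟩
  choose y hy using this
  refine ⟨(EuclideanSpace.equiv (Fin n) ℝ).symm y, ?_⟩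
  ext k
  simp [jskCube, hy]

theorem jskCube_not_boundary (n : ℕ) (y : EuclideanSpace ℝ (Fin n)) :
    jskCube n y ∉ Cube.boundary (Fin n) := by
  rintro ⟨k, h | h⟩
  · exact (unitInterval.sigmoid_pos (y k)).ne' h
  · exact (unitInterval.sigmoid_lt_one (y k)).ne h

theorem jsk_null_of_subsingleton {X : Type*} [TopologicalSpace X] (n : ℕ)
    (φ : C(OnePoint (EuclideanSpace ℝ (Fin n)), X))
    (hs : Subsingleton (HomotopyGroup (Fin n) X (φ OnePoint.infty))) : φ.Nullhomotopic := by
  let f : GenLoop (Fin n) X (φ OnePoint.infty) :=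
    ⟨φ.comp ⟨jskCollapse (jskCube n), jskCollapse_continuous (jskCube_isOpenEmbedding n)⟩, by
      intro y hy
      have : y ∉ range (jskCube n) := by
        rintro ⟨z, rfl⟩
        exact jskCube_not_boundary n z hy
      simp [jskCollapse_infty this]⟩
  have h1 : GenLoop.Homotopic f GenLoop.const := Quotient.exact (hs.elim _ _)
  obtain ⟨F⟩ := h1
  have Fb : ∀ t, ∀ y ∈ Cube.boundary (Fin n), F (t, y) = φ OnePoint.infty := by
    intro t y hy
    have h2 := F.eq_fst t hy
    rw [h2]
    exact f.2 y hy
  let e' : EuclideanSpace ℝ (Fin n) → (Fin n → I) ⊕ Unit := Sum.inl ∘ jskCube n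
  have he' : IsOpenEmbedding e' := IsOpenEmbedding.inl.comp (jskCube_isOpenEmbedding n)
  let q : (Fin n → I) ⊕ Unit → OnePoint (EuclideanSpace ℝ (Fin n)) := jskCollapse e'
  have hq : Continuous q := jskCollapse_continuous he'
  have hqs : Function.Surjective q := by
    intro z
    induction z using OnePoint.rec with
    | infty => exact ⟨Sum.inr (), jskCollapse_infty (by simp [e'])⟩
    | coe y => exact ⟨e' y, jskCollapse_apply he'.injective y⟩
  let G : I × OnePoint (EuclideanSpace ℝ (Fin n)) → X :=
    fun z => z.2.elim (φ OnePoint.infty) (fun y => F (z.1, jskCube n y))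
  let G' : I × ((Fin n → I) ⊕ Unit) → X :=
    fun z => Sum.elim (fun c => F (z.1, c)) (fun _ => φ OnePoint.infty) z.2
  have hG' : Continuous G' := by
    rw [← Homeomorph.prodSumDistrib.symm.comp_continuous_iff', continuous_sum_dom]
    constructor
    · exact F.continuous
    · exact continuous_const
  have hGq : ∀ t x, G (t, q x) = G' (t, x) := by
    intro t x
    by_cases hx : x ∈ range e'
    · obtain ⟨y, rfl⟩ := hx
      simp only [q, G, jskCollapse_apply he'.injective]
      rfl
    · simp only [q, G, jskCollapse_infty hx]
      rcases x with c | u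
      · have : c ∉ range (jskCube n) := by
          rintro ⟨y, rfl⟩
          exact hx ⟨y, rfl⟩
        exact (Fb t c (jskCube_range n c this)).symm
      · rfl
  have hG : Continuous G := by
    have hQ : Continuous (Prod.map id q :
        I × ((Fin n → I) ⊕ Unit) → I × OnePoint (EuclideanSpace ℝ (Fin n))) :=
      continuous_id.prodMap hq
    have hQQ := hQ.isClosedMap.isQuotientMap hQ (Function.surjective_id.prodMap hqs)
    rw [hQQ.continuous_iff]
    have : G ∘ Prod.map id q = G' := by
      funext ⟨t, x⟩
      exact hGq t x
    rw [this]
    exact hG'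
  refine ⟨φ OnePoint.infty, ⟨⟨⟨G, hG⟩, ?_, ?_⟩⟩⟩
  · intro z
    induction z using OnePoint.rec with
    | infty => rfl
    | coe y =>
      change F (0, jskCube n y) = _
      rw [F.apply_zero]
      change φ (jskCollapse (jskCube n) (jskCube n y)) = _
      rw [jskCollapse_apply (jskCube_isOpenEmbedding n).injective]
  · intro z
    induction z using OnePoint.rec with
    | infty => rfl
    | coe y =>
      change F (1, jskCube n y) = _
      rw [F.apply_one]
      rfl

theorem jsk_not_subsingleton {X J : Type*} [TopologicalSpace X] [TopologicalSpace J]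
    [DiscreteTopology J] [Finite J] (j : J) (n : ℕ)
    (e : ContinuousMap.HomotopyEquiv X (OnePoint (J × EuclideanSpace ℝ (Fin n)))) :
    ¬ ∀ x : X, Subsingleton (HomotopyGroup (Fin n) X x) := by
  intro hX
  let a : EuclideanSpace ℝ (Fin n) → J × EuclideanSpace ℝ (Fin n) := fun y => (j, y)
  have ha : IsOpenEmbedding a := by
    refine ⟨?_, ?_⟩
    · exact isEmbedding_prodMkRight j
    · have : range a = {j} ×ˢ univ := by
        ext ⟨j', y⟩
        simp [a, eq_comm]
      rw [this]
      exact (isOpen_discrete _).prod isOpen_univ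
  have ha2 : IsClosedEmbedding a := by
    refine ⟨ha.isEmbedding, ?_⟩
    have : range a = {j} ×ˢ univ := by
      ext ⟨j', y⟩
      simp [a, eq_comm]
    rw [this]
    exact (isClosed_discrete _).prod isClosed_univ
  have hι : Continuous (OnePoint.map a) := OnePoint.continuous_map ha.continuous
    (by rw [Filter.coclosedCompact_eq_cocompact, Filter.coclosedCompact_eq_cocompact]; exact ha2.tendsto_cocompact)
  let ι : C(OnePoint (EuclideanSpace ℝ (Fin n)), OnePoint (J × EuclideanSpace ℝ (Fin n))) :=
    ⟨OnePoint.map a, hι⟩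
  have hb : IsOpenEmbedding (fun y => ((a y : J × EuclideanSpace ℝ (Fin n)) :
      OnePoint (J × EuclideanSpace ℝ (Fin n)))) := OnePoint.isOpenEmbedding_coe.comp ha
  let π : C(OnePoint (J × EuclideanSpace ℝ (Fin n)), OnePoint (EuclideanSpace ℝ (Fin n))) :=
    ⟨jskCollapse _, jskCollapse_continuous hb⟩
  have hπι : π.comp ι = ContinuousMap.id _ := by
    ext z
    induction z using OnePoint.rec with
    | infty =>
      refine jskCollapse_infty ?_
      rintro ⟨y, hy⟩
      exact OnePoint.coe_ne_infty _ hy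
    | coe y => exact jskCollapse_apply hb.injective y
  have h1 := jsk_null_of_subsingleton n (e.invFun.comp ι) (hX _)
  have h2 : ((π.comp e.toFun).comp (e.invFun.comp ι)).Nullhomotopic := h1.comp_right _
  obtain ⟨x, hx⟩ := h2
  have h3 : ContinuousMap.Homotopic ((π.comp e.toFun).comp (e.invFun.comp ι))
      (ContinuousMap.id _) := by
    have := ContinuousMap.Homotopic.comp (ContinuousMap.Homotopic.refl π)
      (ContinuousMap.Homotopic.comp e.right_inv (ContinuousMap.Homotopic.refl ι))
    rw [ContinuousMap.id_comp, hπι] at this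
    exact this
  exact jsk_onePoint_not_null n ⟨x, h3.symm.trans hx⟩

end


section jskPush
variable {V ι : Type*} [Fintype V] [DecidableEq V] [Fintype ι] [DecidableEq ι]
  (b : V → ι) (v : ι → V) (s : ι → ℕ)

/-- points of the complex -/
def JskX (f : V → ℝ) : Prop :=
  (∀ p, 0 ≤ f p) ∧ ∑ p, f p = 1 ∧ ∀ i, {p | b p = i ∧ f p ≠ 0}.ncard ≤ s i

/-- the vertices of a block other than the distinguished one -/
def jskO (i : ι) : Finset V := Finset.univ.filter (fun p => b p = i ∧ p ≠ v i)

/-- complement of the big open cells -/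
def JskA (f : V → ℝ) : Prop := ∃ i, {p | p ∈ jskO b v i ∧ f p ≠ 0}.ncard < s i

/-- amount of mass moved to the distinguished vertex -/
noncomputable def jskGain (i : ι) (f : V → ℝ) (t : ℝ) : ℝ :=
  ∏ σ ∈ Finset.powersetCard (s i) (jskO b v i), ∑ w ∈ σ, max 0 (t - f w)

/-- unnormalised push -/
noncomputable def jskPush (Z : Finset ι) (f : V → ℝ) (t : ℝ) (p : V) : ℝ :=
  if p = v (b p) ∧ b p ∈ Z then f p + jskGain b v s (b p) f t else max 0 (f p - t)

theorem jskGain_nonneg (i : ι) (f : V → ℝ) (t : ℝ) : 0 ≤ jskGain b v s i f t :=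
  Finset.prod_nonneg fun _ _ => Finset.sum_nonneg fun _ _ => le_max_left _ _

theorem jskGain_ne (i : ι) (f : V → ℝ) (t : ℝ) (h : jskGain b v s i f t ≠ 0) :
    {p | p ∈ jskO b v i ∧ max 0 (f p - t) ≠ 0}.ncard < s i := by
  by_contra hc
  push Not at hc
  apply h
  obtain ⟨σ, hσ, hσc⟩ := Set.exists_subset_card_eq hc
  have hfin : σ.Finite := Set.toFinite _
  refine Finset.prod_eq_zero (i := hfin.toFinset) ?_ ?_
  · rw [Finset.mem_powersetCard]
    refine ⟨fun p hp => ?_, ?_⟩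
    · exact (hσ ((Set.Finite.mem_toFinset _).1 hp)).1
    · rw [← hσc, Set.ncard_eq_toFinset_card _ hfin]
  · refine Finset.sum_eq_zero fun p hp => ?_
    have := (hσ ((Set.Finite.mem_toFinset _).1 hp)).2
    refine max_eq_left ?_
    by_contra hc2
    push Not at hc2
    exact this (max_eq_left (by linarith))

theorem jskGain_eq_zero (i : ι) (f : V → ℝ) (t : ℝ) (h : jskGain b v s i f t = 0) :
    ∃ σ : Finset V, σ ⊆ jskO b v i ∧ σ.card = s i ∧ ∀ w ∈ σ, t ≤ f w := by
  rw [jskGain, Finset.prod_eq_zero_iff] at h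
  obtain ⟨σ, hσ, h0⟩ := h
  rw [Finset.mem_powersetCard] at hσ
  refine ⟨σ, hσ.1, hσ.2, fun w hw => ?_⟩
  rw [Finset.sum_eq_zero_iff_of_nonneg fun _ _ => le_max_left _ _] at h0
  have := h0 w hw
  have h2 := le_max_right 0 (t - f w)
  linarith

theorem jskGain_zero (hO : ∀ i, s i ≤ (jskO b v i).card) (i : ι) (f : V → ℝ)
    (hf : ∀ p, 0 ≤ f p) : jskGain b v s i f 0 = 0 := by
  obtain ⟨σ, hσ⟩ := Finset.powersetCard_nonempty.2 (hO i)
  refine Finset.prod_eq_zero hσ (Finset.sum_eq_zero fun p _ => ?_)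
  exact max_eq_left (by linarith [hf p])

theorem jskPush_nonneg (Z : Finset ι) (f : V → ℝ) (hf : ∀ p, 0 ≤ f p) (t : ℝ) (p : V) :
    0 ≤ jskPush b v s Z f t p := by
  unfold jskPush
  split_ifs
  · exact add_nonneg (hf p) (jskGain_nonneg _ _ _ _ _ _)
  · exact le_max_left _ _

theorem jskPush_zero (hO : ∀ i, s i ≤ (jskO b v i).card) (Z : Finset ι) (f : V → ℝ)
    (hf : ∀ p, 0 ≤ f p) : jskPush b v s Z f 0 = f := by
  ext p
  unfold jskPush
  split_ifs
  · rw [jskGain_zero b v s hO _ f hf, add_zero]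
  · simp [hf p]

theorem jskPush_off (Z : Finset ι) (f : V → ℝ) (t : ℝ) (i : ι) (p : V) (hp : p ∈ jskO b v i) :
    jskPush b v s Z f t p = max 0 (f p - t) := by
  simp only [jskO, Finset.mem_filter, Finset.mem_univ, true_and] at hp
  obtain ⟨rfl, h⟩ := hp
  unfold jskPush
  rw [if_neg (fun h' => h h'.1)]

theorem jskPush_off_ne (f : V → ℝ) (t : ℝ) (ht : 0 ≤ t) (p : V)
    (h : max 0 (f p - t) ≠ 0) : f p ≠ 0 := by
  intro h0
  apply h
  rw [h0]
  exact max_eq_left (by linarith)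

theorem jskPush_supp (Z : Finset ι) (f : V → ℝ) (t : ℝ) (ht : 0 ≤ t)
    (hf : JskX b s f) (i : ι) :
    {p | b p = i ∧ jskPush b v s Z f t p ≠ 0}.ncard ≤ s i := by
  by_cases hi : jskGain b v s i f t = 0
  · refine le_trans (Set.ncard_le_ncard ?_ (Set.toFinite _)) (hf.2.2 i)
    rintro p ⟨hp, hne⟩
    refine ⟨hp, ?_⟩
    unfold jskPush at hne
    split_ifs at hne with h
    · rw [hp, hi, add_zero] at hne
      exact hne
    · exact jskPush_off_ne f t ht p hne
  · have h1 := jskGain_ne b v s i f t hi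
    have h2 : {p | b p = i ∧ jskPush b v s Z f t p ≠ 0} ⊆
        insert (v i) {p | p ∈ jskO b v i ∧ max 0 (f p - t) ≠ 0} := by
      rintro p ⟨hp, hne⟩
      by_cases hpv : p = v i
      · exact Or.inl hpv
      · right
        have hO : p ∈ jskO b v i := by simp [jskO, hp, hpv]
        refine ⟨hO, ?_⟩
        rwa [jskPush_off b v s Z f t i p hO] at hne
    have h3 := Set.ncard_le_ncard h2 (Set.toFinite _)
    have h4 := Set.ncard_insert_le (v i) {p | p ∈ jskO b v i ∧ max 0 (f p - t) ≠ 0}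
    omega

/-- normalised push -/
noncomputable def jskNorm (g : V → ℝ) (p : V) : ℝ := g p / ∑ q, g q

theorem jskNorm_X (Z : Finset ι) (f : V → ℝ) (t : ℝ) (ht : 0 ≤ t)
    (hf : JskX b s f) (hpos : ∑ q, jskPush b v s Z f t q ≠ 0) :
    JskX b s (jskNorm (jskPush b v s Z f t)) := by
  refine ⟨fun p => ?_, ?_, fun i => ?_⟩
  · exact div_nonneg (jskPush_nonneg b v s Z f hf.1 t p)
      (Finset.sum_nonneg fun q _ => jskPush_nonneg b v s Z f hf.1 t q)
  · simp only [jskNorm]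
    rw [← Finset.sum_div, div_self hpos]
  · refine le_trans (Set.ncard_le_ncard ?_ (Set.toFinite _)) (jskPush_supp b v s Z f t ht hf i)
    rintro p ⟨hp, hne⟩
    refine ⟨hp, fun h0 => hne ?_⟩
    simp [jskNorm, h0]

theorem jskNorm_A (Z : Finset ι) (f : V → ℝ) (t : ℝ) (ht : 0 ≤ t)
    (hf : JskA b v s f) :
    JskA b v s (jskNorm (jskPush b v s Z f t)) := by
  obtain ⟨i, hi⟩ := hf
  refine ⟨i, lt_of_le_of_lt (Set.ncard_le_ncard ?_ (Set.toFinite _)) hi⟩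
  rintro p ⟨hp, hne⟩
  refine ⟨hp, fun h0 => hne ?_⟩
  have : max 0 (f p - t) = 0 := by rw [h0]; exact max_eq_left (by linarith)
  simp [jskNorm, jskPush_off b v s Z f t i p hp, this]

theorem jskNorm_zero (hO : ∀ i, s i ≤ (jskO b v i).card) (Z : Finset ι) (f : V → ℝ)
    (hf : JskX b s f) : jskNorm (jskPush b v s Z f 0) = f := by
  rw [jskPush_zero b v s hO Z f hf.1]
  ext p
  simp [jskNorm, hf.2.1]

theorem jskPush_continuous {T : Type*} [TopologicalSpace T] (Z : Finset ι) (F : T → V → ℝ)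
    (hF : Continuous F) (τ : T → ℝ) (hτ : Continuous τ) (p : V) :
    Continuous (fun x => jskPush b v s Z (F x) (τ x) p) := by
  unfold jskPush
  split_ifs
  · refine ((continuous_apply p).comp hF).add ?_
    unfold jskGain
    refine continuous_finsetProd _ fun σ _ => continuous_finsetSum _ fun w _ => ?_
    exact continuous_const.max (hτ.sub ((continuous_apply w).comp hF))
  · exact continuous_const.max (((continuous_apply p).comp hF).sub hτ)

theorem jskNorm_continuous {T : Type*} [TopologicalSpace T] (Z : Finset ι) (F : T → V → ℝ)
    (hF : Continuous F) (τ : T → ℝ) (hτ : Continuous τ)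
    (hne : ∀ x, ∑ q, jskPush b v s Z (F x) (τ x) q ≠ 0) :
    Continuous (fun x => jskNorm (jskPush b v s Z (F x) (τ x))) := by
  refine continuous_pi fun p => ?_
  unfold jskNorm
  exact (jskPush_continuous b v s Z F hF τ hτ p).div
    (continuous_finsetSum _ fun q _ => jskPush_continuous b v s Z F hF τ hτ q) hne

/-- top cells avoiding the distinguished vertices -/
def jskJ : Finset (Finset V) :=
  Finset.univ.filter (fun σ => ∀ i, (σ.filter (fun p => b p = i)).card = s i ∧ v i ∉ σ)

theorem jskJ_mem {σ : Finset V} : σ ∈ jskJ b v s ↔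
    ∀ i, (σ.filter (fun p => b p = i)).card = s i ∧ v i ∉ σ := by
  simp [jskJ]

theorem jskJ_card {σ : Finset V} (h : σ ∈ jskJ b v s) : σ.card = ∑ i, s i := by
  rw [jskJ_mem] at h
  rw [Finset.card_eq_sum_card_fiberwise (f := b) (t := Finset.univ) (fun _ _ => Finset.mem_univ _)]
  exact Finset.sum_congr rfl fun i _ => (h i).1

/-- if `f` is positive on a top cell then that cell is the support -/
theorem jskJ_supp {σ : Finset V} (h : σ ∈ jskJ b v s) {f : V → ℝ} (hf : JskX b s f)
    (hpos : ∀ p ∈ σ, f p ≠ 0) (p : V) (hp : f p ≠ 0) : p ∈ σ := by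
  rw [jskJ_mem] at h
  have h1 : ((σ.filter (fun q => b q = b p) : Finset V) : Set V) ⊆ {q | b q = b p ∧ f q ≠ 0} := by
    intro q hq
    simp only [Finset.coe_filter, mem_ofPred_eq] at hq
    exact ⟨hq.2, hpos q hq.1⟩
  have h2 := Set.eq_of_subset_of_ncard_le h1 (by
    rw [Set.ncard_coe_finset, (h (b p)).1]
    exact hf.2.2 (b p)) (Set.toFinite _)
  have h3 : p ∈ {q | b q = b p ∧ f q ≠ 0} := ⟨rfl, hp⟩
  rw [← h2] at h3
  simpa using h3

theorem jskA_iff (hbv : ∀ i, b (v i) = i) {f : V → ℝ} (hf : JskX b s f) :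
    ¬ JskA b v s f ↔ ∃ σ ∈ jskJ b v s, ∀ p, f p ≠ 0 ↔ p ∈ σ := by
  constructor
  · intro h
    simp only [JskA, not_exists, not_lt] at h
    have key : ∀ i, {p | p ∈ jskO b v i ∧ f p ≠ 0} = {p | b p = i ∧ f p ≠ 0} := by
      intro i
      refine Set.eq_of_subset_of_ncard_le ?_ ((hf.2.2 i).trans (h i)) (Set.toFinite _)
      rintro p ⟨hp, hne⟩
      simp only [jskO, Finset.mem_filter, Finset.mem_univ, true_and] at hp
      exact ⟨hp.1, hne⟩
    refine ⟨Finset.univ.filter (fun p => f p ≠ 0), ?_, by simp⟩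
    rw [jskJ_mem]
    intro i
    constructor
    · have e1 : (((Finset.univ.filter (fun p => f p ≠ 0)).filter (fun p => b p = i) : Finset V)
          : Set V) = {p | b p = i ∧ f p ≠ 0} := by
        ext p; simp [and_comm]
      rw [← Set.ncard_coe_finset, e1]
      refine le_antisymm (hf.2.2 i) ?_
      rw [← key]
      exact h i
    · intro hv
      simp only [Finset.mem_filter, Finset.mem_univ, true_and] at hv
      have h3 : v i ∈ {p | b p = b (v i) ∧ f p ≠ 0} := ⟨rfl, hv⟩
      rw [← key] at h3
      have h4 := h3.1
      simp only [jskO, Finset.mem_filter, Finset.mem_univ, true_and, hbv] at h4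
      exact h4 rfl
  · rintro ⟨σ, hσ, h⟩ ⟨i, hi⟩
    rw [jskJ_mem] at hσ
    have : ((σ.filter (fun q => b q = i) : Finset V) : Set V) ⊆
        {p | p ∈ jskO b v i ∧ f p ≠ 0} := by
      intro q hq
      simp only [Finset.coe_filter, mem_ofPred_eq] at hq
      refine ⟨?_, (h q).2 hq.1⟩
      simp only [jskO, Finset.mem_filter, Finset.mem_univ, true_and]
      refine ⟨hq.2, ?_⟩
      rintro rfl
      exact (hσ i).2 hq.1
    have h2 := Set.ncard_le_ncard this (Set.toFinite _)
    rw [Set.ncard_coe_finset, (hσ i).1] at h2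
    omega

end jskPush


section jskDef
variable {V ι : Type*} [Fintype V] [DecidableEq V] [Fintype ι] [DecidableEq ι]
  (b : V → ι) (v : ι → V) (s : ι → ℕ)

/-- first time function -/
noncomputable def jskT (f : V → ℝ) : ℝ :=
  max 0 (1 - ∑ σ ∈ jskJ b v s, ∏ w ∈ σ, ((∑ i, s i : ℕ) : ℝ) * f w)

/-- second time function -/
noncomputable def jskU (f : V → ℝ) : ℝ :=
  max 0 (1 - (Fintype.card V : ℝ) * ∑ w ∈ Finset.univ.filter (fun w => w ≠ v (b w)), f w)

theorem jskT_continuous : Continuous (jskT b v s) := by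
  unfold jskT; fun_prop

theorem jskU_continuous : Continuous (jskU b v) := by
  unfold jskU; fun_prop

theorem jsk_pos_univ (hbv : ∀ i, b (v i) = i) (f : V → ℝ) (hf : JskX b s f) (τ : ℝ)
    (h0 : 0 ≤ τ) (hτ : τ ≤ jskT b v s f) :
    ∑ q, jskPush b v s Finset.univ f τ q ≠ 0 := by
  intro hsum
  rw [Finset.sum_eq_zero_iff_of_nonneg fun q _ => jskPush_nonneg b v s _ f hf.1 τ q] at hsum
  have hv : ∀ i, f (v i) = 0 ∧ jskGain b v s i f τ = 0 := by
    intro i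
    have := hsum (v i) (Finset.mem_univ _)
    unfold jskPush at this
    rw [if_pos (by simp [hbv]), hbv] at this
    have h1 := hf.1 (v i)
    have h2 := jskGain_nonneg b v s i f τ
    constructor <;> linarith
  have hle : ∀ p, f p ≤ τ := by
    intro p
    by_cases hp : p = v (b p)
    · rw [hp, (hv _).1]; exact h0
    · have := hsum p (Finset.mem_univ _)
      unfold jskPush at this
      rw [if_neg (fun h => hp h.1)] at this
      have h2 := le_max_right 0 (f p - τ)
      linarith
  rcases h0.eq_or_lt with rfl | hpos
  · have : ∑ p, f p ≤ 0 := Finset.sum_nonpos fun p _ => hle p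
    rw [hf.2.1] at this
    linarith
  choose σ hσO hσc hσ using fun i => jskGain_eq_zero b v s i f τ (hv i).2
  let ρ : Finset V := Finset.univ.filter (fun p => p ∈ σ (b p))
  have hmemO : ∀ i, ∀ p ∈ σ i, b p = i ∧ p ≠ v i := by
    intro i p hp
    have := hσO i hp
    simpa [jskO] using this
  have hρJ : ρ ∈ jskJ b v s := by
    rw [jskJ_mem]
    intro i
    constructor
    · rw [← hσc i]
      congr 1
      ext p
      simp only [ρ, Finset.mem_filter, Finset.mem_univ, true_and]
      constructor
      · rintro ⟨h1, rfl⟩; exact h1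
      · intro h1
        have := (hmemO i p h1).1
        subst this
        exact ⟨h1, rfl⟩
    · simp only [ρ, Finset.mem_filter, Finset.mem_univ, true_and, hbv]
      intro h
      exact (hmemO i _ h).2 rfl
  have hρf : ∀ p ∈ ρ, f p = τ := by
    intro p hp
    simp only [ρ, Finset.mem_filter, Finset.mem_univ, true_and] at hp
    exact le_antisymm (hle p) (hσ _ p hp)
  have hsupp := jskJ_supp b v s hρJ hf (fun p hp => by rw [hρf p hp]; exact hpos.ne')
  have hsum1 : ((∑ i, s i : ℕ) : ℝ) * τ = 1 := by
    rw [← hf.2.1, ← Finset.sum_subset (Finset.subset_univ ρ) (fun p _ hp => by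
      by_contra hc; exact hp (hsupp p hc)), Finset.sum_congr rfl hρf, Finset.sum_const,
      jskJ_card b v s hρJ, nsmul_eq_mul]
  have hmu : 1 ≤ ∑ σ ∈ jskJ b v s, ∏ w ∈ σ, ((∑ i, s i : ℕ) : ℝ) * f w := by
    have h1 : ∏ w ∈ ρ, ((∑ i, s i : ℕ) : ℝ) * f w = 1 := by
      refine Finset.prod_eq_one fun w hw => ?_
      rw [hρf w hw, hsum1]
    rw [← h1]
    exact Finset.single_le_sum (f := fun σ => ∏ w ∈ σ, ((∑ i, s i : ℕ) : ℝ) * f w)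
      (fun σ _ => Finset.prod_nonneg fun w _ =>
        mul_nonneg (Nat.cast_nonneg _) (hf.1 w)) hρJ
  have : jskT b v s f = 0 := max_eq_left (by linarith)
  linarith

theorem jsk_pos_one (hbv : ∀ i, b (v i) = i) (i1 : ι) (hi1 : 1 ≤ s i1)
    (f : V → ℝ) (hf : JskX b s f) (τ : ℝ)
    (h0 : 0 ≤ τ) (hτ : τ ≤ jskU b v f) :
    ∑ q, jskPush b v s {i1} f τ q ≠ 0 := by
  intro hsum
  rw [Finset.sum_eq_zero_iff_of_nonneg fun q _ => jskPush_nonneg b v s _ f hf.1 τ q] at hsum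
  have hv : f (v i1) = 0 ∧ jskGain b v s i1 f τ = 0 := by
    have := hsum (v i1) (Finset.mem_univ _)
    unfold jskPush at this
    rw [if_pos (by simp [hbv]), hbv] at this
    have h1 := hf.1 (v i1)
    have h2 := jskGain_nonneg b v s i1 f τ
    constructor <;> linarith
  have hle : ∀ p, f p ≤ τ := by
    intro p
    by_cases hp : p = v i1
    · rw [hp, hv.1]; exact h0
    · have := hsum p (Finset.mem_univ _)
      unfold jskPush at this
      rw [if_neg (fun h => hp (by
        have h2 := h.2
        rw [Finset.mem_singleton] at h2
        rw [← h2]; exact h.1))] at this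
      have h2 := le_max_right 0 (f p - τ)
      linarith
  obtain ⟨σ, hσO, hσc, hσ⟩ := jskGain_eq_zero b v s i1 f τ hv.2
  obtain ⟨w, hw⟩ := Finset.card_pos.1 (by omega : 0 < σ.card)
  have hwO := hσO hw
  simp only [jskO, Finset.mem_filter, Finset.mem_univ, true_and] at hwO
  have h1 : 1 ≤ (Fintype.card V : ℝ) * f w := by
    rw [← hf.2.1]
    have : ∑ p, f p ≤ ∑ p : V, f w := Finset.sum_le_sum fun p _ => (hle p).trans (hσ w hw)
    simpa using this
  have h2 : f w ≤ ∑ w ∈ Finset.univ.filter (fun w => w ≠ v (b w)), f w :=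
    Finset.single_le_sum (fun p _ => hf.1 p) (by
      simp only [Finset.mem_filter, Finset.mem_univ, true_and]
      rw [hwO.1]; exact hwO.2)
  have h3 : (Fintype.card V : ℝ) * f w ≤
      Fintype.card V * ∑ w ∈ Finset.univ.filter (fun w => w ≠ v (b w)), f w :=
    mul_le_mul_of_nonneg_left h2 (Nat.cast_nonneg _)
  have : jskU b v f = 0 := max_eq_left (by linarith)
  have : ∑ p, f p ≤ 0 := Finset.sum_nonpos fun p _ => (hle p).trans (by linarith)
  rw [hf.2.1] at this
  linarith

theorem jskT_A (f : V → ℝ) (hf : JskA b v s f) : jskT b v s f = 1 := by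
  have : ∑ σ ∈ jskJ b v s, ∏ w ∈ σ, ((∑ i, s i : ℕ) : ℝ) * f w = 0 := by
    refine Finset.sum_eq_zero fun σ hσ => ?_
    by_contra hne
    have hne := Finset.prod_ne_zero_iff.1 hne
    rw [jskJ_mem] at hσ
    obtain ⟨i, hi⟩ := hf
    have : ((σ.filter (fun q => b q = i) : Finset V) : Set V) ⊆
        {p | p ∈ jskO b v i ∧ f p ≠ 0} := by
      intro q hq
      simp only [Finset.coe_filter, mem_ofPred_eq] at hq
      refine ⟨?_, right_ne_zero_of_mul (hne q hq.1)⟩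
      simp only [jskO, Finset.mem_filter, Finset.mem_univ, true_and]
      refine ⟨hq.2, ?_⟩
      rintro rfl
      exact (hσ i).2 hq.1
    have h2 := Set.ncard_le_ncard this (Set.toFinite _)
    rw [Set.ncard_coe_finset, (hσ i).1] at h2
    omega
  rw [jskT, this]
  norm_num

theorem jskX_le_one (f : V → ℝ) (hf : JskX b s f) (p : V) : f p ≤ 1 := by
  rw [← hf.2.1]
  exact Finset.single_le_sum (fun q _ => hf.1 q) (Finset.mem_univ p)

/-- first stage -/
noncomputable def jskD (t : ℝ) (f : V → ℝ) : V → ℝ :=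
  jskNorm (jskPush b v s Finset.univ f (t * jskT b v s f))

/-- second stage -/
noncomputable def jskE (i1 : ι) (t : ℝ) (f : V → ℝ) : V → ℝ :=
  jskNorm (jskPush b v s {i1} f (t * jskU b v f))

theorem jskT_nonneg (f : V → ℝ) : 0 ≤ jskT b v s f := le_max_left _ _
theorem jskU_nonneg (f : V → ℝ) : 0 ≤ jskU b v f := le_max_left _ _

theorem jskD_ne (hbv : ∀ i, b (v i) = i) (f : V → ℝ) (hf : JskX b s f) (t : unitInterval) :
    ∑ q, jskPush b v s Finset.univ f (t * jskT b v s f) q ≠ 0 :=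
  jsk_pos_univ b v s hbv f hf _ (mul_nonneg t.2.1 (jskT_nonneg b v s f))
    (mul_le_of_le_one_left (jskT_nonneg b v s f) t.2.2)

theorem jskE_ne (hbv : ∀ i, b (v i) = i) (i1 : ι) (hi1 : 1 ≤ s i1)
    (f : V → ℝ) (hf : JskX b s f) (t : unitInterval) :
    ∑ q, jskPush b v s {i1} f (t * jskU b v f) q ≠ 0 :=
  jsk_pos_one b v s hbv i1 hi1 f hf _ (mul_nonneg t.2.1 (jskU_nonneg b v f))
    (mul_le_of_le_one_left (jskU_nonneg b v f) t.2.2)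

theorem jskD_X (hbv : ∀ i, b (v i) = i) (f : V → ℝ) (hf : JskX b s f) (t : unitInterval) :
    JskX b s (jskD b v s t f) :=
  jskNorm_X b v s _ f _ (mul_nonneg t.2.1 (jskT_nonneg b v s f)) hf (jskD_ne b v s hbv f hf t)

theorem jskE_X (hbv : ∀ i, b (v i) = i) (i1 : ι) (hi1 : 1 ≤ s i1)
    (f : V → ℝ) (hf : JskX b s f) (t : unitInterval) :
    JskX b s (jskE b v s i1 t f) :=
  jskNorm_X b v s _ f _ (mul_nonneg t.2.1 (jskU_nonneg b v f)) hf (jskE_ne b v s hbv i1 hi1 f hf t)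

theorem jskDE_one (hbv : ∀ i, b (v i) = i) (i1 : ι) (hi1 : 1 ≤ s i1)
    (f : V → ℝ) (hf : JskX b s f) (hA : JskA b v s f) :
    jskE b v s i1 1 (jskD b v s 1 f) = Pi.single (v i1) 1 := by
  have hD : ∀ p, p ≠ v (b p) → jskD b v s 1 f p = 0 := by
    intro p hp
    simp only [jskD, jskT_A b v s f hA, jskNorm, jskPush]
    rw [if_neg (fun h => hp h.1), max_eq_left (by linarith [jskX_le_one b s f hf p]), zero_div]
  have hX := jskD_X b v s hbv f hf 1
  simp only [Set.Icc.coe_one] at hX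
  generalize jskD b v s 1 f = g at hD hX
  have hU : jskU b v g = 1 := by
    have : ∑ w ∈ Finset.univ.filter (fun w => w ≠ v (b w)), g w = 0 :=
      Finset.sum_eq_zero fun w hw => hD w (by simpa using hw)
    rw [jskU, this]; norm_num
  have hE := jskE_X b v s hbv i1 hi1 g hX 1
  simp only [Set.Icc.coe_one] at hE
  have h0 : ∀ p, p ≠ v i1 → jskE b v s i1 1 g p = 0 := by
    intro p hp
    simp only [jskE, hU, jskNorm, jskPush]
    rw [if_neg (fun h => hp (by
        have h2 := h.2
        rw [Finset.mem_singleton] at h2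
        rw [← h2]; exact h.1)), max_eq_left (by linarith [jskX_le_one b s g hX p]), zero_div]
  have h1 : jskE b v s i1 1 g (v i1) = 1 := by
    refine Eq.trans ?_ hE.2.1
    exact (Finset.sum_eq_single (v i1) (fun p _ hp => h0 p hp)
      (fun h => absurd (Finset.mem_univ _) h)).symm
  ext p
  by_cases hp : p = v i1
  · rw [hp, h1]; simp
  · rw [h0 p hp]; simp [hp]

theorem jskPoint_X (hbv : ∀ i, b (v i) = i) (i1 : ι) (hi1 : 1 ≤ s i1) :
    JskX b s (Pi.single (v i1) 1 : V → ℝ) := by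
  refine ⟨fun p => ?_, by simp, fun i => ?_⟩
  · by_cases hp : p = v i1
    · rw [hp]; simp
    · simp [hp]
  · have h1 : {p | b p = i ∧ (Pi.single (v i1) 1 : V → ℝ) p ≠ 0} ⊆ {v i1} := by
      rintro p ⟨-, hp⟩
      by_contra hc
      exact hp (by simp [show p ≠ v i1 from hc])
    by_cases hi : i = i1
    · subst hi
      have := Set.ncard_le_ncard h1 (Set.toFinite _)
      simp only [Set.ncard_singleton] at this
      omega
    · have : {p | b p = i ∧ (Pi.single (v i1) 1 : V → ℝ) p ≠ 0} = ∅ := by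
        rw [Set.eq_empty_iff_forall_notMem]
        intro p hp
        have h2 : p = v i1 := h1 hp
        have h3 := hp.1
        rw [h2, hbv] at h3
        exact hi h3.symm
      rw [this]; simp

theorem jskPoint_A (i1 : ι) (hi1 : 1 ≤ s i1) :
    JskA b v s (Pi.single (v i1) 1 : V → ℝ) := by
  refine ⟨i1, ?_⟩
  have : {p | p ∈ jskO b v i1 ∧ (Pi.single (v i1) 1 : V → ℝ) p ≠ 0} = ∅ := by
    rw [Set.eq_empty_iff_forall_notMem]
    rintro p ⟨h1, h2⟩
    simp only [jskO, Finset.mem_filter, Finset.mem_univ, true_and] at h1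
    exact h2 (by simp [h1.2])
  rw [this]; simp only [Set.ncard_empty]; omega

set_option maxHeartbeats 1000000 in
/-- the deformation -/
theorem jsk_deformation (hbv : ∀ i, b (v i) = i) (hO : ∀ i, s i ≤ (jskO b v i).card)
    (i1 : ι) (hi1 : 1 ≤ s i1) :
    ∃ H : unitInterval × {f : V → ℝ // JskX b s f} → {f : V → ℝ // JskX b s f}, Continuous H ∧
      (∀ x, H (0, x) = x) ∧ (∀ t x, JskA b v s x.1 → JskA b v s (H (t, x)).1) ∧
      (∀ x, JskA b v s x.1 → H (1, x) = ⟨Pi.single (v i1) 1, jskPoint_X b v s hbv i1 hi1⟩) := by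
  refine ⟨fun z => ⟨jskE b v s i1 z.1 (jskD b v s z.1 z.2.1), jskE_X b v s hbv i1 hi1 _
    (jskD_X b v s hbv _ z.2.2 z.1) z.1⟩, ?_, ?_, ?_, ?_⟩
  · refine Continuous.subtype_mk ?_ _
    have hD : Continuous (fun z : unitInterval × {f : V → ℝ // JskX b s f} =>
        jskD b v s z.1 z.2.1) := by
      unfold jskD
      refine jskNorm_continuous (T := unitInterval × {f : V → ℝ // JskX b s f}) b v s _ (fun z => z.2.1) (by fun_prop)
        (fun z => (z.1 : ℝ) * jskT b v s z.2.1) ?_ (fun z => jskD_ne b v s hbv z.2.1 z.2.2 z.1)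
      exact (by fun_prop : Continuous fun z : unitInterval × {f : V → ℝ // JskX b s f} =>
        (z.1 : ℝ)).mul ((jskT_continuous b v s).comp (by fun_prop))
    unfold jskE
    refine jskNorm_continuous (T := unitInterval × {f : V → ℝ // JskX b s f}) b v s _ (fun z => jskD b v s z.1 z.2.1) hD
      (fun z => (z.1 : ℝ) * jskU b v (jskD b v s z.1 z.2.1)) ?_
      (fun z => jskE_ne b v s hbv i1 hi1 _ (jskD_X b v s hbv _ z.2.2 z.1) z.1)
    exact (by fun_prop : Continuous fun z : unitInterval × {f : V → ℝ // JskX b s f} =>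
        (z.1 : ℝ)).mul ((jskU_continuous b v).comp hD)
  · intro x
    refine Subtype.ext ?_
    simp only [jskE, jskD, Set.Icc.coe_zero, zero_mul]
    rw [jskNorm_zero b v s hO _ _ x.2, jskNorm_zero b v s hO _ _ x.2]
  · intro t x hx
    exact jskNorm_A b v s _ _ _ (mul_nonneg t.2.1 (jskU_nonneg b v _))
      (jskNorm_A b v s _ _ _ (mul_nonneg t.2.1 (jskT_nonneg b v s _)) hx)
  · intro x hx
    refine Subtype.ext ?_
    simp only [Set.Icc.coe_one]
    exact jskDE_one b v s hbv i1 hi1 x.1 x.2 hx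

end jskDef


section jskEmb
variable {V ι : Type*} [Fintype V] [DecidableEq V] [Fintype ι] [DecidableEq ι]
  (b : V → ι) (v : ι → V) (s : ι → ℕ)

/-- homogeneous exponential coordinates -/
noncomputable def jskEx {n : ℕ} (y : EuclideanSpace ℝ (Fin n)) (k : Fin (n + 1)) : ℝ :=
  Real.exp (Fin.cons (α := fun _ => ℝ) 0 (fun j => y j) k)

theorem jskEx_pos {n : ℕ} (y : EuclideanSpace ℝ (Fin n)) (k : Fin (n + 1)) : 0 < jskEx y k :=
  Real.exp_pos _

theorem jskEx_continuous {n : ℕ} (k : Fin (n + 1)) :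
    Continuous (fun y : EuclideanSpace ℝ (Fin n) => jskEx y k) := by
  unfold jskEx
  refine Real.continuous_exp.comp ?_
  refine Fin.cases ?_ (fun j => ?_) k
  · simp only [Fin.cons_zero]; fun_prop
  · simp only [Fin.cons_succ]; fun_prop

/-- softmax on a cell -/
noncomputable def jskSoft {n : ℕ} (σ : Finset V) (ψ : σ ≃ Fin (n + 1))
    (y : EuclideanSpace ℝ (Fin n)) (p : V) : ℝ :=
  if h : p ∈ σ then jskEx y (ψ ⟨p, h⟩) / ∑ k, jskEx y k else 0

theorem jskEx_sum_pos {n : ℕ} (y : EuclideanSpace ℝ (Fin n)) : 0 < ∑ k, jskEx y k :=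
  Finset.sum_pos (fun k _ => jskEx_pos y k) Finset.univ_nonempty

theorem jskSoft_pos {n : ℕ} (σ : Finset V) (ψ : σ ≃ Fin (n + 1))
    (y : EuclideanSpace ℝ (Fin n)) (p : V) (hp : p ∈ σ) : 0 < jskSoft σ ψ y p := by
  rw [jskSoft, dif_pos hp]
  exact div_pos (jskEx_pos _ _) (jskEx_sum_pos y)

theorem jskSoft_ne {n : ℕ} (σ : Finset V) (ψ : σ ≃ Fin (n + 1))
    (y : EuclideanSpace ℝ (Fin n)) (p : V) : jskSoft σ ψ y p ≠ 0 ↔ p ∈ σ := by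
  constructor
  · intro h
    by_contra hp
    exact h (by rw [jskSoft, dif_neg hp])
  · exact fun hp => (jskSoft_pos σ ψ y p hp).ne'

theorem jskSoft_continuous {n : ℕ} (σ : Finset V) (ψ : σ ≃ Fin (n + 1)) :
    Continuous (jskSoft σ ψ) := by
  refine continuous_pi fun p => ?_
  unfold jskSoft
  split_ifs
  · exact (jskEx_continuous _).div (continuous_finsetSum _ fun k _ => jskEx_continuous k)
      (fun y => (jskEx_sum_pos y).ne')
  · exact continuous_const

theorem jskSoft_X {n : ℕ} (σ : Finset V) (hσ : σ ∈ jskJ b v s) (ψ : σ ≃ Fin (n + 1))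
    (y : EuclideanSpace ℝ (Fin n)) : JskX b s (jskSoft σ ψ y) := by
  refine ⟨fun p => ?_, ?_, fun i => ?_⟩
  · by_cases hp : p ∈ σ
    · exact (jskSoft_pos σ ψ y p hp).le
    · rw [jskSoft, dif_neg hp]
  · rw [← Finset.sum_subset (Finset.subset_univ σ) (fun p _ hp => by rw [jskSoft, dif_neg hp]),
      ← Finset.sum_coe_sort σ]
    have : ∀ p : σ, jskSoft σ ψ y p = jskEx y (ψ p) / ∑ k, jskEx y k := by
      intro p
      rw [jskSoft, dif_pos p.2]
    simp only [this]
    rw [← Finset.sum_div, Equiv.sum_comp ψ (fun k => jskEx y k), div_self (jskEx_sum_pos y).ne']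
  · rw [jskJ_mem] at hσ
    rw [← (hσ i).1, ← Set.ncard_coe_finset]
    refine Set.ncard_le_ncard ?_ (Set.toFinite _)
    rintro p ⟨h1, h2⟩
    rw [jskSoft_ne] at h2
    simp [h1, h2]

/-- inverse of softmax -/
noncomputable def jskLog {n : ℕ} (σ : Finset V) (ψ : σ ≃ Fin (n + 1))
    (f : V → ℝ) : EuclideanSpace ℝ (Fin n) :=
  (EuclideanSpace.equiv (Fin n) ℝ).symm
    (fun j => Real.log (f (ψ.symm j.succ)) - Real.log (f (ψ.symm 0)))

theorem jskLog_soft {n : ℕ} (σ : Finset V) (ψ : σ ≃ Fin (n + 1))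
    (y : EuclideanSpace ℝ (Fin n)) : jskLog σ ψ (jskSoft σ ψ y) = y := by
  have : ∀ k, jskSoft σ ψ y (ψ.symm k) = jskEx y k / ∑ k, jskEx y k := by
    intro k
    rw [jskSoft, dif_pos (ψ.symm k).2]
    simp
  ext j
  simp only [jskLog, this]
  change Real.log (jskEx y j.succ / ∑ k, jskEx y k) - Real.log (jskEx y 0 / ∑ k, jskEx y k) = y j
  rw [Real.log_div (jskEx_pos _ _).ne' (jskEx_sum_pos y).ne',
    Real.log_div (jskEx_pos _ _).ne' (jskEx_sum_pos y).ne']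
  simp [jskEx]

theorem jskSoft_log {n : ℕ} (σ : Finset V) (hσ : σ ∈ jskJ b v s) (ψ : σ ≃ Fin (n + 1))
    (f : V → ℝ) (hf : JskX b s f) (hpos : ∀ p ∈ σ, 0 < f p) :
    jskSoft σ ψ (jskLog σ ψ f) = f := by
  have hsupp := jskJ_supp b v s hσ hf (fun p hp => (hpos p hp).ne')
  have h0 : 0 < f (ψ.symm 0) := hpos _ (ψ.symm 0).2
  have hex : ∀ k, jskEx (jskLog σ ψ f) k = f (ψ.symm k) / f (ψ.symm 0) := by
    intro k
    refine Fin.cases ?_ (fun j => ?_) k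
    · simp [jskEx, div_self h0.ne']
    · have h1 : 0 < f (ψ.symm j.succ) := hpos _ (ψ.symm j.succ).2
      simp only [jskEx, Fin.cons_succ, jskLog]
      simp [Real.exp_sub, Real.exp_log h0, Real.exp_log h1]
  have hsum : ∑ k, jskEx (jskLog σ ψ f) k = 1 / f (ψ.symm 0) := by
    simp only [hex]
    rw [← Finset.sum_div, Equiv.sum_comp ψ.symm (fun p : σ => f p), Finset.sum_coe_sort σ f,
      Finset.sum_subset (Finset.subset_univ σ) (fun p _ hp => by
        by_contra hc; exact hp (hsupp p hc)), hf.2.1]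
  ext p
  by_cases hp : p ∈ σ
  · rw [jskSoft, dif_pos hp, hsum, hex]
    simp only [Equiv.symm_apply_apply]
    field_simp
  · rw [jskSoft, dif_neg hp]
    by_contra hc
    exact hp (hsupp p (Ne.symm hc))

theorem jskSoft_isOpenEmbedding {n : ℕ} (σ : Finset V) (hσ : σ ∈ jskJ b v s)
    (ψ : σ ≃ Fin (n + 1)) :
    IsOpenEmbedding (fun y => (⟨jskSoft σ ψ y, jskSoft_X b v s σ hσ ψ y⟩ :
      {f : V → ℝ // JskX b s f})) := by
  let Φ : OpenPartialHomeomorph (EuclideanSpace ℝ (Fin n)) {f : V → ℝ // JskX b s f} :=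
    { toFun := fun y => ⟨jskSoft σ ψ y, jskSoft_X b v s σ hσ ψ y⟩
      invFun := fun f => jskLog σ ψ f.1
      source := Set.univ
      target := {f | ∀ p ∈ σ, 0 < f.1 p}
      map_source' := fun y _ p hp => jskSoft_pos σ ψ y p hp
      map_target' := fun _ _ => Set.mem_univ _
      left_inv' := fun y _ => jskLog_soft σ ψ y
      right_inv' := fun f hf => Subtype.ext (jskSoft_log b v s σ hσ ψ f.1 f.2 hf)
      open_source := isOpen_univ
      open_target := by
        have : {f : {f : V → ℝ // JskX b s f} | ∀ p ∈ σ, 0 < f.1 p} =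
            ⋂ p ∈ σ, {f | 0 < f.1 p} := by
          ext f; simp
        rw [this]
        refine isOpen_biInter_finset fun p _ => ?_
        exact isOpen_lt continuous_const ((continuous_apply p).comp continuous_subtype_val)
      continuousOn_toFun := ((jskSoft_continuous σ ψ).subtype_mk _).continuousOn
      continuousOn_invFun := by
        unfold jskLog
        refine (EuclideanSpace.equiv (Fin n) ℝ).symm.continuous.comp_continuousOn ?_
        refine continuousOn_pi.2 fun j => ?_
        refine ContinuousOn.sub ?_ ?_
        · refine ContinuousOn.log (((continuous_apply _).comp continuous_subtype_val).continuousOn) ?_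
          exact fun f hf => (hf _ (ψ.symm j.succ).2).ne'
        · refine ContinuousOn.log (((continuous_apply _).comp continuous_subtype_val).continuousOn) ?_
          exact fun f hf => (hf _ (ψ.symm 0).2).ne' }
  exact Φ.isOpenEmbedding rfl

theorem jskX_compact : CompactSpace {f : V → ℝ // JskX b s f} := by
  refine (isCompact_iff_compactSpace (s := {f : V → ℝ | JskX b s f})).1 ?_
  have hc : IsCompact (Set.univ.pi (fun _ : V => Set.Icc (0:ℝ) 1)) :=
    isCompact_univ_pi fun _ => isCompact_Icc
  refine hc.of_isClosed_subset ?_ ?_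
  · have e1 : {f : V → ℝ | JskX b s f} = {f | ∀ p, 0 ≤ f p} ∩ ({f | ∑ p, f p = 1} ∩
        {f | ∀ i, ∀ σ : Finset V, (∀ p ∈ σ, b p = i) → s i < σ.card → ∏ p ∈ σ, f p = 0}) := by
      ext f
      refine and_congr Iff.rfl (and_congr Iff.rfl (forall_congr' fun i => ?_))
      constructor
      · intro h σ hσ hlt
        by_contra hne
        rw [← ne_eq, Finset.prod_ne_zero_iff] at hne
        have : (σ : Set V) ⊆ {p | b p = i ∧ f p ≠ 0} := fun p hp => ⟨hσ p hp, hne p hp⟩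
        have h2 := Set.ncard_le_ncard this (Set.toFinite _)
        rw [Set.ncard_coe_finset] at h2
        omega
      · intro h
        by_contra hlt
        push Not at hlt
        have hfin : {p | b p = i ∧ f p ≠ 0}.Finite := Set.toFinite _
        have h3 := h hfin.toFinset (fun p hp => ((Set.Finite.mem_toFinset _).1 hp).1) (by
          rwa [Set.ncard_eq_toFinset_card _ hfin] at hlt)
        rw [Finset.prod_eq_zero_iff] at h3
        obtain ⟨p, hp, hp0⟩ := h3
        exact ((Set.Finite.mem_toFinset _).1 hp).2 hp0
    rw [e1]
    refine IsClosed.inter ?_ (IsClosed.inter ?_ ?_)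
    · have : {f : V → ℝ | ∀ p, 0 ≤ f p} = ⋂ p, {f | 0 ≤ f p} := by ext f; simp
      rw [this]
      exact isClosed_iInter fun p => isClosed_le continuous_const (continuous_apply p)
    · exact isClosed_eq (by fun_prop) continuous_const
    · have : {f : V → ℝ | ∀ i, ∀ σ : Finset V, (∀ p ∈ σ, b p = i) → s i < σ.card →
          ∏ p ∈ σ, f p = 0} = ⋂ (i) (σ : Finset V) (_ : ∀ p ∈ σ, b p = i) (_ : s i < σ.card),
            {f | ∏ p ∈ σ, f p = 0} := by
        ext f; simp
      rw [this]
      exact isClosed_iInter fun i => isClosed_iInter fun σ => isClosed_iInter fun _ =>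
        isClosed_iInter fun _ => isClosed_eq (by fun_prop) continuous_const
  · intro f hf p _
    exact ⟨hf.1 p, jskX_le_one b s f hf p⟩

theorem jsk_part_one (hbv : ∀ i, b (v i) = i) (hO : ∀ i, s i ≤ (jskO b v i).card)
    (n N : ℕ) (hn : n + 1 = ∑ i, s i) (hN : (jskJ b v s).card = N) :
    Nonempty (ContinuousMap.HomotopyEquiv {f : V → ℝ // JskX b s f}
      (OnePoint (Fin N × EuclideanSpace ℝ (Fin n)))) := by
  obtain ⟨i1, hi1⟩ : ∃ i, 1 ≤ s i := by
    by_contra h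
    push Not at h
    have : ∑ i, s i = 0 := Finset.sum_eq_zero fun i _ => by have := h i; omega
    omega
  have : CompactSpace {f : V → ℝ // JskX b s f} := jskX_compact b s
  let κ : Fin N ≃ jskJ b v s := (Finset.equivFinOfCardEq hN).symm
  have hψ : ∀ j : Fin N, Nonempty ((κ j).1 ≃ Fin (n + 1)) := by
    intro j
    exact ⟨Finset.equivFinOfCardEq (by rw [jskJ_card b v s (κ j).2, hn])⟩
  let ψ := fun j => (hψ j).some
  let e : Fin N × EuclideanSpace ℝ (Fin n) → {f : V → ℝ // JskX b s f} :=
    fun z => ⟨jskSoft (κ z.1).1 (ψ z.1) z.2, jskSoft_X b v s _ (κ z.1).2 (ψ z.1) z.2⟩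
  have he1 : ∀ j, IsOpenEmbedding (fun y => e (j, y)) := fun j =>
    jskSoft_isOpenEmbedding b v s (κ j).1 (κ j).2 (ψ j)
  have he : IsOpenEmbedding e := by
    refine IsOpenEmbedding.of_continuous_injective_isOpenMap ?_ ?_ ?_
    · rw [continuous_prod_of_discrete_left]
      exact fun j => (he1 j).continuous
    · rintro ⟨j, y⟩ ⟨j', y'⟩ h
      have h1 : (κ j).1 = (κ j').1 := by
        ext p
        rw [← jskSoft_ne (κ j).1 (ψ j) y p, ← jskSoft_ne (κ j').1 (ψ j') y' p]
        have := congrFun (congrArg Subtype.val h) p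
        simp only [e] at this
        rw [this]
      have h2 : j = j' := κ.injective (Subtype.ext h1)
      subst h2
      rw [(he1 j).injective h]
    · rw [isOpenMap_prod_of_discrete_left]
      exact fun j => (he1 j).isOpenMap
  have hrange : ∀ x, x ∉ range e ↔ JskA b v s x.1 := by
    intro x
    rw [← not_iff_not, not_not, jskA_iff b v s hbv x.2]
    constructor
    · rintro ⟨⟨j, y⟩, rfl⟩
      exact ⟨(κ j).1, (κ j).2, jskSoft_ne _ _ _⟩
    · rintro ⟨σ, hσ, h⟩
      obtain ⟨j, hj⟩ := κ.surjective ⟨σ, hσ⟩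
      have hj' : (κ j).1 = σ := by rw [hj]
      refine ⟨(j, jskLog (κ j).1 (ψ j) x.1), Subtype.ext ?_⟩
      refine jskSoft_log b v s (κ j).1 (κ j).2 (ψ j) x.1 x.2 fun p hp => ?_
      rw [hj', ← h] at hp
      exact lt_of_le_of_ne (x.2.1 p) (Ne.symm hp)
  obtain ⟨H, hH, H0, HA, H1⟩ := jsk_deformation b v s hbv hO i1 hi1
  refine jsk_homotopyEquiv he ⟨Pi.single (v i1) 1, jskPoint_X b v s hbv i1 hi1⟩ ((hrange _).2 (jskPoint_A b v s i1 hi1)) H hH H0 ?_ ?_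
  · intro t x hx
    rw [hrange] at hx ⊢
    exact HA t x hx
  · intro x hx
    rw [hrange] at hx
    exact H1 x hx

end jskEmb


theorem jsk_wedge_homeo {S E : Type*} [TopologicalSpace S] [NormedAddCommGroup E]
    [InnerProductSpace ℝ E] [FiniteDimensional ℝ E] (h : OnePoint E ≃ₜ S) (N : ℕ) (hN : 0 < N) :
    Nonempty (Wedge (Fin N) S (h OnePoint.infty) ≃ₜ OnePoint (Fin N × E)) := by
  have ha2 : ∀ j : Fin N, IsClosedEmbedding (fun y : E => (j, y)) := by
    intro j
    refine ⟨isEmbedding_prodMkRight j, ?_⟩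
    have : range (fun y : E => (j, y)) = {j} ×ˢ univ := by
      ext ⟨j', y⟩
      simp [eq_comm]
    rw [this]
    exact (isClosed_discrete _).prod isClosed_univ
  let g : Fin N × S → OnePoint (Fin N × E) := fun z => OnePoint.map (fun y => (z.1, y)) (h.symm z.2)
  have hg : Continuous g := by
    rw [continuous_prod_of_discrete_left]
    intro j
    refine (OnePoint.continuous_map (ha2 j).continuous ?_).comp h.symm.continuous
    rw [Filter.coclosedCompact_eq_cocompact, Filter.coclosedCompact_eq_cocompact]
    exact (ha2 j).tendsto_cocompact
  have hr : ∀ p q : Fin N × S, (p.2 = h OnePoint.infty ∧ q.2 = h OnePoint.infty) → g p = g q := by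
    rintro ⟨p1, p2⟩ ⟨q1, q2⟩ ⟨h1, h2⟩
    simp only at h1 h2
    subst h1 h2
    simp [g]
  let G : Wedge (Fin N) S (h OnePoint.infty) → OnePoint (Fin N × E) := Quot.lift g hr
  have hG : Continuous G := by
    exact continuous_quot_lift hr hg
  have hS : CompactSpace S := h.compactSpace
  have hc : CompactSpace (Wedge (Fin N) S (h OnePoint.infty)) :=
    inferInstanceAs (CompactSpace (Quot _))
  have hb : Function.Bijective G := by
    constructor
    · intro a b
      induction a using Quot.ind with | _ a =>
      induction b using Quot.ind with | _ b =>
      obtain ⟨j, s⟩ := a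
      obtain ⟨k, t⟩ := b
      intro hab
      change OnePoint.map (fun y => (j, y)) (h.symm s) = OnePoint.map (fun y => (k, y)) (h.symm t)
        at hab
      obtain ⟨u, rfl⟩ := h.surjective s
      obtain ⟨v, rfl⟩ := h.surjective t
      simp only [Homeomorph.symm_apply_apply] at hab
      induction u using OnePoint.rec with
      | infty =>
        induction v using OnePoint.rec with
        | infty => exact Quot.sound ⟨rfl, rfl⟩
        | coe y => exact absurd hab (OnePoint.infty_ne_coe _)
      | coe x =>
        induction v using OnePoint.rec with
        | infty => exact absurd hab (OnePoint.coe_ne_infty _)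
        | coe y =>
          have := OnePoint.coe_injective hab
          simp only [Prod.mk.injEq] at this
          rw [this.1, this.2]
    · intro z
      induction z using OnePoint.rec with
      | infty => exact ⟨Quot.mk _ (⟨0, hN⟩, h OnePoint.infty), by simp [G, g]⟩
      | coe w => exact ⟨Quot.mk _ (w.1, h w.2), by simp [G, g]⟩
  exact ⟨hG.homeoOfEquivCompactToT2 (f := Equiv.ofBijective G hb)⟩


theorem jskJ_card_eq {V ι : Type*} [Fintype V] [DecidableEq V] [Fintype ι] [DecidableEq ι]
    (b : V → ι) (v : ι → V) (s : ι → ℕ) (hbv : ∀ i, b (v i) = i) :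
    (jskJ b v s).card = ∏ i, ((jskO b v i).card).choose (s i) := by
  have : ∏ i, ((jskO b v i).card).choose (s i) =
      (Fintype.piFinset (fun i => Finset.powersetCard (s i) (jskO b v i))).card := by
    rw [Fintype.card_piFinset]
    simp only [Finset.card_powersetCard]
  rw [this]
  refine Finset.card_bij' (fun σ _ => fun i => σ.filter (fun p => b p = i))
    (fun g _ => Finset.univ.filter (fun p => p ∈ g (b p))) ?_ ?_ ?_ ?_
  · intro σ hσ
    rw [jskJ_mem] at hσ
    rw [Fintype.mem_piFinset]
    intro i
    rw [Finset.mem_powersetCard]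
    refine ⟨fun p hp => ?_, (hσ i).1⟩
    rw [Finset.mem_filter] at hp
    simp only [jskO, Finset.mem_filter, Finset.mem_univ, true_and]
    refine ⟨hp.2, ?_⟩
    rintro rfl
    exact (hσ i).2 hp.1
  · intro g hg
    rw [Fintype.mem_piFinset] at hg
    have hO : ∀ i, ∀ p ∈ g i, b p = i ∧ p ≠ v i := by
      intro i p hp
      have h1 := (Finset.mem_powersetCard.1 (hg i)).1 hp
      simpa [jskO] using h1
    rw [jskJ_mem]
    intro i
    constructor
    · rw [← (Finset.mem_powersetCard.1 (hg i)).2]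
      congr 1
      ext p
      simp only [Finset.mem_filter, Finset.mem_univ, true_and]
      constructor
      · rintro ⟨h1, rfl⟩; exact h1
      · intro h1
        have := (hO i p h1).1
        subst this
        exact ⟨h1, rfl⟩
    · simp only [Finset.mem_filter, Finset.mem_univ, true_and, hbv]
      exact fun h => (hO i _ h).2 rfl
  · intro σ _
    ext p
    simp
  · intro g hg
    rw [Fintype.mem_piFinset] at hg
    funext i
    ext p
    simp only [Finset.mem_filter, Finset.mem_univ, true_and]
    constructor
    · rintro ⟨h1, rfl⟩; exact h1
    · intro h1
      have h2 := (Finset.mem_powersetCard.1 (hg i)).1 h1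
      simp only [jskO, Finset.mem_filter, Finset.mem_univ, true_and] at h2
      obtain ⟨rfl, -⟩ := h2
      exact ⟨h1, rfl⟩

theorem jsk_realization_iff (l : ℕ) (d s : Fin l → ℕ) (f : (Σ i : Fin l, Fin (d i)) → ℝ) :
    ((∀ v, 0 ≤ f v) ∧ (∑ v, f v = 1) ∧ ∃ σ ∈ (joinSkeleta l d s).faces, ∀ v, f v ≠ 0 → v ∈ σ) ↔
      JskX (fun p : Σ i : Fin l, Fin (d i) => p.1) s f := by
  refine and_congr Iff.rfl (and_congr_right fun hsum => ?_)
  constructor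
  · rintro ⟨σ, ⟨-, hσ⟩, h⟩ i
    refine le_trans ?_ (hσ i)
    rw [← Set.ncard_coe_finset]
    refine Set.ncard_le_ncard ?_ (Set.toFinite _)
    rintro p ⟨h1, h2⟩
    simp only [Finset.coe_filter, mem_ofPred_eq]
    exact ⟨h p h2, h1⟩
  · intro h
    refine ⟨Finset.univ.filter (fun p => f p ≠ 0), ⟨?_, fun i => ?_⟩, by simp⟩
    · by_contra hne
      rw [Finset.not_nonempty_iff_eq_empty, Finset.filter_eq_empty_iff] at hne
      rw [Finset.sum_eq_zero (fun p hp => by simpa using hne hp)] at hsum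
      exact zero_ne_one hsum
    · refine le_trans (le_of_eq ?_) (h i)
      rw [← Set.ncard_coe_finset]
      congr 1
      ext p
      simp [and_comm]

theorem jsk_main (l : ℕ) (d s : Fin l → ℕ) (hds : ∀ i, s i < d i) (n : ℕ)
    (hn : n + 1 = ∑ i, s i) :
    Nonempty (ContinuousMap.HomotopyEquiv (joinSkeleta l d s).Realization
      (OnePoint (Fin (∏ i, (d i - 1).choose (s i)) × EuclideanSpace ℝ (Fin n)))) := by
  let b : (Σ i : Fin l, Fin (d i)) → Fin l := fun p => p.1
  let v : Fin l → (Σ i : Fin l, Fin (d i)) := fun i => ⟨i, ⟨0, by have := hds i; omega⟩⟩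
  have hbv : ∀ i, b (v i) = i := fun i => rfl
  have hOc : ∀ i, (jskO b v i).card = d i - 1 := by
    intro i
    have h1 : jskO b v i = (Finset.univ.map (Function.Embedding.sigmaMk i)).erase (v i) := by
      ext ⟨j, k⟩
      simp only [jskO, Finset.mem_filter, Finset.mem_univ, true_and, Finset.mem_erase,
        Finset.mem_map, Function.Embedding.sigmaMk_apply, b]
      constructor
      · rintro ⟨rfl, h⟩
        exact ⟨h, k, rfl⟩
      · rintro ⟨h, k', hk'⟩
        exact ⟨(congrArg Sigma.fst hk').symm, h⟩
    rw [h1, Finset.card_erase_of_mem (by simp [v]), Finset.card_map]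
    simp
  have hN : (jskJ b v s).card = ∏ i, (d i - 1).choose (s i) := by
    rw [jskJ_card_eq b v s hbv]
    simp only [hOc]
  obtain ⟨e⟩ := jsk_part_one b v s hbv (fun i => by rw [hOc]; have := hds i; omega) n _ hn hN
  have hh : Nonempty ((joinSkeleta l d s).Realization ≃ₜ {f : _ → ℝ // JskX b s f}) := by
    have hp := jsk_realization_iff l d s
    exact ⟨Homeomorph.subtype (Homeomorph.refl _) hp⟩
  obtain ⟨h⟩ := hh
  exact ⟨h.toHomotopyEquiv.trans e⟩


end

/-- The join of proper skeleta `Δ^{d i - 1}_{(s i - 1)}` (with `s i < d i`) is homotopy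
equivalent to a wedge of `∏ binom (d i - 1) (s i)` spheres of dimension `(∑ s i) - 1`;
hence it is `((∑ s i) - 2)`-connected but not `((∑ s i) - 1)`-connected, provided
`∑ s i ≥ 1`. -/
theorem joinSkeleta_wedge_of_spheres (l : ℕ) (d s : Fin l → ℕ)
    (hds : ∀ i, s i < d i) (hS : 1 ≤ ∑ i, s i) :
    (∃ x0 : Metric.sphere (0 : EuclideanSpace ℝ (Fin (∑ i, s i))) 1,
      Nonempty (ContinuousMap.HomotopyEquiv
        (joinSkeleta l d s).Realization
        (Wedge (Fin (∏ i, (d i - 1).choose (s i)))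
          (Metric.sphere (0 : EuclideanSpace ℝ (Fin (∑ i, s i))) 1) x0))) ∧
    NConnected ((∑ i, s i : ℕ) - 2 : ℤ) (joinSkeleta l d s).Realization ∧
    ¬ NConnected ((∑ i, s i : ℕ) - 1 : ℤ) (joinSkeleta l d s).Realization := by
  obtain ⟨n, hn⟩ : ∃ n, n + 1 = ∑ i, s i := ⟨∑ i, s i - 1, by omega⟩
  obtain ⟨e⟩ := jsk_main l d s hds n hn
  have hN : 0 < ∏ i, (d i - 1).choose (s i) :=
    Finset.prod_pos fun i _ => Nat.choose_pos (by have := hds i; omega)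
  refine ⟨?_, ⟨?_, ?_⟩, ?_⟩
  · let h : OnePoint (EuclideanSpace ℝ (Fin n)) ≃ₜ
        Metric.sphere (0 : EuclideanSpace ℝ (Fin (∑ i, s i))) 1 :=
      onePointEquivSphereOfFinrankEq (by simp [hn])
    obtain ⟨k⟩ := jsk_wedge_homeo h _ hN
    exact ⟨h OnePoint.infty, ⟨e.trans k.symm.toHomotopyEquiv⟩⟩
  · exact ⟨e.invFun OnePoint.infty⟩
  · intro i x hi
    exact jsk_homotopyGroup_subsingleton e (by simp; omega) x
  · rintro ⟨-, hc⟩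
    exact jsk_not_subsingleton ⟨0, hN⟩ n e (fun x => hc n x (by omega))
end
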